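/- With the Calderón–Zygmund decomposition, the truncated kernels and the sets F_s^n, 𝓘_s^{#,n} as in the context, let 𝓜₁ be the set of maximal cubes of 𝓘_s^{#,n} and, inductively, 𝓜_{u+1} the set of maximal cubes of 𝓘_s^{#,n}∖(𝓜₁∪⋯∪𝓜_u); set u₀ := ⌈C₀2^{ds}⌉ and β_u := Σ_{K∈𝓜_u} T_{K,2} b_{k−s}. There exist constants η > 0, δ > 0, C₀ and C' (depending only on d and the constants C, c₁, c₂) such that for every integer s ≥ 200, every w ∈ {0,1/2}^d, every n ≥ 1 and every choice of signs ε_1, …, ε_{u₀} ∈ {−1,1}, ‖ Σ_{u=1}^{u₀} ε_u β_u ‖_{L²(ℝ^d)} ≤ C' 2^{−n} (2^{−δs} λ C_Ω ‖f‖_{L¹(ℝ^d)})^{1/2}. -/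

import Mathlib

open MeasureTheory Metric Set FourierTransform
open scoped ENNReal RealInnerProductSpace

noncomputable section

abbrev Rd (d : ℕ) : Type := EuclideanSpace ℝ (Fin d)

/-- Surface measure on the unit sphere `S^{d-1}`. -/
def sphereMeasure (d : ℕ) : Measure (sphere (0 : Rd d) 1) :=
  (volume : Measure (Rd d)).toSphere

/-- Integral over the sphere of a function defined on `ℝ^d`. -/
def sphInt (d : ℕ) (g : Rd d → ℝ) : ℝ :=
  ∫ θ : sphere (0 : Rd d) 1, g (θ : Rd d) ∂(sphereMeasure d)

/-- `‖Ω‖₁`, the `L¹(S^{d-1})` norm of `Ω`. -/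
def omegaL1 (d : ℕ) (Ω : Rd d → ℝ) : ℝ := sphInt d (fun x => |Ω x|)

/-- `‖Ω‖_{LlogL(S^{d-1})}`. -/
def omegaLlogL (d : ℕ) (Ω : Rd d → ℝ) : ℝ :=
  sphInt d (fun x => |Ω x| * Real.log (2 + |Ω x|))

/-- The constant `C_Ω`. -/
def constCOmega (d : ℕ) (Ω : Rd d → ℝ) : ℝ :=
  omegaLlogL d Ω +
    sphInt d (fun x => |Ω x| * (1 + max (Real.log (|Ω x| / omegaL1 d Ω)) 0))

/-- `Ω` is homogeneous of degree zero on `ℝ^d ∖ {0}`. -/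
def Homogeneous0 (d : ℕ) (Ω : Rd d → ℝ) : Prop :=
  ∀ x : Rd d, x ≠ 0 → ∀ r : ℝ, 0 < r → Ω (r • x) = Ω x

/-- The hypotheses on `Ω`: homogeneity of degree `0`, integrability on the sphere,
the cancellation condition, and `Ω ∈ L log L(S^{d-1})`. -/
def OmegaHyp (d : ℕ) (Ω : Rd d → ℝ) : Prop :=
  Homogeneous0 d Ω ∧
  Integrable (fun θ : sphere (0 : Rd d) 1 => Ω (θ : Rd d)) (sphereMeasure d) ∧
  (∫ θ : sphere (0 : Rd d) 1, Ω (θ : Rd d) ∂(sphereMeasure d)) = 0 ∧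
  Integrable (fun θ : sphere (0 : Rd d) 1 => |Ω (θ : Rd d)| * Real.log (2 + |Ω (θ : Rd d)|))
    (sphereMeasure d)

/-- `φ` is smooth, supported in the annulus `{2^{-4} < |x| < 2^{-2}}` and
satisfies the partition of unity condition `Σ_j φ(2^{-j} x) = 1` for `x ≠ 0`. -/
def AdmissiblePhi (d : ℕ) (φ : Rd d → ℝ) : Prop :=
  ContDiff ℝ (⊤ : ℕ∞) φ ∧
  tsupport φ ⊆ {x : Rd d | (2:ℝ) ^ (-4 : ℤ) < ‖x‖ ∧ ‖x‖ < (2:ℝ) ^ (-2 : ℤ)} ∧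
  ∀ x : Rd d, x ≠ 0 → HasSum (fun j : ℤ => φ ((2:ℝ) ^ (-j) • x)) 1

/-- The kernel `𝒦_j(x) = φ(2^{-j}x) Ω(x) |x|^{-d}`. -/
def Kker (d : ℕ) (φ Om : Rd d → ℝ) (j : ℤ) (x : Rd d) : ℝ :=
  φ ((2:ℝ) ^ (-j) • x) * Om x * ‖x‖ ^ (-(d : ℤ))

/-- The dyadic operator `T_j f = 𝒦_j * f`. -/
def Tj (d : ℕ) (φ Om : Rd d → ℝ) (j : ℤ) (f : Rd d → ℝ) (x : Rd d) : ℝ :=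
  ∫ y, Kker d φ Om j (x - y) * f y

/-- The maximal dyadic truncated operator `T_* f(x) = sup_l |Σ_{j ≥ l} T_j f(x)|`. -/
def TStar (d : ℕ) (φ Om f : Rd d → ℝ) (x : Rd d) : ℝ≥0∞ :=
  ⨆ l : ℤ, ENNReal.ofReal |∑' j : {j : ℤ // l ≤ j}, Tj d φ Om (j : ℤ) f x|

/-- The dyadic cube `2^k w + ∏_i [m_i 2^k, (m_i+1) 2^k)` in the shifted grid `𝔇^w`. -/
def dcube (d : ℕ) (w : Fin d → ℝ) (k : ℤ) (m : Fin d → ℤ) : Set (Rd d) :=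
  {x | ∀ i : Fin d, (2:ℝ) ^ k * (w i + m i) ≤ x i ∧ x i < (2:ℝ) ^ k * (w i + m i + 1)}

/-- The concentric cube `½K` of half the sidelength. -/
def dhalf (d : ℕ) (w : Fin d → ℝ) (k : ℤ) (m : Fin d → ℤ) : Set (Rd d) :=
  {x | ∀ i : Fin d,
    (2:ℝ) ^ k * (w i + m i + 1/4) ≤ x i ∧ x i < (2:ℝ) ^ k * (w i + m i + 3/4)}

/-- `w ∈ {0, 1/2}^d`. -/
def GridShift (d : ℕ) (w : Fin d → ℝ) : Prop := ∀ i, w i = 0 ∨ w i = 1/2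

/-- The Calderón–Zygmund decomposition data at level `λ/C_Ω`: a countable collection
`Qset` of pairwise disjoint standard dyadic cubes and bad functions `b_Q` with
`supp b_Q ⊆ Q`, `∫ b_Q = 0`, `‖b_Q‖₁ ≤ C⟨f⟩_Q |Q|` and `⟨f⟩_Q ≈ λ/C_Ω`. -/
structure CZData (d : ℕ) (COm Cc c₁ c₂ : ℝ) (f : Rd d → ℝ) (lam : ℝ)
    (Qset : Set (ℤ × (Fin d → ℤ))) (b : ℤ × (Fin d → ℤ) → Rd d → ℝ) : Prop where
  pairwise_disjoint : Qset.Pairwise fun q q' =>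
    Disjoint (dcube d 0 q.1 q.2) (dcube d 0 q'.1 q'.2)
  support_subset : ∀ q ∈ Qset, Function.support (b q) ⊆ dcube d 0 q.1 q.2
  integrable : ∀ q ∈ Qset, Integrable (b q)
  integral_zero : ∀ q ∈ Qset, (∫ x, b q x) = 0
  l1_bound : ∀ q ∈ Qset, (∫ x, |b q x|) ≤ Cc * ∫ x in dcube d 0 q.1 q.2, |f x|
  avg_lower : ∀ q ∈ Qset, c₁ * lam / COm ≤
    (∫ x in dcube d 0 q.1 q.2, |f x|) / (volume (dcube d 0 q.1 q.2)).toReal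
  avg_upper : ∀ q ∈ Qset,
    (∫ x in dcube d 0 q.1 q.2, |f x|) / (volume (dcube d 0 q.1 q.2)).toReal ≤ c₂ * lam / COm

/-- `b_m = Σ_{Q ∈ 𝒬, l(Q) = 2^m} b_Q`. -/
def bsum (d : ℕ) (Qset : Set (ℤ × (Fin d → ℤ))) (b : ℤ × (Fin d → ℤ) → Rd d → ℝ)
    (m : ℤ) (x : Rd d) : ℝ :=
  ∑' mv : Fin d → ℤ, Set.indicator Qset (fun q => b q x) (m, mv)

/-- `Ω₁ = Ω·χ_{{|Ω| ≥ 2^{ηs}‖Ω‖₁}}`. -/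
def Omega1 (d : ℕ) (Ω : Rd d → ℝ) (η : ℝ) (s : ℕ) (x : Rd d) : ℝ :=
  if (2:ℝ) ^ (η * s) * omegaL1 d Ω ≤ |Ω x| then Ω x else 0

/-- `Ω₂ = Ω·χ_{{|Ω| < 2^{ηs}‖Ω‖₁}}`. -/
def Omega2 (d : ℕ) (Ω : Rd d → ℝ) (η : ℝ) (s : ℕ) (x : Rd d) : ℝ :=
  if |Ω x| < (2:ℝ) ^ (η * s) * omegaL1 d Ω then Ω x else 0

/-- `T_K g = 𝒦_k * (g·χ_{½K})`, for `K ∈ 𝔇^w` with `l(K) = 2^k` given by `(k, m)`,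
where the kernel is built from the function `Om`. -/
def TKop (d : ℕ) (φ Om : Rd d → ℝ) (w : Fin d → ℝ) (k : ℤ) (m : Fin d → ℤ)
    (g : Rd d → ℝ) (x : Rd d) : ℝ :=
  ∫ y, Kker d φ Om k (x - y) * Set.indicator (dhalf d w k m) g y

/-- The exceptional sets `F_s^n`: `F_s^0 = ℝ^d` and `F_s^{n+1}` is the set where more than
`C₀2^{ds}` of the cubes `K ∈ 𝔇^w` with `K ⊆ F_s^n` and `b_{k-s}χ_{½K} ≠ 0` pile up. -/
def Fset (d : ℕ) (w : Fin d → ℝ) (Qset : Set (ℤ × (Fin d → ℤ)))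
    (b : ℤ × (Fin d → ℤ) → Rd d → ℝ) (s : ℕ) (C₀ : ℝ) : ℕ → Set (Rd d)
  | 0 => Set.univ
  | n + 1 =>
    {x | ENNReal.ofReal (C₀ * (2:ℝ) ^ (d * s)) <
      ∑' km : ℤ × (Fin d → ℤ),
        Set.indicator
          {km' : ℤ × (Fin d → ℤ) |
            dcube d w km'.1 km'.2 ⊆ Fset d w Qset b s C₀ n ∧
            ¬ ((dhalf d w km'.1 km'.2).indicator (bsum d Qset b (km'.1 - (s : ℤ)))
                =ᵐ[(volume : Measure (Rd d))] (fun _ => (0:ℝ)))}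
          (fun km' => (dcube d w km'.1 km'.2).indicator (fun _ => (1:ℝ≥0∞)) x) km}

/-- The partition classes `𝓘_s^{#,n}`: cubes `K ∈ 𝔇^w` with `b_{k-s}χ_{½K} ≠ 0`,
`K ⊆ F_s^{n-1}` and `K ⊄ F_s^n`. -/
def Isharp (d : ℕ) (w : Fin d → ℝ) (Qset : Set (ℤ × (Fin d → ℤ)))
    (b : ℤ × (Fin d → ℤ) → Rd d → ℝ) (s : ℕ) (C₀ : ℝ) (n : ℕ) :
    Set (ℤ × (Fin d → ℤ)) :=
  {km | ¬ ((dhalf d w km.1 km.2).indicator (bsum d Qset b (km.1 - (s : ℤ)))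
        =ᵐ[(volume : Measure (Rd d))] (fun _ => (0:ℝ))) ∧
    dcube d w km.1 km.2 ⊆ Fset d w Qset b s C₀ (n - 1) ∧
    ¬ dcube d w km.1 km.2 ⊆ Fset d w Qset b s C₀ n}

/-- The maximal cubes of a collection `S` of dyadic cubes in the grid `𝔇^w`. -/
def maxCubes (d : ℕ) (w : Fin d → ℝ) (S : Set (ℤ × (Fin d → ℤ))) :
    Set (ℤ × (Fin d → ℤ)) :=
  {km | km ∈ S ∧ ∀ km' ∈ S, dcube d w km.1 km.2 ⊆ dcube d w km'.1 km'.2 → km' = km}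

/-- `restCubes S u = S ∖ (𝓜₁ ∪ ⋯ ∪ 𝓜_u)`, so that `𝓜_{u+1} = maxCubes (restCubes S u)`. -/
def restCubes (d : ℕ) (w : Fin d → ℝ) (S : Set (ℤ × (Fin d → ℤ))) :
    ℕ → Set (ℤ × (Fin d → ℤ))
  | 0 => S
  | u + 1 => restCubes d w S u \ maxCubes d w (restCubes d w S u)

/-- `β_u = Σ_{K ∈ 𝓜_u} T_{K,2} b_{k-s}` (for `u ≥ 1`, with `𝓜_u` the maximal cubes of the
`u`-th generation of the collection `S`). -/
def betaFn (d : ℕ) (φ Om : Rd d → ℝ) (w : Fin d → ℝ) (Qset : Set (ℤ × (Fin d → ℤ)))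
    (b : ℤ × (Fin d → ℤ) → Rd d → ℝ) (s : ℕ) (S : Set (ℤ × (Fin d → ℤ)))
    (u : ℕ) (x : Rd d) : ℝ :=
  ∑' km : ℤ × (Fin d → ℤ),
    Set.indicator (maxCubes d w (restCubes d w S (u - 1)))
      (fun km' => TKop d φ Om w km'.1 km'.2 (bsum d Qset b (km'.1 - (s : ℤ))) x) km

/-- Plancherel's theorem for the classical Fourier transform of a function in `L¹ ∩ L²`. -/
theorem eLpNorm_fourier_eq {E : Type*} [NormedAddCommGroup E] [InnerProductSpace ℝ E]
    [FiniteDimensional ℝ E] [MeasurableSpace E] [BorelSpace E] {f : E → ℂ}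
    (h1 : Integrable f) (h2 : MemLp f 2) : eLpNorm (𝓕 f) 2 volume = eLpNorm f 2 volume := by
  set F : Lp ℂ 2 (volume : Measure E) := h2.toLp f with hF
  have hcont : Continuous (𝓕 f) :=
    VectorFourier.fourierIntegral_continuous (μ := volume) Real.continuous_fourierChar
      continuous_inner h1
  have hae : ∀ᵐ x, (𝓕 F : Lp ℂ 2 (volume : Measure E)) x = 𝓕 f x := by
    apply ae_eq_of_integral_contDiff_smul_eq
    · exact (Lp.memLp _).locallyIntegrable (by norm_num)
    · exact hcont.locallyIntegrable
    · intro g g_smooth g_cpt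
      have hg₁ : HasCompactSupport (Complex.ofRealCLM ∘ g) := g_cpt.comp_left rfl
      have hg₂ : ContDiff ℝ (⊤ : ℕ∞) (Complex.ofRealCLM ∘ g) := by fun_prop
      set G := hg₁.toSchwartzMap hg₂ with hG
      have e1 : ∫ x, g x • (𝓕 F : Lp ℂ 2 (volume : Measure E)) x
          = (Lp.toTemperedDistribution (μ := volume) (𝓕 F : Lp ℂ 2 (volume : Measure E))) G := by
        simp [hG]
      have e2 : ∫ x, g x • 𝓕 f x = ∫ x, G x • 𝓕 f x := by
        simp [hG]
      rw [e1, e2, ← Lp.fourier_toTemperedDistribution_eq, TemperedDistribution.fourier_apply,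
        Lp.toTemperedDistribution_apply]
      have e3 : ∫ x, (𝓕 G) x • F x = ∫ x, (𝓕 G) x • f x := by
        apply integral_congr_ae
        filter_upwards [h2.coeFn_toLp] with x hx
        rw [hF, hx]
      rw [e3]
      have := VectorFourier.integral_fourierIntegral_smul_eq_flip (L := innerₗ E)
        Real.continuous_fourierChar continuous_inner (G.integrable (μ := volume)) h1
      simpa using! this
  rw [← eLpNorm_congr_ae hae, ← eLpNorm_congr_ae h2.coeFn_toLp]
  have := Lp.norm_fourier_eq F
  rw [Lp.norm_def, Lp.norm_def] at this
  exact (ENNReal.toReal_eq_toReal_iff' (Lp.eLpNorm_ne_top _) (Lp.eLpNorm_ne_top _)).1 this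

section RealConvolution

variable {E : Type*} [NormedAddCommGroup E] [InnerProductSpace ℝ E]
    [FiniteDimensional ℝ E] [MeasurableSpace E] [BorelSpace E]

/-- The Fourier transform of a real valued function. -/
def realFourier (g : E → ℝ) : E → ℂ := 𝓕 (fun x => (g x : ℂ))

theorem integral_sub_mul_eq_convolution (K b : E → ℝ) :
    (fun x => ∫ y, K (x - y) * b y)
      = convolution b K (ContinuousLinearMap.mul ℝ ℝ) volume := by
  ext x
  simp [convolution_def, mul_comm]

theorem integrable_integral_sub_mul {K b : E → ℝ} (hK : Integrable K) (hb : Integrable b) :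
    Integrable (fun x => ∫ y, K (x - y) * b y) := by
  rw [integral_sub_mul_eq_convolution]
  exact hb.integrable_convolution _ hK

theorem realFourier_conv {K b : E → ℝ} (hK : Integrable K) (hb : Integrable b) (ξ : E) :
    realFourier (fun x => ∫ y, K (x - y) * b y) ξ = realFourier K ξ * realFourier b ξ := by
  have h := Real.fourier_mul_convolution_eq (f₁ := fun x => (b x : ℂ)) (f₂ := fun x => (K x : ℂ))
    hb.ofReal hK.ofReal ξ
  unfold realFourier
  rw [mul_comm]
  convert h using 2
  ext x
  simp only [convolution_def, ContinuousLinearMap.mul_apply']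
  rw [← integral_complex_ofReal]
  simp [mul_comm]

theorem realFourier_norm_le {g : E → ℝ} (ξ : E) : ‖realFourier g ξ‖ ≤ ∫ x, |g x| := by
  have := VectorFourier.norm_fourierIntegral_le_integral_norm Real.fourierChar volume
    (innerₗ E) (fun x => (g x : ℂ)) ξ
  simpa [realFourier] using! this

theorem realFourier_continuous {g : E → ℝ} (hg : Integrable g) : Continuous (realFourier g) :=
  VectorFourier.fourierIntegral_continuous (μ := volume) Real.continuous_fourierChar
      continuous_inner hg.ofReal

theorem realFourier_add {f g : E → ℝ} (hf : Integrable f) (hg : Integrable g) (ξ : E) :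
    realFourier (fun x => f x + g x) ξ = realFourier f ξ + realFourier g ξ := by
  simp only [realFourier, Real.fourier_eq]
  rw [← integral_add]
  · simp [smul_add]
  · simpa using (Real.fourierIntegral_convergent_iff ξ).2 hf.ofReal
  · simpa using (Real.fourierIntegral_convergent_iff ξ).2 hg.ofReal

theorem realFourier_finset_sum {ι : Type*} (S : Finset ι) {f : ι → E → ℝ}
    (hf : ∀ i ∈ S, Integrable (f i)) (ξ : E) :
    realFourier (fun x => ∑ i ∈ S, f i x) ξ = ∑ i ∈ S, realFourier (f i) ξ := by
  classical
  induction S using Finset.induction_on with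
  | empty => simp [realFourier, Real.fourier_eq]
  | insert a S ha ih =>
    simp only [Finset.sum_insert ha]
    rw [realFourier_add (hf a (by simp)), ih fun i hi => hf i (by simp [hi])]
    exact integrable_finsetSum _ fun i hi => hf i (by simp [hi])

theorem lintegral_realFourier_sq {f : E → ℝ} (h1 : Integrable f) (h2 : MemLp f 2) :
    ∫⁻ ξ, ‖realFourier f ξ‖ₑ ^ 2 = ∫⁻ x, ‖f x‖ₑ ^ 2 := by
  have h := eLpNorm_fourier_eq h1.ofReal (f := fun x => (f x : ℂ)) h2.ofReal
  have e : eLpNorm (fun x => (f x : ℂ)) 2 volume = eLpNorm f 2 volume :=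
    eLpNorm_congr_norm_ae (by simp)
  rw [e, eLpNorm_eq_lintegral_rpow_enorm_toReal (by simp) (by simp),
    eLpNorm_eq_lintegral_rpow_enorm_toReal (by simp) (by simp)] at h
  have h3 := (ENNReal.rpow_left_injective (x := 1 / (2:ℝ≥0∞).toReal) (by norm_num)) h
  simpa [realFourier] using h3

end RealConvolution

section GaussianForm

variable {E : Type*} [NormedAddCommGroup E] [InnerProductSpace ℝ E]
    [FiniteDimensional ℝ E] [MeasurableSpace E] [BorelSpace E]

/-- The `L¹`-normalised Gaussian at scale `a`. -/
def gaussianAt (E : Type*) [NormedAddCommGroup E] [InnerProductSpace ℝ E] (a : ℝ) (u : E) : ℝ :=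
  (a ^ Module.finrank ℝ E)⁻¹ * Real.exp (-Real.pi * (‖u‖ / a) ^ 2)

theorem gaussianAt_eq (a : ℝ) (ha : 0 < a) (x y : E) :
    𝓕 (fun v : E => Complex.exp (-((Real.pi * a ^ 2 : ℝ) : ℂ) * ‖v‖ ^ 2
        + 2 * Real.pi * Complex.I * ⟪x, v⟫)) y
      = (gaussianAt E a (x - y) : ℂ) := by
  rw [fourier_gaussian_innerProductSpace' (by
    rw [Complex.ofReal_re]; positivity)]
  have hpi : (Real.pi : ℂ) ≠ 0 := by exact_mod_cast Real.pi_ne_zero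
  have ha' : (a : ℂ) ≠ 0 := by exact_mod_cast ha.ne'
  unfold gaussianAt
  push_cast
  congr 1
  · have : (Real.pi : ℂ) / (Real.pi * a ^ 2) = (((a ^ 2)⁻¹ : ℝ) : ℂ) := by
      push_cast; field_simp
    rw [this]
    have h2 : ((Module.finrank ℝ E : ℂ) / 2) = (((Module.finrank ℝ E : ℝ) / 2 : ℝ) : ℂ) := by
      push_cast; rfl
    rw [h2, ← Complex.ofReal_cpow (by positivity)]
    rw [← Complex.ofReal_pow, ← Complex.ofReal_inv]
    congr 1
    rw [Real.inv_rpow (by positivity), ← Real.rpow_natCast, ← Real.rpow_mul ha.le]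
    congr 1
    rw [← Real.rpow_natCast]
    congr 1
    push_cast; ring
  · congr 1
    field_simp

theorem integral_gaussian_mul_fourier {b : E → ℝ} (hb : Integrable b) {a : ℝ} (ha : 0 < a) (x : E) :
    ∫ ξ, realFourier b ξ * Complex.exp (-((Real.pi * a ^ 2 : ℝ) : ℂ) * ‖ξ‖ ^ 2
        + 2 * Real.pi * Complex.I * ⟪x, ξ⟫)
      = ((∫ y, gaussianAt E a (x - y) * b y : ℝ) : ℂ) := by
  have hre : 0 < (((Real.pi * a ^ 2 : ℝ) : ℂ)).re := by rw [Complex.ofReal_re]; positivity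
  have J := GaussianFourier.integrable_cexp_neg_mul_sq_norm_add (V := E) hre
      (2 * Real.pi * Complex.I) x
  have h := VectorFourier.integral_fourierIntegral_smul_eq_flip (L := innerₗ E)
        Real.continuous_fourierChar continuous_inner (f := fun x => (b x : ℂ)) hb.ofReal J
  rw [← integral_complex_ofReal]
  rw [flip_innerₗ] at h
  refine Eq.trans h ?_
  refine integral_congr_ae (Filter.Eventually.of_forall fun y => ?_)
  have := gaussianAt_eq a ha x y
  refine (congrArg (fun z : ℂ => (b y : ℂ) • z) this).trans ?_
  simp [mul_comm]

theorem integral_gaussian_form {b : E → ℝ} (hb : Integrable b) {a : ℝ} (ha : 0 < a) :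
    ((∫ ξ, Real.exp (-(Real.pi * a ^ 2) * ‖ξ‖ ^ 2) * ‖realFourier b ξ‖ ^ 2 : ℝ) : ℂ)
      = ((∫ x, b x * ∫ y, gaussianAt E a (x - y) * b y : ℝ) : ℂ) := by
  have hre : 0 < (((Real.pi * a ^ 2 : ℝ) : ℂ)).re := by rw [Complex.ofReal_re]; positivity
  have J := GaussianFourier.integrable_cexp_neg_mul_sq_norm_add (V := E) hre 0 0
  have hG : Integrable (fun ξ => realFourier b ξ *
      Complex.exp (-((Real.pi * a ^ 2 : ℝ) : ℂ) * ‖ξ‖ ^ 2)) := by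
    have J' : Integrable (fun ξ : E => Complex.exp (-((Real.pi * a ^ 2 : ℝ) : ℂ) * ‖ξ‖ ^ 2)) := by
      simpa using J
    exact J'.bdd_mul (c := ∫ x, |b x|) (realFourier_continuous hb).aestronglyMeasurable
      (Filter.Eventually.of_forall fun ξ => realFourier_norm_le ξ)
  have h := VectorFourier.integral_fourierIntegral_smul_eq_flip (L := -innerₗ E)
        Real.continuous_fourierChar continuous_inner.neg (f := fun x => (b x : ℂ)) hb.ofReal hG
  rw [← integral_complex_ofReal, ← integral_complex_ofReal]
  refine Eq.trans ?_ (h.trans ?_)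
  · refine integral_congr_ae (Filter.Eventually.of_forall fun ξ => ?_)
    have hc : VectorFourier.fourierIntegral 𝐞 volume (-innerₗ E) (fun x => (b x : ℂ)) ξ
        = starRingEnd ℂ (realFourier b ξ) := by
      rw [realFourier, Real.fourier_eq, VectorFourier.fourierIntegral, ← integral_conj]
      refine integral_congr_ae (Filter.Eventually.of_forall fun y => ?_)
      simp [Circle.smul_def]
    simp only [hc]
    push_cast
    rw [smul_eq_mul, mul_comm (realFourier b ξ), mul_left_comm, Complex.conj_mul']
  · refine integral_congr_ae (Filter.Eventually.of_forall fun x => ?_)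
    have := integral_gaussian_mul_fourier hb ha x
    simp only [smul_eq_mul, VectorFourier.fourierIntegral]
    push_cast
    rw [← integral_complex_ofReal] at this ⊢
    congr 1
    rw [← this]
    refine integral_congr_ae (Filter.Eventually.of_forall fun ξ => ?_)
    simp only [LinearMap.flip_apply, LinearMap.neg_apply, innerₗ_apply_apply, neg_neg,
      Circle.smul_def, Real.fourierChar_apply, smul_eq_mul, Complex.exp_add]
    push_cast
    ring_nf

theorem lintegral_gaussian_form_le {b : E → ℝ} (hb : Integrable b) {a : ℝ} (ha : 0 < a) :
    ∫⁻ ξ, ENNReal.ofReal (Real.exp (-(Real.pi * a ^ 2) * ‖ξ‖ ^ 2)) * ‖realFourier b ξ‖ₑ ^ 2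
      ≤ ∫⁻ x, ‖b x‖ₑ * ‖∫ y, gaussianAt E a (x - y) * b y‖ₑ := by
  have hre : 0 < (((Real.pi * a ^ 2 : ℝ) : ℂ)).re := by rw [Complex.ofReal_re]; positivity
  have J := (GaussianFourier.integrable_cexp_neg_mul_sq_norm_add (V := E) hre 0 0).norm
  have J' : Integrable (fun ξ : E => Real.exp (-(Real.pi * a ^ 2) * ‖ξ‖ ^ 2)) := by
    refine J.congr (Filter.Eventually.of_forall fun x => ?_)
    simp [Complex.norm_exp]
    norm_cast
    simp
  have hint : Integrable
      (fun ξ => Real.exp (-(Real.pi * a ^ 2) * ‖ξ‖ ^ 2) * ‖realFourier b ξ‖ ^ 2) := by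
    refine J'.mul_bdd (c := (∫ x, |b x|) ^ 2)
      ((realFourier_continuous hb).norm.pow 2).aestronglyMeasurable
      (Filter.Eventually.of_forall fun ξ => ?_)
    rw [norm_pow, norm_norm]
    exact pow_le_pow_left₀ (norm_nonneg _) (realFourier_norm_le ξ) 2
  have h := integral_gaussian_form hb ha
  have h' := Complex.ofReal_injective h
  calc _ = ENNReal.ofReal
        (∫ ξ, Real.exp (-(Real.pi * a ^ 2) * ‖ξ‖ ^ 2) * ‖realFourier b ξ‖ ^ 2) := by
        rw [ofReal_integral_eq_lintegral_ofReal hint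
          (Filter.Eventually.of_forall fun ξ => by positivity)]
        refine lintegral_congr fun ξ => ?_
        rw [ENNReal.ofReal_mul (Real.exp_nonneg _), ENNReal.ofReal_pow (norm_nonneg _),
          ofReal_norm]
    _ ≤ ‖∫ x, b x * ∫ y, gaussianAt E a (x - y) * b y‖ₑ := by
        rw [h']; exact Real.ofReal_le_enorm _
    _ ≤ ∫⁻ x, ‖b x * ∫ y, gaussianAt E a (x - y) * b y‖ₑ := enorm_integral_le_lintegral_enorm _
    _ = _ := by simp_rw [enorm_mul]

end GaussianForm

theorem exp_neg_pi_sq_lipschitz (P : ℕ) : ∃ C : ℝ, 0 < C ∧ ∀ s t : ℝ, 0 ≤ s → s ≤ t →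
    |Real.exp (-Real.pi * t ^ 2) - Real.exp (-Real.pi * s ^ 2)|
      ≤ C * (t - s) * ((1 + s) ^ P)⁻¹ := by
  refine ⟨2 * Real.pi * ((P + 1).factorial * Real.exp 2), by positivity, fun s t hs hst => ?_⟩
  rcases hst.eq_or_lt with rfl | hlt
  · simp
  have hd : ∀ x : ℝ, HasDerivAt (fun x : ℝ => Real.exp (-Real.pi * x ^ 2))
      (Real.exp (-Real.pi * x ^ 2) * (-Real.pi * (2 * x))) x := fun x => by
    have := ((hasDerivAt_pow 2 x).const_mul (-Real.pi)).exp
    simpa using this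
  obtain ⟨c, hc, hc'⟩ := exists_hasDerivAt_eq_slope _ _ hlt
    (fun x _ => (hd x).continuousAt.continuousWithinAt) (fun x _ => hd x)
  have hts : 0 < t - s := sub_pos.2 hlt
  have hc0 : 0 < c := hs.trans_lt hc.1
  have e : Real.exp (-Real.pi * t ^ 2) - Real.exp (-Real.pi * s ^ 2)
      = (Real.exp (-Real.pi * c ^ 2) * (-Real.pi * (2 * c))) * (t - s) := by
    rw [hc']; field_simp
  have hpi := Real.pi_gt_three
  have h1 := Real.pow_div_factorial_le_exp (1 + c) (by positivity) (P + 1)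
  rw [div_le_iff₀ (by positivity)] at h1
  have h2 : Real.exp (1 + c) ≤ Real.exp 2 * Real.exp (Real.pi * c ^ 2) := by
    rw [← Real.exp_add]
    apply Real.exp_le_exp.2
    nlinarith [sq_nonneg (c - 1/2)]
  have key : Real.exp (-Real.pi * c ^ 2) * c * (1 + s) ^ P
      ≤ (P + 1).factorial * Real.exp 2 := by
    have h3 : c * (1 + s) ^ P ≤ (1 + c) ^ (P + 1) := by
      rw [pow_succ, mul_comm]
      gcongr
      · exact hc.1.le
      · linarith
    calc Real.exp (-Real.pi * c ^ 2) * c * (1 + s) ^ P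
        = Real.exp (-Real.pi * c ^ 2) * (c * (1 + s) ^ P) := by ring
      _ ≤ Real.exp (-Real.pi * c ^ 2) * (Real.exp 2 * Real.exp (Real.pi * c ^ 2)
          * (P + 1).factorial) := by
        exact mul_le_mul_of_nonneg_left (h3.trans (h1.trans (by gcongr))) (Real.exp_nonneg _)
      _ = (Real.exp (-Real.pi * c ^ 2) * Real.exp (Real.pi * c ^ 2)) *
          ((P + 1).factorial * Real.exp 2) := by ring
      _ = _ := by rw [← Real.exp_add]; simp
  rw [e, abs_mul, abs_of_pos hts, abs_mul, abs_of_pos (Real.exp_pos _), abs_mul, abs_neg,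
    abs_of_pos Real.pi_pos, abs_of_pos (by positivity : (0:ℝ) < 2 * c)]
  rw [← div_eq_mul_inv, le_div_iff₀ (by positivity)]
  calc _ = 2 * Real.pi * (t - s) * (Real.exp (-Real.pi * c ^ 2) * c * (1 + s) ^ P) := by ring
    _ ≤ 2 * Real.pi * (t - s) * ((P + 1).factorial * Real.exp 2) := by gcongr
    _ = _ := by ring

/-- A mean zero function `b` carried by a set `Q` of diameter at most `ρ`, with
`‖b‖₁ ≤ A |Q|`. -/
structure MeanZeroAtom {E : Type*} [NormedAddCommGroup E] [MeasureSpace E]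
    (Q : Set E) (b : E → ℝ) (A ρ : ℝ) : Prop where
  measurableSet : MeasurableSet Q
  measurable : Measurable b
  integrable : Integrable b
  support_subset : Function.support b ⊆ Q
  integral_zero : ∫ x, b x = 0
  l1_bound : ∫⁻ x, ‖b x‖ₑ ≤ ENNReal.ofReal A * volume Q
  diam : ∀ x ∈ Q, ∀ y ∈ Q, ‖x - y‖ ≤ ρ

/-- A normalised polynomially decaying bump at scale `a`. -/
def polyBump (E : Type*) [NormedAddCommGroup E] [InnerProductSpace ℝ E] (a : ℝ) (u : E) : ℝ :=
  (a ^ Module.finrank ℝ E)⁻¹ * ((1 + ‖u‖ / a) ^ (Module.finrank ℝ E + 1))⁻¹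

theorem polyBump_nonneg {E : Type*} [NormedAddCommGroup E] [InnerProductSpace ℝ E]
    {a : ℝ} (ha : 0 < a) (u : E) : 0 ≤ polyBump E a u := by
  unfold polyBump; positivity

theorem polyBump_le {E : Type*} [NormedAddCommGroup E] [InnerProductSpace ℝ E]
    {a ρ : ℝ} (ha : 0 < a) {u v : E} (huv : ‖u - v‖ ≤ ρ) :
    polyBump E a u ≤ (1 + ρ / a) ^ (Module.finrank ℝ E + 1) * polyBump E a v := by
  have hρ : 0 ≤ ρ := (norm_nonneg _).trans huv
  set d := Module.finrank ℝ E with hd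
  have h1 : ‖v‖ ≤ ‖u‖ + ρ := by
    have := (abs_le.1 ((abs_norm_sub_norm_le u v).trans huv)).1; linarith
  have h2 : (1 + ‖v‖ / a) ≤ (1 + ρ / a) * (1 + ‖u‖ / a) := by
    have : ‖v‖ / a ≤ ‖u‖ / a + ρ / a := by rw [← add_div]; gcongr
    have h3 : 0 ≤ ρ / a * (‖u‖ / a) := by positivity
    nlinarith
  have h4 : ((1 + ‖u‖ / a) ^ (d + 1))⁻¹
      ≤ (1 + ρ / a) ^ (d + 1) * ((1 + ‖v‖ / a) ^ (d + 1))⁻¹ := by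
    rw [← div_eq_mul_inv, inv_eq_one_div, div_le_div_iff₀ (by positivity) (by positivity),
      one_mul, ← mul_pow]
    gcongr
  unfold polyBump
  calc _ ≤ (a ^ d)⁻¹ * ((1 + ρ / a) ^ (d + 1) * ((1 + ‖v‖ / a) ^ (d + 1))⁻¹) := by
        gcongr
    _ = _ := by ring

theorem lintegral_polyBump (E : Type*) [NormedAddCommGroup E] [InnerProductSpace ℝ E]
    [FiniteDimensional ℝ E] [MeasurableSpace E] [BorelSpace E] : ∃ C : ℝ, 0 < C ∧
    ∀ a : ℝ, 0 < a → ∀ x : E, ∫⁻ z, ENNReal.ofReal (polyBump E a (x - z)) ≤ ENNReal.ofReal C := by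
  set d := Module.finrank ℝ E with hd
  have hint : Integrable (fun x : E => (1 + ‖x‖) ^ (-((d:ℝ) + 1))) :=
    integrable_one_add_norm (by simp [hd])
  have hint' : Integrable (fun x : E => ((1 + ‖x‖) ^ (d + 1))⁻¹) := by
    refine hint.congr (Filter.Eventually.of_forall fun x => ?_)
    simp only
    rw [Real.rpow_neg (by positivity)]
    norm_cast
  refine ⟨(∫ x : E, ((1 + ‖x‖) ^ (d + 1))⁻¹) + 1, ?_, fun a ha x => ?_⟩
  · have : 0 ≤ ∫ x : E, ((1 + ‖x‖) ^ (d + 1))⁻¹ := integral_nonneg fun x => by positivity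
    linarith
  have e1 : ∫⁻ z, ENNReal.ofReal (polyBump E a (x - z)) =
      ∫⁻ z, ENNReal.ofReal (polyBump E a z) :=
    lintegral_sub_left_eq_self (fun z => ENNReal.ofReal (polyBump E a z)) x
  have e3 : ∀ z, polyBump E a z
      = (a ^ d)⁻¹ * ((1 + ‖a⁻¹ • z‖) ^ (d + 1))⁻¹ := fun z => by
    rw [polyBump, norm_smul, Real.norm_of_nonneg (by positivity), div_eq_inv_mul]
  rw [e1, ← ofReal_integral_eq_lintegral_ofReal _
    (Filter.Eventually.of_forall fun z => polyBump_nonneg ha z)]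
  · apply ENNReal.ofReal_le_ofReal
    simp_rw [e3]
    rw [integral_const_mul]
    have := Measure.integral_comp_inv_smul (volume : Measure E)
      (fun x : E => ((1 + ‖x‖) ^ (d + 1))⁻¹) a
    rw [this, ← hd, abs_of_pos (by positivity), smul_eq_mul, inv_mul_cancel_left₀ (by positivity)]
    linarith
  · simp_rw [e3]
    exact ((integrable_comp_smul_iff volume _ (inv_ne_zero ha.ne')).2 hint').const_mul _

theorem gaussianAt_sub_le (E : Type*) [NormedAddCommGroup E] [InnerProductSpace ℝ E] :
    ∃ C : ℝ, 0 < C ∧ ∀ a : ℝ, 0 < a → ∀ ρ : ℝ, ∀ u v : E, ‖u - v‖ ≤ ρ →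
      |gaussianAt E a u - gaussianAt E a v|
        ≤ C * (ρ / a) * (1 + ρ / a) ^ (Module.finrank ℝ E + 1) * polyBump E a v := by
  set d := Module.finrank ℝ E with hd
  obtain ⟨C, hC, h⟩ := exp_neg_pi_sq_lipschitz (d + 1)
  refine ⟨C, hC, fun a ha ρ u v huv => ?_⟩
  have hρ : 0 ≤ ρ := (norm_nonneg _).trans huv
  have huv' : |‖u‖ - ‖v‖| ≤ ρ := (abs_norm_sub_norm_le u v).trans huv
  have key : |Real.exp (-Real.pi * (‖u‖ / a) ^ 2) - Real.exp (-Real.pi * (‖v‖ / a) ^ 2)|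
      ≤ C * (ρ / a) * (1 + ρ / a) ^ (d + 1) * ((1 + ‖v‖ / a) ^ (d + 1))⁻¹ := by
    rcases le_total ‖u‖ ‖v‖ with hle | hle
    · rw [abs_sub_comm]
      refine (h _ _ (by positivity) (by gcongr : ‖u‖ / a ≤ ‖v‖ / a)).trans ?_
      have h1 : ‖v‖ ≤ ‖u‖ + ρ := by
        have := (abs_le.1 huv').1; linarith
      have h2 : (1 + ‖v‖ / a) ≤ (1 + ρ / a) * (1 + ‖u‖ / a) := by
        have : ‖v‖ / a ≤ ‖u‖ / a + ρ / a := by rw [← add_div]; gcongr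
        have h3 : 0 ≤ ρ / a * (‖u‖ / a) := by positivity
        nlinarith
      have h4 : ((1 + ‖u‖ / a) ^ (d + 1))⁻¹
          ≤ (1 + ρ / a) ^ (d + 1) * ((1 + ‖v‖ / a) ^ (d + 1))⁻¹ := by
        rw [← div_eq_mul_inv, inv_eq_one_div, div_le_div_iff₀ (by positivity) (by positivity),
          one_mul, ← mul_pow]
        gcongr
      rw [mul_assoc]
      have h5 : ‖v‖ / a - ‖u‖ / a ≤ ρ / a := by
        rw [← sub_div]; gcongr; linarith
      rw [mul_assoc, mul_assoc]
      have h6 : 0 ≤ ((1 + ‖u‖ / a) ^ (d + 1))⁻¹ := by positivity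
      have h7 : 0 ≤ ρ / a := by positivity
      exact mul_le_mul_of_nonneg_left (mul_le_mul h5 h4 h6 h7) hC.le
    · refine (h _ _ (by positivity) (by gcongr : ‖v‖ / a ≤ ‖u‖ / a)).trans ?_
      have h5 : ‖u‖ / a - ‖v‖ / a ≤ ρ / a := by
        rw [← sub_div]; gcongr; have := (abs_le.1 huv').2; linarith
      have h7 : 0 ≤ ρ / a := by positivity
      refine mul_le_mul_of_nonneg_right ?_ (by positivity)
      refine (mul_le_mul_of_nonneg_left h5 hC.le).trans ?_
      exact le_mul_of_one_le_right (by positivity) (one_le_pow₀ (by linarith))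
  unfold gaussianAt polyBump
  rw [← mul_sub, abs_mul, abs_of_pos (by positivity)]
  calc _ ≤ (a ^ d)⁻¹ * (C * (ρ / a) * (1 + ρ / a) ^ (d + 1) * ((1 + ‖v‖ / a) ^ (d + 1))⁻¹) := by
        gcongr
    _ = _ := by ring

theorem continuous_gaussianAt {E : Type*} [NormedAddCommGroup E] [InnerProductSpace ℝ E] (a : ℝ) :
    Continuous (gaussianAt E a) := by
  unfold gaussianAt; fun_prop

theorem continuous_polyBump {E : Type*} [NormedAddCommGroup E] [InnerProductSpace ℝ E]
    {a : ℝ} (ha : 0 < a) : Continuous (polyBump E a) := by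
  unfold polyBump
  refine continuous_const.mul (Continuous.inv₀ (by fun_prop) fun x => by positivity)

theorem abs_gaussianAt_le {E : Type*} [NormedAddCommGroup E] [InnerProductSpace ℝ E]
    {a : ℝ} (ha : 0 < a) (u : E) :
    ‖gaussianAt E a u‖ ≤ (a ^ Module.finrank ℝ E)⁻¹ := by
  unfold gaussianAt
  rw [norm_mul, Real.norm_of_nonneg (by positivity), Real.norm_of_nonneg (by positivity)]
  refine mul_le_of_le_one_right (by positivity) (Real.exp_le_one_iff.2 ?_)
  have := Real.pi_pos
  nlinarith [sq_nonneg (‖u‖ / a)]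

section GaussianCancel

variable {E : Type*} [NormedAddCommGroup E] [InnerProductSpace ℝ E]
    [FiniteDimensional ℝ E] [MeasurableSpace E] [BorelSpace E]

theorem integrable_gaussianAt_mul {b : E → ℝ} (hb : Integrable b) {a : ℝ} (ha : 0 < a) (x : E) :
    Integrable (fun y => gaussianAt E a (x - y) * b y) :=
  hb.bdd_mul (c := (a ^ Module.finrank ℝ E)⁻¹)
    ((continuous_gaussianAt a).comp (by fun_prop)).aestronglyMeasurable
    (Filter.Eventually.of_forall fun y => abs_gaussianAt_le ha _)

theorem gaussian_conv_atoms_le (E : Type*) [NormedAddCommGroup E] [InnerProductSpace ℝ E]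
    [FiniteDimensional ℝ E] [MeasurableSpace E] [BorelSpace E] : ∃ C : ℝ, 0 < C ∧
    ∀ a ρ A : ℝ, 0 < a → 0 ≤ ρ → 0 ≤ A →
    ∀ (ι : Type) (S : Finset ι) (Q : ι → Set E) (b : ι → E → ℝ),
      (∀ i ∈ S, MeanZeroAtom (Q i) (b i) A ρ) → (S : Set ι).PairwiseDisjoint Q →
      ∀ x, ‖∫ y, gaussianAt E a (x - y) * ∑ i ∈ S, b i y‖ₑ
        ≤ ENNReal.ofReal (C * A * (ρ / a) * (1 + ρ / a) ^ (2 * (Module.finrank ℝ E + 1))) := by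
  obtain ⟨C₁, hC₁, h₁⟩ := gaussianAt_sub_le E
  obtain ⟨C₂, hC₂, h₂⟩ := lintegral_polyBump E
  set d := Module.finrank ℝ E with hd
  refine ⟨C₁ * C₂, by positivity, fun a ρ A ha hρ hA ι S Q b hat hdis x => ?_⟩
  set c := C₁ * (ρ / a) * (1 + ρ / a) ^ (d + 1) with hc
  have hc0 : 0 ≤ c := by positivity
  have hone : ∀ i ∈ S, ‖∫ y, gaussianAt E a (x - y) * b i y‖ₑ
      ≤ ENNReal.ofReal (c * A * (1 + ρ / a) ^ (d + 1)) *
        ∫⁻ z in Q i, ENNReal.ofReal (polyBump E a (x - z)) := by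
    intro i hi
    have h := hat i hi
    rcases (Q i).eq_empty_or_nonempty with hQ | ⟨y₀, hy₀⟩
    · have : b i = 0 := by
        rw [← Function.support_eq_empty_iff, ← subset_empty_iff, ← hQ]; exact h.support_subset
      simp [this]
    have e1 : ∫ y, gaussianAt E a (x - y) * b i y
        = ∫ y, (gaussianAt E a (x - y) - gaussianAt E a (x - y₀)) * b i y := by
      simp_rw [sub_mul]
      rw [integral_sub (integrable_gaussianAt_mul h.integrable ha x) (h.integrable.const_mul _),
        integral_const_mul, h.integral_zero, mul_zero, sub_zero]
    calc ‖∫ y, gaussianAt E a (x - y) * b i y‖ₑ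
        ≤ ∫⁻ y, ‖(gaussianAt E a (x - y) - gaussianAt E a (x - y₀)) * b i y‖ₑ := by
          rw [e1]; exact enorm_integral_le_lintegral_enorm _
      _ ≤ ∫⁻ y, ENNReal.ofReal (c * polyBump E a (x - y₀)) * ‖b i y‖ₑ := by
          refine lintegral_mono fun y => ?_
          by_cases hy : y ∈ Q i
          · rw [enorm_mul]
            gcongr
            rw [Real.enorm_eq_ofReal_abs]
            apply ENNReal.ofReal_le_ofReal
            refine h₁ a ha ρ _ _ ?_
            rw [sub_sub_sub_cancel_left]
            exact h.diam _ hy₀ _ hy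
          · have : b i y = 0 := by
              by_contra h0; exact hy (h.support_subset h0)
            simp [this]
      _ = ENNReal.ofReal (c * polyBump E a (x - y₀)) * ∫⁻ y, ‖b i y‖ₑ :=
          lintegral_const_mul _ h.measurable.enorm
      _ ≤ ENNReal.ofReal (c * polyBump E a (x - y₀)) * (ENNReal.ofReal A * volume (Q i)) := by
          gcongr; exact h.l1_bound
      _ = ∫⁻ z in Q i, ENNReal.ofReal (c * A * polyBump E a (x - y₀)) := by
          rw [setLIntegral_const, ← mul_assoc, ← ENNReal.ofReal_mul
            (mul_nonneg hc0 (polyBump_nonneg ha _))]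
          congr 2; ring
      _ ≤ ∫⁻ z in Q i, ENNReal.ofReal (c * A * (1 + ρ / a) ^ (d + 1)) *
            ENNReal.ofReal (polyBump E a (x - z)) := by
          refine setLIntegral_mono' h.measurableSet fun z hz => ?_
          rw [← ENNReal.ofReal_mul (by positivity)]
          apply ENNReal.ofReal_le_ofReal
          rw [mul_assoc (c * A)]
          refine mul_le_mul_of_nonneg_left (polyBump_le ha ?_) (by positivity)
          rw [sub_sub_sub_cancel_left]
          exact h.diam _ hz _ hy₀
      _ = _ := by
          refine lintegral_const_mul _ ?_
          exact ENNReal.measurable_ofReal.comp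
            (((continuous_polyBump ha).comp (by fun_prop)).measurable)
  have e : ∫ y, gaussianAt E a (x - y) * ∑ i ∈ S, b i y
      = ∑ i ∈ S, ∫ y, gaussianAt E a (x - y) * b i y := by
    simp_rw [Finset.mul_sum]
    exact integral_finsetSum _ fun i hi => integrable_gaussianAt_mul (hat i hi).integrable ha x
  rw [e]
  calc _ ≤ ∑ i ∈ S, ‖∫ y, gaussianAt E a (x - y) * b i y‖ₑ := enorm_sum_le _ _
    _ ≤ ∑ i ∈ S, ENNReal.ofReal (c * A * (1 + ρ / a) ^ (d + 1)) *
        ∫⁻ z in Q i, ENNReal.ofReal (polyBump E a (x - z)) := Finset.sum_le_sum hone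
    _ = ENNReal.ofReal (c * A * (1 + ρ / a) ^ (d + 1)) *
        ∫⁻ z in ⋃ i ∈ S, Q i, ENNReal.ofReal (polyBump E a (x - z)) := by
        rw [← Finset.mul_sum, lintegral_biUnion_finset hdis fun i hi => (hat i hi).measurableSet]
    _ ≤ ENNReal.ofReal (c * A * (1 + ρ / a) ^ (d + 1)) * ENNReal.ofReal C₂ := by
        gcongr
        exact (setLIntegral_le_lintegral _ _).trans (h₂ a ha x)
    _ = _ := by
        rw [← ENNReal.ofReal_mul (by positivity)]
        congr 1
        rw [hc]; ring

theorem gaussian_form_atoms_le (E : Type*) [NormedAddCommGroup E] [InnerProductSpace ℝ E]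
    [FiniteDimensional ℝ E] [MeasurableSpace E] [BorelSpace E] : ∃ C : ℝ, 0 < C ∧
    ∀ a ρ A : ℝ, 0 < a → 0 ≤ ρ → 0 ≤ A →
    ∀ (ι : Type) (S : Finset ι) (Q : ι → Set E) (b : ι → E → ℝ),
      (∀ i ∈ S, MeanZeroAtom (Q i) (b i) A ρ) → (S : Set ι).PairwiseDisjoint Q →
      ∫⁻ ξ, ENNReal.ofReal (Real.exp (-(Real.pi * a ^ 2) * ‖ξ‖ ^ 2)) *
          ‖realFourier (fun x => ∑ i ∈ S, b i x) ξ‖ₑ ^ 2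
        ≤ ENNReal.ofReal (C * A ^ 2 * (ρ / a) * (1 + ρ / a) ^ (2 * (Module.finrank ℝ E + 1)))
          * ∑ i ∈ S, volume (Q i) := by
  obtain ⟨C, hC, h⟩ := gaussian_conv_atoms_le E
  refine ⟨C, hC, fun a ρ A ha hρ hA ι S Q b hat hdis => ?_⟩
  set d := Module.finrank ℝ E with hd
  have hint : Integrable (fun x => ∑ i ∈ S, b i x) :=
    integrable_finsetSum _ fun i hi => (hat i hi).integrable
  refine (lintegral_gaussian_form_le hint ha).trans ?_
  calc _ ≤ ∫⁻ x, (∑ i ∈ S, ‖b i x‖ₑ) *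
        ENNReal.ofReal (C * A * (ρ / a) * (1 + ρ / a) ^ (2 * (d + 1))) := by
        refine lintegral_mono fun x => ?_
        gcongr
        · exact enorm_sum_le _ _
        · exact h a ρ A ha hρ hA ι S Q b hat hdis x
    _ = (∑ i ∈ S, ∫⁻ x, ‖b i x‖ₑ) *
        ENNReal.ofReal (C * A * (ρ / a) * (1 + ρ / a) ^ (2 * (d + 1))) := by
        rw [lintegral_mul_const' _ _ ENNReal.ofReal_ne_top, lintegral_finsetSum' _
          fun i hi => (hat i hi).measurable.enorm.aemeasurable]
    _ ≤ (∑ i ∈ S, ENNReal.ofReal A * volume (Q i)) *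
        ENNReal.ofReal (C * A * (ρ / a) * (1 + ρ / a) ^ (2 * (d + 1))) := by
        gcongr with i hi
        exact (hat i hi).l1_bound
    _ = _ := by
        rw [← Finset.mul_sum, mul_right_comm, ← ENNReal.ofReal_mul hA]
        congr 2
        ring

end GaussianCancel

theorem fourier_slice_decay {E : Type*} [NormedAddCommGroup E] [NormedSpace ℝ E]
    (N : ℕ) : ∀ G : ℝ × E → ℂ, ContDiff ℝ (⊤ : ℕ∞) G → HasCompactSupport G →
      ∃ C : ℝ, 0 ≤ C ∧ ∀ (u : E) (t : ℝ), ‖𝓕 (fun r : ℝ => G (r, u)) t‖ * |t| ^ N ≤ C := by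
  have slice_cpt : ∀ G : ℝ × E → ℂ, HasCompactSupport G →
      ∀ u : E, HasCompactSupport (fun r : ℝ => G (r, u)) := fun G hc u => by
    refine HasCompactSupport.intro (hc.isCompact.image continuous_fst) fun r hr => ?_
    by_contra h
    exact hr ⟨(r, u), subset_tsupport _ h, rfl⟩
  induction N with
  | zero =>
    intro G hG hc
    obtain ⟨B, hB⟩ := hc.exists_bound_of_continuous hG.continuous
    have hK := hc.isCompact.image continuous_fst
    set K := Prod.fst '' tsupport G with hKdef
    have hB0 : 0 ≤ B := (norm_nonneg _).trans (hB 0)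
    refine ⟨B * volume.real K, by positivity, fun u t => ?_⟩
    rw [pow_zero, mul_one]
    refine (VectorFourier.norm_fourierIntegral_le_integral_norm _ _ _ _ _).trans ?_
    have hsub : ∀ r, r ∉ K → ‖G (r, u)‖ = 0 := fun r hr => by
      rw [norm_eq_zero]
      by_contra h
      exact hr ⟨(r, u), subset_tsupport _ h, rfl⟩
    rw [← setIntegral_eq_integral_of_forall_compl_eq_zero hsub]
    have := norm_setIntegral_le_of_norm_le_const (μ := volume) (f := fun r => ‖G (r, u)‖) hK.measure_lt_top
      (C := B) (fun r _ => by rw [norm_norm]; exact hB _)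
    exact (Real.le_norm_self _).trans this
  | succ N ih =>
    intro G hG hc
    have hG1 : ContDiff ℝ (⊤ : ℕ∞) (fun p => fderiv ℝ G p (1, 0)) :=
      (hG.fderiv_right (by simp)).clm_apply contDiff_const
    have hc1 : HasCompactSupport (fun p => fderiv ℝ G p (1, 0)) := hc.fderiv_apply ℝ (1, 0)
    obtain ⟨C, hC0, hC⟩ := ih _ hG1 hc1
    refine ⟨C, hC0, fun u t => ?_⟩
    have hd : ∀ r, HasDerivAt (fun r : ℝ => G (r, u)) (fderiv ℝ G (r, u) (1, 0)) r := fun r => by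
      have h1 : HasFDerivAt G (fderiv ℝ G (r, u)) (r, u) :=
        (hG.differentiable (by simp) _).hasFDerivAt
      exact h1.comp_hasDerivAt r ((hasDerivAt_id r).prodMk (hasDerivAt_const r u))
    have hder : deriv (fun r : ℝ => G (r, u)) = fun r => fderiv ℝ G (r, u) (1, 0) :=
      funext fun r => (hd r).deriv
    have hcont : Continuous (fun r : ℝ => G (r, u)) := hG.continuous.comp (by fun_prop)
    have hcont1 : Continuous (fun r : ℝ => fderiv ℝ G (r, u) (1, 0)) :=
      hG1.continuous.comp (by fun_prop : Continuous fun r : ℝ => (r, u))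
    have hF := Real.fourier_deriv (hcont.integrable_of_hasCompactSupport (slice_cpt G hc u))
      (fun r => (hd r).differentiableAt)
      (by rw [hder]; exact hcont1.integrable_of_hasCompactSupport (slice_cpt _ hc1 u))
    have h2 := hC u t
    rw [← hder, hF] at h2
    refine le_trans ?_ h2
    have : ‖(2 * Real.pi * Complex.I * t : ℂ)‖ = 2 * Real.pi * |t| := by
      simp [abs_of_pos Real.pi_pos]
    rw [norm_smul, this, pow_succ]
    have hpi := Real.pi_gt_three
    have h3 : 0 ≤ ‖𝓕 (fun r : ℝ => G (r, u)) t‖ * |t| ^ N * |t| := by positivity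
    nlinarith

theorem AdmissiblePhi.norm_mem {d : ℕ} {φ : Rd d → ℝ} (hφ : AdmissiblePhi d φ) {x : Rd d}
    (hx : φ x ≠ 0) : 1 / 16 < ‖x‖ ∧ ‖x‖ < 1 / 4 := by
  have := hφ.2.1 (subset_tsupport _ hx)
  norm_num at this ⊢
  exact this

/-- A smooth bump on `(1,2)` with integral one. -/
theorem exists_bump_Icc_one_two : ∃ χ : ℝ → ℝ, ContDiff ℝ (⊤ : ℕ∞) χ ∧ (∀ r, 0 ≤ χ r) ∧
    (∀ r, χ r ≠ 0 → 1 ≤ r ∧ r ≤ 2) ∧ ∫ r, χ r = 1 := by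
  let f : ContDiffBump (3 / 2 : ℝ) := ⟨1 / 4, 1 / 2, by norm_num, by norm_num⟩
  refine ⟨f.normed volume, f.contDiff_normed, f.nonneg_normed, fun r hr => ?_, f.integral_normed⟩
  have : r ∈ Function.support (f.normed volume) := hr
  rw [f.support_normed_eq, mem_ball, Real.dist_eq] at this
  have h := abs_lt.1 this
  have e : f.rOut = 1 / 2 := rfl
  rw [e] at h
  constructor <;> linarith [h.1, h.2]

theorem fourier_kernel_dilate {d : ℕ} {φ w : Rd d → ℝ} (hφ : AdmissiblePhi d φ)
    (hw : Homogeneous0 d w) (k : ℤ) (ξ : Rd d) {r : ℝ} (hr1 : 1 ≤ r) (hr2 : r ≤ 2) :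
    realFourier (Kker d φ w k) ξ = ∫ u, ((φ (r • u) : ℝ) : ℂ) *
      (Real.fourierChar (-(r * ⟪u, (2:ℝ) ^ k • ξ⟫)) : ℂ) *
        (({u : Rd d | 1 / 32 ≤ ‖u‖ ∧ ‖u‖ ≤ 1}.indicator (fun u => w u * ‖u‖ ^ (-(d:ℤ))) u : ℝ) : ℂ)
      := by
  have h2k : (0:ℝ) < 2 ^ k := by positivity
  have hr0 : 0 < r := by linarith
  set c := (2:ℝ) ^ k * r with hc
  have hc0 : 0 < c := by positivity
  have h := Measure.integral_comp_smul (volume : Measure (Rd d))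
    (fun x => Real.fourierChar (-⟪x, ξ⟫) • ((Kker d φ w k x : ℝ) : ℂ)) c
  rw [realFourier, Real.fourier_eq]
  have h' : ∫ x, Real.fourierChar (-⟪x, ξ⟫) • ((Kker d φ w k x : ℝ) : ℂ)
      = (c ^ d : ℝ) • ∫ x, Real.fourierChar (-⟪c • x, ξ⟫) • ((Kker d φ w k (c • x) : ℝ) : ℂ) := by
    rw [h, finrank_euclideanSpace_fin, abs_of_pos (by positivity), smul_inv_smul₀ (by positivity)]
  rw [h', ← integral_smul]
  refine integral_congr_ae (Filter.Eventually.of_forall fun u => ?_)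
  have e1 : (2:ℝ) ^ (-k) • c • u = r • u := by
    rw [smul_smul, hc, ← mul_assoc, ← zpow_add₀ (by norm_num)]; simp
  have e2 : ⟪c • u, ξ⟫ = r * ⟪u, (2:ℝ) ^ k • ξ⟫ := by
    rw [real_inner_smul_left, real_inner_smul_right, hc]; ring
  simp only [Kker, e1, e2]
  by_cases hu : φ (r • u) = 0
  · simp [hu]
  have hn := hφ.norm_mem hu
  rw [norm_smul, Real.norm_of_nonneg hr0.le] at hn
  have hmem : u ∈ {u : Rd d | 1 / 32 ≤ ‖u‖ ∧ ‖u‖ ≤ 1} := by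
    constructor <;> nlinarith [norm_nonneg u, hn.1, hn.2]
  have hu0 : u ≠ 0 := by
    rintro rfl; simp at hn; linarith
  rw [indicator_of_mem hmem, hw u hu0 c hc0, norm_smul, Real.norm_of_nonneg hc0.le, mul_zpow]
  have : c ^ d * c ^ (-(d:ℤ)) = 1 := by
    rw [zpow_neg, zpow_natCast, mul_inv_cancel₀ (by positivity)]
  simp only [Circle.smul_def, smul_eq_mul, Complex.real_smul]
  have h3 : (c:ℂ) ^ d * (c:ℂ) ^ (-(d:ℤ)) = 1 := by exact_mod_cast this
  push_cast
  linear_combination (φ (r • u) : ℂ) * (w u) * (‖u‖ : ℂ) ^ (-(d:ℤ)) *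
      (Real.fourierChar (-(r * ⟪u, (2:ℝ) ^ k • ξ⟫)) : ℂ) * h3

theorem kernel_fourier_decay {d : ℕ} {φ : Rd d → ℝ} (hφ : AdmissiblePhi d φ) (N : ℕ) :
    ∃ C : ℝ, 0 < C ∧ ∀ (w : Rd d → ℝ) (M : ℝ), Measurable w → Homogeneous0 d w →
      (∀ x, |w x| ≤ M) → ∀ (ξ : Rd d) (τ : ℝ), 0 < τ →
      (∀ x, w x ≠ 0 → τ * ‖x‖ * ‖ξ‖ ≤ |⟪x, ξ⟫|) → ∀ k : ℤ,
        ‖realFourier (Kker d φ w k) ξ‖ * (τ * ((2:ℝ) ^ k * ‖ξ‖)) ^ N ≤ C * M := by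
  obtain ⟨χ, hχ, hχ0, hχs, hχ1⟩ := exists_bump_Icc_one_two
  have hφ' := hφ.1
  set G : ℝ × Rd d → ℂ := fun p => ((χ p.1 * φ (p.1 • p.2) : ℝ) : ℂ) with hG
  have hGs : ContDiff ℝ (⊤ : ℕ∞) G := by
    apply Complex.ofRealCLM.contDiff.comp
    exact (hχ.comp contDiff_fst).mul (hφ'.comp (contDiff_fst.smul contDiff_snd))
  have hGc : HasCompactSupport G := by
    refine HasCompactSupport.intro (isCompact_Icc.prod (isCompact_closedBall (0 : Rd d) 1))
      (K := Icc (1:ℝ) 2 ×ˢ closedBall (0 : Rd d) 1) fun p hp => ?_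
    by_contra h
    have h1 : χ p.1 ≠ 0 := fun h0 => h (by simp [hG, h0])
    have h2 : φ (p.1 • p.2) ≠ 0 := fun h0 => h (by simp [hG, h0])
    have h3 := hχs _ h1
    have h4 := hφ.norm_mem h2
    rw [norm_smul, Real.norm_of_nonneg (by linarith)] at h4
    refine hp ⟨h3, ?_⟩
    rw [mem_closedBall_zero_iff]
    nlinarith [norm_nonneg p.2, h4.2, h3.1]
  obtain ⟨C, hC0, hC⟩ := fourier_slice_decay N G hGs hGc
  have hχc : HasCompactSupport χ := HasCompactSupport.intro (isCompact_Icc (a := (1:ℝ)) (b := 2))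
    fun r hr => by by_contra h; exact hr (hχs r h)
  have hχi : Integrable χ := hχ.continuous.integrable_of_hasCompactSupport hχc
  have hφc : HasCompactSupport φ :=
    HasCompactSupport.intro (isCompact_closedBall (0 : Rd d) 1) fun x hx => by
      by_contra h
      exact hx (by rw [mem_closedBall_zero_iff]; linarith [(hφ.norm_mem h).2])
  obtain ⟨B, hB⟩ := hφc.exists_bound_of_continuous hφ'.continuous
  set v := volume.real (closedBall (0 : Rd d) 1) with hv
  refine ⟨32 ^ d * v * (C * 32 ^ N) + 1, by positivity, fun w M hwm hw hwM ξ τ hτ hwξ k => ?_⟩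
  have hM : 0 ≤ M := (abs_nonneg _).trans (hwM 0)
  set η := (2:ℝ) ^ k • ξ with hη
  have hηn : ‖η‖ = (2:ℝ) ^ k * ‖ξ‖ := by
    rw [hη, norm_smul, Real.norm_of_nonneg (by positivity)]
  set W := {u : Rd d | 1 / 32 ≤ ‖u‖ ∧ ‖u‖ ≤ 1} with hW
  have hWm : MeasurableSet W :=
    (measurableSet_le measurable_const measurable_norm).inter
      (measurableSet_le measurable_norm measurable_const)
  set V : Rd d → ℝ := W.indicator (fun u => w u * ‖u‖ ^ (-(d:ℤ))) with hV
  have hVm : Measurable V := (hwm.mul (measurable_norm.pow_const _)).indicator hWm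
  have hVle : ∀ u, |V u| ≤ (closedBall (0 : Rd d) 1).indicator (fun _ => M * 32 ^ d) u := by
    intro u
    by_cases hu : u ∈ W
    · have h1 : u ∈ closedBall (0 : Rd d) 1 := by simpa using hu.2
      rw [hV, indicator_of_mem hu, indicator_of_mem h1, abs_mul]
      have hu1 := hu.1
      have h2 : |‖u‖ ^ (-(d:ℤ))| ≤ 32 ^ d := by
        rw [abs_of_nonneg (by positivity), zpow_neg, zpow_natCast, ← inv_pow]
        gcongr
        rw [inv_le_comm₀ (by linarith) (by norm_num)]
        linarith
      gcongr
      exact hwM u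
    · rw [hV, indicator_of_notMem hu, abs_zero]
      exact indicator_nonneg (fun _ _ => by positivity) _
  have hIi : Integrable ((closedBall (0 : Rd d) 1).indicator (fun _ => M * (32:ℝ) ^ d)) :=
    (integrable_indicator_iff measurableSet_closedBall).2
      (integrableOn_const (by exact measure_closedBall_lt_top.ne))
  have hVi : Integrable V := hIi.mono' hVm.aestronglyMeasurable
    (Filter.Eventually.of_forall hVle)
  have hVint : ∫ u, |V u| ≤ M * 32 ^ d * v := by
    refine (integral_mono hVi.abs hIi hVle).trans (le_of_eq ?_)
    rw [integral_indicator measurableSet_closedBall, setIntegral_const, smul_eq_mul, mul_comm]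
  have rep : realFourier (Kker d φ w k) ξ
      = ∫ u, (V u : ℂ) * 𝓕 (fun r : ℝ => G (r, u)) ⟪u, η⟫ := by
    have e1 : realFourier (Kker d φ w k) ξ = ∫ r : ℝ, ∫ u, (χ r : ℂ) * (((φ (r • u) : ℝ) : ℂ) *
      (Real.fourierChar (-(r * ⟪u, η⟫)) : ℂ) * (V u : ℂ)) := by
      have : ∀ r : ℝ, ∫ u, (χ r : ℂ) * (((φ (r • u) : ℝ) : ℂ) *
          (Real.fourierChar (-(r * ⟪u, η⟫)) : ℂ) * (V u : ℂ))
          = (χ r : ℂ) * realFourier (Kker d φ w k) ξ := fun r => by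
        by_cases hr : χ r = 0
        · simp [hr]
        · rw [integral_const_mul, fourier_kernel_dilate hφ hw k ξ (hχs r hr).1 (hχs r hr).2]
      simp_rw [this]
      rw [integral_mul_const, integral_complex_ofReal, hχ1]
      simp
    rw [e1, integral_integral_swap]
    · refine integral_congr_ae (Filter.Eventually.of_forall fun u => ?_)
      simp only [Real.fourier_eq, hG, ← integral_const_mul]
      refine integral_congr_ae (Filter.Eventually.of_forall fun r => ?_)
      simp only [Circle.smul_def, smul_eq_mul, RCLike.inner_apply]
      push_cast
      simp [mul_comm r]
      ring
    · have h1 : Integrable (fun p : ℝ × Rd d => (χ p.1 : ℂ) * (V p.2 : ℂ)) :=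
        hχi.ofReal.mul_prod hVi.ofReal
      have h2 := h1.bdd_mul (c := B)
        (f := fun p : ℝ × Rd d => ((φ (p.1 • p.2) : ℝ) : ℂ) *
          (Real.fourierChar (-(p.1 * ⟪p.2, η⟫)) : ℂ))
        (Continuous.aestronglyMeasurable (by
          have := hφ'.continuous
          have := Real.continuous_fourierChar
          fun_prop)) (Filter.Eventually.of_forall fun p => by
            rw [norm_mul, Circle.norm_coe, mul_one, Complex.norm_real]
            exact hB _)
      refine h2.congr (Filter.Eventually.of_forall fun p => ?_)
      simp only [Function.uncurry]
      ring
  have hptw : ∀ u, ‖(V u : ℂ) * 𝓕 (fun r : ℝ => G (r, u)) ⟪u, η⟫‖ * (τ * ‖η‖) ^ N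
      ≤ |V u| * (C * 32 ^ N) := fun u => by
    rw [norm_mul, Complex.norm_real, Real.norm_eq_abs, mul_assoc]
    by_cases hu : V u = 0
    · simp [hu]
    have huW : u ∈ W := by
      by_contra h; exact hu (indicator_of_notMem h _)
    have hwu : w u ≠ 0 := fun h => hu (by rw [hV, indicator_of_mem huW, h, zero_mul])
    have h1 : τ * ‖η‖ ≤ 32 * |⟪u, η⟫| := by
      have h2 := hwξ u hwu
      rw [hη, real_inner_smul_right, ← hη, abs_mul, abs_of_pos (by positivity : (0:ℝ) < 2 ^ k),
        hηn]
      have h3 := huW.1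
      have h4 : (0:ℝ) < 2 ^ k := by positivity
      have h5 : τ * ‖ξ‖ ≤ 32 * |⟪u, ξ⟫| := by
        have : 0 ≤ τ * ‖ξ‖ := by positivity
        nlinarith
      nlinarith
    refine mul_le_mul_of_nonneg_left ?_ (abs_nonneg _)
    calc _ ≤ ‖𝓕 (fun r : ℝ => G (r, u)) ⟪u, η⟫‖ * (32 * |⟪u, η⟫|) ^ N :=
          mul_le_mul_of_nonneg_left (pow_le_pow_left₀ (by positivity) h1 N) (norm_nonneg _)
      _ = (‖𝓕 (fun r : ℝ => G (r, u)) ⟪u, η⟫‖ * |⟪u, η⟫| ^ N) * 32 ^ N := by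
        rw [mul_pow]; ring
      _ ≤ C * 32 ^ N := mul_le_mul_of_nonneg_right (hC u _) (by positivity)
  rw [← hηn, rep]
  calc _ ≤ (∫ u, ‖(V u : ℂ) * 𝓕 (fun r : ℝ => G (r, u)) ⟪u, η⟫‖) * (τ * ‖η‖) ^ N := by
        gcongr; exact norm_integral_le_integral_norm _
    _ = ∫ u, ‖(V u : ℂ) * 𝓕 (fun r : ℝ => G (r, u)) ⟪u, η⟫‖ * (τ * ‖η‖) ^ N := by
        rw [integral_mul_const]
    _ ≤ ∫ u, |V u| * (C * 32 ^ N) := by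
        refine integral_mono_of_nonneg (Filter.Eventually.of_forall fun u => by positivity)
          (hVi.abs.mul_const _) (Filter.Eventually.of_forall hptw)
    _ ≤ M * 32 ^ d * v * (C * 32 ^ N) := by
        rw [integral_mul_const]; gcongr
    _ ≤ _ := by nlinarith

/-- Double counting for the product of two measures. -/
theorem mul_measure_le_mul_measure_of_sections {α β : Type*} [MeasurableSpace α]
    [MeasurableSpace β] (μ : Measure α) (ν : Measure β) [SFinite μ] [SFinite ν]
    {P : Set (α × β)} (hP : MeasurableSet P) {A : Set α} {B : Set β} {a m : ℝ≥0∞}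
    (hA : ∀ x ∈ A, a ≤ ν {y | (x, y) ∈ P}) (hB : ∀ y ∈ B, μ {x | (x, y) ∈ P} ≤ m)
    (hPB : ∀ p ∈ P, p.2 ∈ B) : a * μ A ≤ m * ν B := by
  have h1 : a * μ A ≤ (μ.prod ν) P := by
    rw [Measure.prod_apply hP, ← setLIntegral_const]
    exact (setLIntegral_mono (measurable_measure_prodMk_left hP) hA).trans
      (setLIntegral_le_lintegral _ _)
  refine h1.trans ?_
  rw [Measure.prod_apply_symm hP]
  refine le_trans (lintegral_mono fun y => ?_) (lintegral_indicator_const_le B m)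
  by_cases hy : y ∈ B
  · rw [indicator_of_mem hy]; exact hB y hy
  · have : (fun x => (x, y)) ⁻¹' P = ∅ := by
      ext x; simpa using fun h => hy (hPB _ h)
    simp [this]

theorem volume_shell_le {d : ℕ} {W Y : Set (Rd d)} (hW : MeasurableSet W) {t : ℝ}
    (hWt : ∀ v ∈ W, |‖v‖ - 1| ≤ t) (hY : ∀ ρ ∈ Icc (1:ℝ) 2, ∀ v ∈ W, ρ • v ∈ Y) :
    volume W ≤ ENNReal.ofReal (4 * t) * volume Y := by
  have hP : MeasurableSet {p : ℝ × Rd d | p.1 ∈ Icc (1:ℝ) 2 ∧ p.1⁻¹ • p.2 ∈ W} := by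
    refine (measurable_fst measurableSet_Icc).inter ?_
    have : Measurable fun p : ℝ × Rd d => p.1⁻¹ • p.2 := by fun_prop
    exact this hW
  have key := mul_measure_le_mul_measure_of_sections (volume : Measure ℝ)
    (volume : Measure (Rd d)) hP (A := Icc 1 2) (B := Y) (a := volume W)
    (m := ENNReal.ofReal (4 * t)) ?_ ?_ ?_
  · simpa [show (2:ℝ) - 1 = 1 by norm_num] using key
  · intro ρ hρ
    have hρ0 : 0 < ρ := by linarith [hρ.1]
    have : {y : Rd d | (ρ, y) ∈ {p : ℝ × Rd d | p.1 ∈ Icc (1:ℝ) 2 ∧ p.1⁻¹ • p.2 ∈ W}}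
        = (fun y => ρ⁻¹ • y) ⁻¹' W := by
      ext y; simpa using fun _ => hρ
    rw [this, Measure.addHaar_preimage_smul _ (by positivity)]
    refine le_mul_of_one_le_left zero_le ?_
    rw [ENNReal.one_le_ofReal, abs_of_pos (by positivity), inv_pow, inv_inv]
    exact one_le_pow₀ hρ.1
  · intro y _
    have : {ρ : ℝ | (ρ, y) ∈ {p : ℝ × Rd d | p.1 ∈ Icc (1:ℝ) 2 ∧ p.1⁻¹ • p.2 ∈ W}}
        ⊆ Icc (‖y‖ - 2 * t) (‖y‖ + 2 * t) := by
      rintro ρ ⟨hρ, h⟩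
      have hρ0 : 0 < ρ := by linarith [hρ.1]
      have h1 := hWt _ h
      rw [norm_smul, Real.norm_of_nonneg (by positivity)] at h1
      have h2 : |‖y‖ - ρ| ≤ ρ * t := by
        have : ‖y‖ - ρ = ρ * (ρ⁻¹ * ‖y‖ - 1) := by field_simp
        rw [this, abs_mul, abs_of_pos hρ0]
        gcongr
      have ht : 0 ≤ t := (abs_nonneg _).trans h1
      have h3 : ρ * t ≤ 2 * t := by gcongr; exact hρ.2
      have := abs_le.1 h2
      constructor <;> linarith
    refine (measure_mono this).trans ?_
    rw [Real.volume_Icc]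
    exact ENNReal.ofReal_le_ofReal (by linarith)
  · rintro ⟨ρ, y⟩ ⟨hρ, h⟩
    have hρ0 : ρ ≠ 0 := by have := hρ.1; simp only at this; intro h; linarith
    have := hY ρ hρ _ h
    simpa [smul_inv_smul₀ hρ0] using this

theorem volume_slab_le {d : ℕ} {ω : Rd d} (hω : ‖ω‖ = 1) (B t : ℝ) :
    volume {v : Rd d | ‖v‖ ≤ B ∧ |⟪v, ω⟫| ≤ t}
      ≤ ENNReal.ofReal (2 * t) * volume (closedBall (0 : Rd d) (B + 1)) := by
  set Y := {v : Rd d | ‖v‖ ≤ B ∧ |⟪v, ω⟫| ≤ t}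
  have hYm : MeasurableSet Y := by
    have : Continuous fun v : Rd d => |⟪v, ω⟫| := by fun_prop
    exact (measurableSet_le measurable_norm measurable_const).inter
      (measurableSet_le this.measurable measurable_const)
  have hP : MeasurableSet {p : ℝ × Rd d | p.1 ∈ Icc (0:ℝ) 1 ∧ p.2 - p.1 • ω ∈ Y} := by
    refine (measurable_fst measurableSet_Icc).inter ?_
    have : Measurable fun p : ℝ × Rd d => p.2 - p.1 • ω := by fun_prop
    exact this hYm
  have key := mul_measure_le_mul_measure_of_sections (volume : Measure ℝ)
    (volume : Measure (Rd d)) hP (A := Icc 0 1) (B := closedBall (0 : Rd d) (B + 1))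
    (a := volume Y) (m := ENNReal.ofReal (2 * t)) ?_ ?_ ?_
  · simpa using key
  · intro r hr
    have : {y : Rd d | (r, y) ∈ {p : ℝ × Rd d | p.1 ∈ Icc (0:ℝ) 1 ∧ p.2 - p.1 • ω ∈ Y}}
        = (fun y => y - r • ω) ⁻¹' Y := by
      ext y; simpa using fun _ => hr
    rw [this]; simp_rw [sub_eq_add_neg]; rw [measure_preimage_add_right]
  · intro y _
    have : {r : ℝ | (r, y) ∈ {p : ℝ × Rd d | p.1 ∈ Icc (0:ℝ) 1 ∧ p.2 - p.1 • ω ∈ Y}}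
        ⊆ Icc (⟪y, ω⟫ - t) (⟪y, ω⟫ + t) := by
      rintro r ⟨_, _, h⟩
      simp only [inner_sub_left, real_inner_smul_left, real_inner_self_eq_norm_sq, hω] at h
      have := abs_le.1 h
      constructor <;> linarith
    refine (measure_mono this).trans ?_
    rw [Real.volume_Icc]
    exact ENNReal.ofReal_le_ofReal (by linarith)
  · rintro ⟨r, y⟩ ⟨hr, h, _⟩
    rw [mem_closedBall_zero_iff]
    have hr' : ‖r • ω‖ ≤ 1 := by
      rw [norm_smul, hω, Real.norm_of_nonneg hr.1, mul_one]; exact hr.2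
    have : y = (y - r • ω) + r • ω := by simp
    simp only at h ⊢
    rw [this]
    exact (norm_add_le _ _).trans (by linarith)

/-- The `δ`-neighbourhood of the segment `{r e : |r| ≤ L}`. -/
def tube {d : ℕ} (L δ : ℝ) (e : Rd d) : Set (Rd d) := {v | ∃ r, |r| ≤ L ∧ ‖v - r • e‖ ≤ δ}

theorem volume_tube_le {d : ℕ} {L δ D : ℝ} (hδ : 0 < δ) (hδL : δ ≤ L) {e : Rd d} (he : ‖e‖ ≤ D) :
    ENNReal.ofReal (2 * δ) * volume (tube L δ e)
      ≤ ENNReal.ofReal (4 * L * ((1 + D) * δ) ^ d) * volume (closedBall (0 : Rd d) 1) := by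
  have hD : 0 ≤ D := (norm_nonneg e).trans he
  have hP : MeasurableSet {p : Rd d × ℝ | p.2 ∈ Icc (-(2 * L)) (2 * L) ∧
      ‖p.1 - p.2 • e‖ ≤ (1 + D) * δ} := by
    have : Continuous fun p : Rd d × ℝ => ‖p.1 - p.2 • e‖ := by fun_prop
    exact (measurable_snd measurableSet_Icc).inter
      (measurableSet_le this.measurable measurable_const)
  have key := mul_measure_le_mul_measure_of_sections (volume : Measure (Rd d))
    (volume : Measure ℝ) hP (A := tube L δ e) (B := Icc (-(2 * L)) (2 * L))
    (a := ENNReal.ofReal (2 * δ))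
    (m := ENNReal.ofReal (((1 + D) * δ) ^ d) * volume (closedBall (0 : Rd d) 1)) ?_ ?_ ?_
  · refine key.trans (le_of_eq ?_)
    rw [Real.volume_Icc, show 2 * L - -(2 * L) = 4 * L by ring,
      ENNReal.ofReal_mul (by linarith : (0:ℝ) ≤ 4 * L)]
    ring
  · rintro v ⟨r, hr, hv⟩
    have h : Icc (r - δ) (r + δ) ⊆ {y | (v, y) ∈ {p : Rd d × ℝ |
        p.2 ∈ Icc (-(2 * L)) (2 * L) ∧ ‖p.1 - p.2 • e‖ ≤ (1 + D) * δ}} := by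
      intro r' hr'
      have h1 := abs_le.1 hr
      refine ⟨⟨by linarith [hr'.1], by linarith [hr'.2]⟩, ?_⟩
      have : v - r' • e = (v - r • e) + (r - r') • e := by rw [sub_smul]; abel
      simp only
      rw [this]
      refine (norm_add_le _ _).trans ?_
      have h2 : ‖(r - r') • e‖ ≤ δ * D := by
        rw [norm_smul, Real.norm_eq_abs]
        gcongr
        rw [abs_le]; constructor <;> linarith [hr'.1, hr'.2]
      linarith
    refine le_trans (le_of_eq ?_) (measure_mono h)
    rw [Real.volume_Icc]; congr 1; ring
  · intro r _
    have : {v | (v, r) ∈ {p : Rd d × ℝ | p.2 ∈ Icc (-(2 * L)) (2 * L) ∧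
        ‖p.1 - p.2 • e‖ ≤ (1 + D) * δ}} ⊆ closedBall (r • e) ((1 + D) * δ) := by
      rintro v ⟨_, h⟩
      rwa [mem_closedBall, dist_eq_norm]
    refine (measure_mono this).trans (le_of_eq ?_)
    rw [Measure.addHaar_closedBall _ _ (by positivity), finrank_euclideanSpace_fin,
      Measure.addHaar_unitClosedBall_eq_addHaar_unitBall]
  · rintro ⟨v, r⟩ ⟨h, _⟩
    exact h

theorem norm_le_sqrt_mul_of_forall_abs_le {d : ℕ} {v : Rd d} {t : ℝ} (ht : 0 ≤ t)
    (h : ∀ i, |v i| ≤ t) : ‖v‖ ≤ √d * t := by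
  rw [EuclideanSpace.norm_eq]
  calc √(∑ i, ‖v i‖ ^ 2) ≤ √(∑ _i : Fin d, t ^ 2) := by
        gcongr with i; exact h i
    _ = √d * t := by
        rw [Finset.sum_const, Finset.card_univ, Fintype.card_fin, nsmul_eq_mul,
          Real.sqrt_mul (by positivity), Real.sqrt_sq ht]

theorem volume_box {d : ℕ} (a : Fin d → ℝ) (l : ℝ) :
    volume {x : Rd d | ∀ i, a i ≤ x i ∧ x i < a i + l} = ENNReal.ofReal l ^ d := by
  have h := (PiLp.volume_preserving_ofLp (Fin d)).measure_preimage
    (s := univ.pi fun i => Ico (a i) (a i + l))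
    (MeasurableSet.univ_pi fun i => measurableSet_Ico).nullMeasurableSet
  have e : (WithLp.ofLp ⁻¹' (univ.pi fun i => Ico (a i) (a i + l)) : Set (Rd d))
      = {x : Rd d | ∀ i, a i ≤ x i ∧ x i < a i + l} := by
    ext x; simp [Set.mem_pi]
  rw [e] at h
  rw [h, Real.volume_pi_Ico]
  simp

theorem measurableSet_box {d : ℕ} (a b : Fin d → ℝ) :
    MeasurableSet {x : Rd d | ∀ i, a i ≤ x i ∧ x i < b i} := by
  simp only [Set.ofPred_forall]
  refine MeasurableSet.iInter fun i => ?_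
  have : Measurable fun x : Rd d => x i := by fun_prop
  exact (measurableSet_le measurable_const this).inter (measurableSet_lt this measurable_const)

/-- The index of the angular cell of aperture `1 / R` containing the direction of `x`. -/
def cellIdx {d : ℕ} (R : ℝ) (x : Rd d) : Fin d → ℤ := fun i => ⌊R * (x i / ‖x‖)⌋

theorem measurable_cellIdx {d : ℕ} (R : ℝ) : Measurable (cellIdx R : Rd d → Fin d → ℤ) := by
  refine measurable_pi_iff.2 fun i => Int.measurable_floor.comp ?_
  fun_prop

theorem cellIdx_smul {d : ℕ} (R : ℝ) (x : Rd d) {r : ℝ} (hr : 0 < r) :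
    cellIdx R (r • x) = cellIdx R x := by
  ext i
  simp only [cellIdx, norm_smul, Real.norm_of_nonneg hr.le, PiLp.smul_apply, smul_eq_mul]
  rw [mul_div_mul_left _ _ hr.ne']

/-- The vector `μ / R`. -/
def cellDir {d : ℕ} (R : ℝ) (μ : Fin d → ℤ) : Rd d := WithLp.toLp 2 fun i => (μ i : ℝ) / R

theorem norm_sub_smul_cellDir_le {d : ℕ} {R : ℝ} (hR : 0 < R) (x : Rd d) :
    ‖x - ‖x‖ • cellDir R (cellIdx R x)‖ ≤ √d * (‖x‖ / R) := by
  refine norm_le_sqrt_mul_of_forall_abs_le (by positivity) fun i => ?_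
  by_cases hx : x = 0
  · simp [hx]
  have hx' : 0 < ‖x‖ := norm_pos_iff.2 hx
  have h1 := Int.floor_le (R * (x i / ‖x‖))
  have h2 := Int.lt_floor_add_one (R * (x i / ‖x‖))
  have e : (x - ‖x‖ • cellDir R (cellIdx R x)) i
      = ‖x‖ / R * (R * (x i / ‖x‖) - ⌊R * (x i / ‖x‖)⌋) := by
    simp only [cellDir, cellIdx, PiLp.sub_apply, PiLp.smul_apply, smul_eq_mul]
    field_simp
  rw [e, abs_mul, abs_of_pos (by positivity)]
  refine mul_le_of_le_one_right (by positivity) ?_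
  rw [abs_le]; constructor <;> linarith

theorem norm_cellDir_le {d : ℕ} {R : ℝ} (hR : 1 ≤ R) {x : Rd d} (hx : x ≠ 0) :
    ‖cellDir R (cellIdx R x)‖ ≤ 1 + √d := by
  have hx' : 0 < ‖x‖ := norm_pos_iff.2 hx
  have h := norm_sub_smul_cellDir_le (by linarith : 0 < R) x
  have h1 : ‖‖x‖ • cellDir R (cellIdx R x)‖ ≤ ‖x‖ + √d * (‖x‖ / R) := by
    have := norm_sub_norm_le (‖x‖ • cellDir R (cellIdx R x)) x
    rw [norm_sub_rev] at this
    linarith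
  rw [norm_smul, norm_norm] at h1
  have h2 : ‖x‖ / R ≤ ‖x‖ := div_le_self hx'.le hR
  have h3 : √d * (‖x‖ / R) ≤ √d * ‖x‖ := by gcongr
  nlinarith

theorem card_mul_le_volume {d : ℕ} {R : ℝ} (hR : 0 < R) (S : Finset (Fin d → ℤ)) {W : Set (Rd d)}
    (hW : ∀ v : Rd d, (fun i => ⌊R * v i⌋) ∈ S → v ∈ W) :
    (S.card : ℝ≥0∞) * ENNReal.ofReal R⁻¹ ^ d ≤ volume W := by
  set c : (Fin d → ℤ) → Set (Rd d) := fun μ =>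
    {x : Rd d | ∀ i, (μ i : ℝ) / R ≤ x i ∧ x i < (μ i : ℝ) / R + R⁻¹} with hc
  have hcm : ∀ μ, ∀ v ∈ c μ, (fun i => ⌊R * v i⌋) = μ := by
    intro μ v hv
    ext i
    have := hv i
    rw [Int.floor_eq_iff]
    have h1 := mul_le_mul_of_nonneg_left this.1 hR.le
    have h2 := mul_lt_mul_of_pos_left this.2 hR
    rw [mul_add, mul_inv_cancel₀ hR.ne', mul_div_cancel₀ _ hR.ne'] at h2
    rw [mul_div_cancel₀ _ hR.ne'] at h1
    exact ⟨h1, h2⟩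
  have hd : (S : Set (Fin d → ℤ)).PairwiseDisjoint c := by
    intro μ _ ν _ hμν
    rw [Function.onFun, Set.disjoint_left]
    intro v h1 h2
    exact hμν ((hcm _ _ h1).symm.trans (hcm _ _ h2))
  have := measure_biUnion_finset (μ := volume) hd fun μ _ => measurableSet_box _ _
  calc _ = ∑ μ ∈ S, volume (c μ) := by
        simp [hc, volume_box]
    _ = volume (⋃ μ ∈ S, c μ) := this.symm
    _ ≤ volume W := by
        refine measure_mono fun v hv => ?_
        simp only [mem_iUnion] at hv
        obtain ⟨μ, hμ, hv⟩ := hv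
        exact hW v (by rwa [hcm _ _ hv])

theorem card_le_of_volume_le {d : ℕ} {R C : ℝ} (hR : 0 < R) (hC : 0 ≤ C) {S : Finset (Fin d → ℤ)}
    {W : Set (Rd d)}
    (hW : ∀ v : Rd d, (fun i => ⌊R * v i⌋) ∈ S → v ∈ W) (hWC : volume W ≤ ENNReal.ofReal C) :
    (S.card : ℝ) ≤ C * R ^ d := by
  have h := (card_mul_le_volume hR S hW).trans hWC
  rw [← ENNReal.ofReal_pow (by positivity), ← ENNReal.ofReal_natCast,
    ← ENNReal.ofReal_mul (by positivity), ENNReal.ofReal_le_ofReal_iff hC, inv_pow,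
    ← div_eq_mul_inv, div_le_iff₀ (by positivity)] at h
  exact h

theorem exists_cell_count (d : ℕ) : ∃ C : ℝ, 0 < C ∧ ∀ R : ℝ, 1 ≤ R →
    ∃ J : Finset (Fin d → ℤ), (∀ x : Rd d, x ≠ 0 → cellIdx R x ∈ J) ∧
      (J.card : ℝ) ≤ C * R⁻¹ * R ^ d ∧ ∀ ξ : Rd d, ξ ≠ 0 → ∃ J' ⊆ J,
        (J'.card : ℝ) ≤ C * R⁻¹ ^ 2 * R ^ d ∧ ∀ x : Rd d, x ≠ 0 → cellIdx R x ∉ J' →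
          R⁻¹ * ‖x‖ * ‖ξ‖ ≤ |⟪x, ξ⟫| := by
  classical
  set D := 1 + √(d:ℝ) with hD
  have hD1 : 1 ≤ D := by rw [hD]; linarith [Real.sqrt_nonneg (d:ℝ)]
  have hfin : ∀ r : ℝ, volume (closedBall (0 : Rd d) r) ≠ ∞ := fun r =>
    measure_closedBall_lt_top.ne
  set V := volume.real (closedBall (0 : Rd d) (2 * D + 3)) with hV
  have hVe : volume (closedBall (0 : Rd d) (2 * D + 3)) = ENNReal.ofReal V :=
    (ofReal_measureReal (hfin _)).symm
  refine ⟨4 * D * V + 32 * D ^ 2 * V + 1, by positivity, fun R hR => ?_⟩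
  have hR0 : 0 < R := by linarith
  -- points of a cell are close to unit vectors
  have hclose : ∀ θ v : Rd d, ‖θ‖ = 1 → (∀ i, ⌊R * v i⌋ = ⌊R * θ i⌋) → ‖v - θ‖ ≤ D * R⁻¹ := by
    intro θ v _ h
    refine (norm_le_sqrt_mul_of_forall_abs_le (t := R⁻¹) (by positivity) fun i => ?_).trans ?_
    · have h1 := Int.abs_sub_lt_one_of_floor_eq_floor (h i)
      rw [← mul_sub, abs_mul, abs_of_pos hR0] at h1
      rw [PiLp.sub_apply, ← one_div, le_div_iff₀ hR0]
      linarith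
    · gcongr; rw [hD]; linarith
  have hRi : R⁻¹ ≤ 1 := inv_le_one_of_one_le₀ hR
  set U : Set (Fin d → ℤ) := {μ | ∃ θ : Rd d, ‖θ‖ = 1 ∧ ∀ i, ⌊R * θ i⌋ = μ i} with hU
  have hUf : U.Finite := by
    refine (Set.Finite.pi (t := fun _ : Fin d => Icc (-⌈R⌉) ⌈R⌉)
      fun i => Set.finite_Icc _ _).subset ?_
    rintro μ ⟨θ, hθ, h⟩ i -
    have h1 : |θ i| ≤ 1 := by rw [← hθ]; exact PiLp.norm_apply_le θ i
    have h2 := abs_le.1 h1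
    rw [← h i]
    constructor
    · rw [Int.le_floor]; push_cast
      have := Int.le_ceil R
      nlinarith
    · have h3 := Int.floor_le_floor (a := R * θ i) (b := R) (by nlinarith)
      exact h3.trans (Int.floor_le_ceil R)
  have hmemU : ∀ μ, μ ∈ hUf.toFinset ↔ ∃ θ : Rd d, ‖θ‖ = 1 ∧ ∀ i, ⌊R * θ i⌋ = μ i := by
    intro μ; rw [Set.Finite.mem_toFinset, hU, mem_ofPred_eq]
  have hunit : ∀ x : Rd d, x ≠ 0 → ‖‖x‖⁻¹ • x‖ = 1 := fun x hx => by
    rw [norm_smul, norm_inv, norm_norm, inv_mul_cancel₀ (norm_ne_zero_iff.2 hx)]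
  have hfl : ∀ x : Rd d, ∀ i, ⌊R * (‖x‖⁻¹ • x) i⌋ = cellIdx R x i := by
    intro x i
    simp only [cellIdx, PiLp.smul_apply, smul_eq_mul, div_eq_inv_mul]
  set W := {v : Rd d | |‖v‖ - 1| ≤ D * R⁻¹} with hW
  have hWm : MeasurableSet W := by
    have : Continuous fun v : Rd d => |‖v‖ - 1| := by fun_prop
    exact measurableSet_le this.measurable measurable_const
  have hWmem : ∀ θ v : Rd d, ‖θ‖ = 1 → ‖v - θ‖ ≤ D * R⁻¹ → v ∈ W := by
    intro θ v hθ h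
    rw [hW, mem_ofPred_eq, ← hθ]
    exact (abs_norm_sub_norm_le _ _).trans h
  have hWsm : ∀ ρ ∈ Icc (1:ℝ) 2, ∀ v ∈ W, ‖ρ • v‖ ≤ 2 * D + 2 := by
    intro ρ hρ v hv
    have h1 : ‖v‖ - 1 ≤ D * R⁻¹ := (le_abs_self _).trans hv
    rw [norm_smul, Real.norm_of_nonneg (by linarith [hρ.1])]
    have h2 : ‖v‖ ≤ D + 1 := by nlinarith
    calc _ ≤ 2 * (D + 1) := by gcongr; exact hρ.2
      _ = _ := by ring
  have hvolW := volume_shell_le hWm (Y := closedBall (0 : Rd d) (2 * D + 2)) (fun v hv => hv)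
    fun ρ hρ v hv => mem_closedBall_zero_iff.2 (hWsm ρ hρ v hv)
  refine ⟨hUf.toFinset, fun x hx => (hmemU _).2 ⟨‖x‖⁻¹ • x, hunit x hx, hfl x⟩, ?_,
    fun ξ hξ => ⟨{μ ∈ hUf.toFinset | ∃ θ : Rd d, ‖θ‖ = 1 ∧ (∀ i, ⌊R * θ i⌋ = μ i) ∧
      |⟪θ, ξ⟫| ≤ R⁻¹ * ‖ξ‖}, Finset.filter_subset _ _, ?_, fun x hx hxJ => ?_⟩⟩
  · refine (card_le_of_volume_le (C := 4 * (D * R⁻¹) * V) hR0 (by positivity) (W := W)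
      ?_ (hvolW.trans ?_)).trans ?_
    · intro v hv
      obtain ⟨θ, hθ, h⟩ := (hmemU _).1 hv
      exact hWmem θ v hθ (hclose θ v hθ fun i => (h i).symm)
    · rw [ENNReal.ofReal_mul (p := 4 * (D * R⁻¹)) (by positivity), ← hVe]
      gcongr
      linarith
    · have : 4 * (D * R⁻¹) * V ≤ (4 * D * V + 32 * D ^ 2 * V + 1) * R⁻¹ := by
        have : 0 ≤ (32 * D ^ 2 * V + 1) * R⁻¹ := by positivity
        linarith
      gcongr
  · have hξ' : 0 < ‖ξ‖ := norm_pos_iff.2 hξ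
    set W' := W ∩ {v : Rd d | |⟪v, ‖ξ‖⁻¹ • ξ⟫| ≤ 2 * D * R⁻¹} with hW'
    have hWm' : MeasurableSet W' := by
      have : Continuous fun v : Rd d => |⟪v, ‖ξ‖⁻¹ • ξ⟫| := by fun_prop
      exact hWm.inter (measurableSet_le this.measurable measurable_const)
    have hY := volume_slab_le (hunit ξ hξ) (2 * D + 2) (4 * D * R⁻¹)
    have hvol := volume_shell_le hWm' (t := D * R⁻¹)
      (Y := {v : Rd d | ‖v‖ ≤ 2 * D + 2 ∧ |⟪v, ‖ξ‖⁻¹ • ξ⟫| ≤ 4 * D * R⁻¹}) (fun v hv => hv.1) ?_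
    · refine (card_le_of_volume_le (C := 4 * (D * R⁻¹) * (2 * (4 * D * R⁻¹) * V)) hR0
        (by positivity) (W := W') ?_ (hvol.trans ?_)).trans ?_
      · intro v hv
        obtain ⟨-, θ, hθ, h, hin⟩ := Finset.mem_filter.1 hv
        have hc := hclose θ v hθ fun i => (h i).symm
        refine ⟨hWmem θ v hθ hc, ?_⟩
        have e : ⟪v, ‖ξ‖⁻¹ • ξ⟫ = ‖ξ‖⁻¹ * ⟪θ, ξ⟫ + ⟪v - θ, ‖ξ‖⁻¹ • ξ⟫ := by
          rw [inner_sub_left, real_inner_smul_right, real_inner_smul_right]; ring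
        have h1 : |⟪v - θ, ‖ξ‖⁻¹ • ξ⟫| ≤ D * R⁻¹ := by
          refine (abs_real_inner_le_norm _ _).trans ?_
          rw [hunit ξ hξ, mul_one]; exact hc
        have h2 : |‖ξ‖⁻¹ * ⟪θ, ξ⟫| ≤ R⁻¹ := by
          rw [abs_mul, abs_of_pos (by positivity), inv_mul_le_iff₀ hξ']
          linarith
        rw [mem_ofPred_eq, e]
        refine (abs_add_le _ _).trans ?_
        have : R⁻¹ ≤ D * R⁻¹ := le_mul_of_one_le_left (by positivity) hD1
        linarith
      · rw [ENNReal.ofReal_mul (p := 4 * (D * R⁻¹)) (by positivity),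
          ENNReal.ofReal_mul (p := 2 * (4 * D * R⁻¹)) (by positivity), ← hVe]
        have e : 2 * D + 2 + 1 = 2 * D + 3 := by ring
        rw [e] at hY
        gcongr
      · have : 4 * (D * R⁻¹) * (2 * (4 * D * R⁻¹) * V)
            ≤ (4 * D * V + 32 * D ^ 2 * V + 1) * R⁻¹ ^ 2 := by
          have : 0 ≤ (4 * D * V + 1) * R⁻¹ ^ 2 := by positivity
          linarith
        gcongr
    · intro ρ hρ v hv
      have h1 := hWsm ρ hρ v hv.1
      refine ⟨h1, ?_⟩
      have h2 : |⟪v, ‖ξ‖⁻¹ • ξ⟫| ≤ 2 * D * R⁻¹ := hv.2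
      rw [real_inner_smul_left, abs_mul, abs_of_pos (by linarith [hρ.1])]
      calc _ ≤ 2 * (2 * D * R⁻¹) := by gcongr; exact hρ.2
        _ = _ := by ring
  · by_contra! hlt
    refine hxJ (Finset.mem_filter.2 ⟨(hmemU _).2 ⟨_, hunit x hx, hfl x⟩,
      ‖x‖⁻¹ • x, hunit x hx, hfl x, ?_⟩)
    have hx' : 0 < ‖x‖ := norm_pos_iff.2 hx
    rw [real_inner_smul_left, abs_mul, abs_of_pos (by positivity), inv_mul_le_iff₀ hx']
    nlinarith

theorem ENNReal.sq_sum_le_two_mul_sum_ordered {ι : Type*} (S : Finset ι) (k : ι → ℤ)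
    (p : ι → ℝ≥0∞) :
    (∑ i ∈ S, p i) ^ 2 ≤ 2 * ∑ i ∈ S, p i * ∑ j ∈ S with k j ≤ k i, p j := by
  have h1 : (∑ i ∈ S, p i) ^ 2 ≤ (∑ i ∈ S, ∑ j ∈ S, if k j ≤ k i then p i * p j else 0)
      + ∑ i ∈ S, ∑ j ∈ S, if k i ≤ k j then p i * p j else 0 := by
    rw [sq, Finset.sum_mul_sum, ← Finset.sum_add_distrib]
    refine Finset.sum_le_sum fun i _ => ?_
    rw [← Finset.sum_add_distrib]
    refine Finset.sum_le_sum fun j _ => ?_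
    rcases le_total (k j) (k i) with h | h
    · rw [if_pos h]; exact le_self_add
    · rw [if_pos h]; exact le_add_self
  refine h1.trans (le_of_eq ?_)
  rw [Finset.sum_comm (f := fun i j => if k i ≤ k j then p i * p j else 0), two_mul]
  simp only [Finset.mul_sum, Finset.sum_filter, mul_comm, mul_ite, mul_zero]

/-- An `L²` bound for a sum of convolutions, each of which meets boundedly much mass of the
convolutions at finer scales. -/
theorem lintegral_sq_sum_conv_le {d : ℕ} {ι : Type*} (S : Finset ι) (k : ι → ℤ)
    {K g : ι → Rd d → ℝ≥0∞} {Q U : ι → Set (Rd d)} {β : ι → ℝ≥0∞} {m A : ℝ≥0∞}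
    (hKmeas : ∀ i ∈ S, Measurable (K i)) (hgmeas : ∀ i ∈ S, Measurable (g i))
    (hQ : ∀ i ∈ S, MeasurableSet (Q i)) (hd : (S : Set ι).PairwiseDisjoint Q)
    (hgs : ∀ i ∈ S, ∀ y ∉ Q i, g i y = 0) (hgA : ∀ i ∈ S, ∫⁻ y, g i y ≤ A * volume (Q i))
    (hKβ : ∀ i ∈ S, ∀ x, K i x ≤ β i) (hKm : ∀ i ∈ S, ∫⁻ x, K i x ≤ m)
    (hU : ∀ i ∈ S, β i * volume (U i) ≤ m)
    (hov : ∀ i ∈ S, ∀ j ∈ S, k j ≤ k i → ∀ x y z, K i (x - y) ≠ 0 → K j (x - z) ≠ 0 →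
      z ∈ Q j → ∀ q ∈ Q j, q - y ∈ U i) :
    ∫⁻ x, (∑ i ∈ S, ∫⁻ y, K i (x - y) * g i y) ^ 2
      ≤ 2 * A ^ 2 * m ^ 2 * ∑ i ∈ S, volume (Q i) := by
  classical
  set p : ι → Rd d → ℝ≥0∞ := fun i x => ∫⁻ y, K i (x - y) * g i y with hp
  have hKg : ∀ i ∈ S, Measurable fun q : Rd d × Rd d => K i (q.1 - q.2) * g i q.2 := fun i hi =>
    ((hKmeas i hi).comp (measurable_fst.sub measurable_snd)).mul ((hgmeas i hi).comp measurable_snd)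
  have hKy : ∀ i ∈ S, ∀ y, Measurable fun x => K i (x - y) := fun i hi y =>
    (hKmeas i hi).comp (measurable_id.sub_const y)
  have hKgx : ∀ i ∈ S, ∀ x, Measurable fun y => K i (x - y) * g i y := fun i hi x =>
    (hKg i hi).comp measurable_prodMk_left
  have hpm : ∀ i ∈ S, Measurable (p i) := fun i hi => (hKg i hi).lintegral_prod_right'
  have hKi : ∀ i ∈ S, ∀ y, ∫⁻ x, K i (x - y) ≤ m := fun i hi y => by
    rw [lintegral_sub_right_eq_self]; exact hKm i hi
  have hpi : ∀ i ∈ S, ∫⁻ x, p i x ≤ m * (A * volume (Q i)) := fun i hi => by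
    rw [hp, lintegral_lintegral_swap (hKg i hi).aemeasurable]
    calc _ ≤ ∫⁻ y, m * g i y := by
          refine lintegral_mono fun y => ?_
          rw [lintegral_mul_const _ (hKy i hi y)]
          gcongr
          exact hKi i hi y
      _ ≤ _ := by
          rw [lintegral_const_mul _ (hgmeas i hi)]
          gcongr
          exact hgA i hi
  have hloc : ∀ i ∈ S, ∀ y, ∫⁻ x, K i (x - y) * ∑ j ∈ S with k j ≤ k i, p j x ≤ A * m ^ 2 := by
    intro i hi y
    set T := {j ∈ S | k j ≤ k i ∧ ∀ q ∈ Q j, q - y ∈ U i} with hT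
    calc ∫⁻ x, K i (x - y) * ∑ j ∈ S with k j ≤ k i, p j x
        ≤ ∫⁻ x, β i * ∑ j ∈ T, p j x := by
          refine lintegral_mono fun x => ?_
          by_cases h0 : K i (x - y) = 0
          · simp [h0]
          refine mul_le_mul' (hKβ i hi _) ?_
          rw [← Finset.sum_filter_of_ne (p := fun j => k j ≤ k i ∧ ∀ q ∈ Q j, q - y ∈ U i)]
          · refine Finset.sum_le_sum_of_subset fun j hj => ?_
            simp only [Finset.mem_filter, hT] at hj ⊢
            exact ⟨hj.1.1, hj.2⟩
          · intro j hj hne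
            simp only [Finset.mem_filter] at hj
            refine ⟨hj.2, ?_⟩
            by_contra hcon
            refine hne ?_
            rw [hp]
            simp only
            rw [lintegral_eq_zero_iff' (hKgx j hj.1 x).aemeasurable]
            refine Filter.Eventually.of_forall fun z => ?_
            by_contra hz
            have hz1 : K j (x - z) ≠ 0 := fun h => hz (by simp [h])
            have hz2 : z ∈ Q j := by
              by_contra h; exact hz (by simp [hgs j hj.1 z h])
            exact hcon (hov i hi j hj.1 hj.2 x y z h0 hz1 hz2)
      _ = β i * ∑ j ∈ T, ∫⁻ x, p j x := by
          have hTS : ∀ j ∈ T, j ∈ S := fun j hj => (Finset.mem_filter.1 hj).1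
          rw [lintegral_const_mul _ (Finset.measurable_fun_sum _ fun j hj => hpm j (hTS j hj)),
            lintegral_finsetSum' _ fun j hj => (hpm j (hTS j hj)).aemeasurable]
      _ ≤ β i * ∑ j ∈ T, m * (A * volume (Q j)) := by
          gcongr with j hj
          exact hpi j (Finset.mem_filter.1 hj).1
      _ = m * A * (β i * ∑ j ∈ T, volume (Q j)) := by
          simp only [Finset.mul_sum]
          refine Finset.sum_congr rfl fun j _ => by ring
      _ ≤ m * A * (β i * volume (U i)) := by
          gcongr
          have hTS : (T : Set ι) ⊆ S := fun j hj => (Finset.mem_filter.1 hj).1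
          rw [← measure_biUnion_finset (hd.subset hTS) fun j hj => hQ j (hTS hj)]
          calc _ ≤ volume ((fun q => q + (-y)) ⁻¹' U i) := by
                refine measure_mono fun q hq => ?_
                simp only [mem_iUnion] at hq
                obtain ⟨j, hj, hq⟩ := hq
                rw [mem_preimage, ← sub_eq_add_neg]
                exact (Finset.mem_filter.1 hj).2.2 q hq
            _ = _ := measure_preimage_add_right _ _ _
      _ ≤ m * A * m := by gcongr; exact hU i hi
      _ = A * m ^ 2 := by ring
  have hPm : ∀ i ∈ S, Measurable fun x => ∑ j ∈ S with k j ≤ k i, p j x := fun i _ =>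
    Finset.measurable_fun_sum _ fun j hj => hpm j (Finset.mem_filter.1 hj).1
  have hpP : ∀ i ∈ S, Measurable fun x => p i x * ∑ j ∈ S with k j ≤ k i, p j x := fun i hi =>
    (hpm i hi).mul (hPm i hi)
  have hKP : ∀ i ∈ S, ∀ y, Measurable fun x =>
      K i (x - y) * ∑ j ∈ S with k j ≤ k i, p j x := fun i hi y => (hKy i hi y).mul (hPm i hi)
  calc _ ≤ ∫⁻ x, 2 * ∑ i ∈ S, p i x * ∑ j ∈ S with k j ≤ k i, p j x :=
        lintegral_mono fun x => ENNReal.sq_sum_le_two_mul_sum_ordered S k fun i => p i x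
    _ = 2 * ∑ i ∈ S, ∫⁻ x, p i x * ∑ j ∈ S with k j ≤ k i, p j x := by
        rw [lintegral_const_mul _ (Finset.measurable_fun_sum _ hpP),
          lintegral_finsetSum' _ fun i hi => (hpP i hi).aemeasurable]
    _ ≤ 2 * ∑ i ∈ S, A * volume (Q i) * (A * m ^ 2) := by
        gcongr with i hi
        have e : ∀ x, p i x * ∑ j ∈ S with k j ≤ k i, p j x
            = ∫⁻ y, K i (x - y) * g i y * ∑ j ∈ S with k j ≤ k i, p j x := fun x => by
          rw [lintegral_mul_const _ (hKgx i hi x)]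
        simp_rw [e]
        rw [lintegral_lintegral_swap (by
          exact ((hKg i hi).mul ((hPm i hi).comp measurable_fst)).aemeasurable)]
        calc _ ≤ ∫⁻ y, g i y * (A * m ^ 2) := by
              refine lintegral_mono fun y => ?_
              have : ∀ x, K i (x - y) * g i y * ∑ j ∈ S with k j ≤ k i, p j x
                  = g i y * (K i (x - y) * ∑ j ∈ S with k j ≤ k i, p j x) := fun x => by ring
              simp_rw [this]
              rw [lintegral_const_mul _ (hKP i hi y)]
              gcongr
              exact hloc i hi y
          _ ≤ _ := by
              rw [lintegral_mul_const _ (hgmeas i hi)]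
              gcongr
              exact hgA i hi
    _ = _ := by
        simp only [Finset.mul_sum]
        refine Finset.sum_congr rfl fun i _ => by ring

theorem AdmissiblePhi.exists_bound {d : ℕ} {φ : Rd d → ℝ} (hφ : AdmissiblePhi d φ) :
    ∃ B : ℝ, 0 < B ∧ ∀ x, |φ x| ≤ B := by
  have hφc : HasCompactSupport φ :=
    HasCompactSupport.intro (isCompact_closedBall (0 : Rd d) 1) fun x hx => by
      by_contra h
      exact hx (by rw [mem_closedBall_zero_iff]; linarith [(hφ.norm_mem h).2])
  obtain ⟨B, hB⟩ := hφc.exists_bound_of_continuous hφ.1.continuous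
  exact ⟨|B| + 1, by positivity, fun x => (hB x).trans (by linarith [le_abs_self B])⟩

theorem AdmissiblePhi.norm_of_Kker_ne_zero {d : ℕ} {φ : Rd d → ℝ} (hφ : AdmissiblePhi d φ)
    {w : Rd d → ℝ} {k : ℤ} {x : Rd d} (h : Kker d φ w k x ≠ 0) :
    2 ^ k / 16 < ‖x‖ ∧ ‖x‖ < 2 ^ k / 4 ∧ w x ≠ 0 := by
  have h1 : φ ((2:ℝ) ^ (-k) • x) ≠ 0 := fun h0 => h (by rw [Kker, h0, zero_mul, zero_mul])
  have h2 : w x ≠ 0 := fun h0 => h (by simp [Kker, h0])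
  have h3 := hφ.norm_mem h1
  have h2k : (0:ℝ) < 2 ^ k := by positivity
  rw [norm_smul, Real.norm_of_nonneg (by positivity), zpow_neg, inv_mul_eq_div,
    lt_div_iff₀ h2k, div_lt_iff₀ h2k] at h3
  exact ⟨by linarith [h3.1], by linarith [h3.2], h2⟩

theorem abs_Kker_le {d : ℕ} {φ : Rd d → ℝ} (hφ : AdmissiblePhi d φ) {B : ℝ}
    (hB : ∀ x, |φ x| ≤ B) {w : Rd d → ℝ} {M : ℝ} (hw : ∀ x, |w x| ≤ M) (k : ℤ) (x : Rd d) :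
    |Kker d φ w k x| ≤ B * M * (((2:ℝ) ^ k / 16) ^ d)⁻¹ := by
  have hB0 : 0 ≤ B := (abs_nonneg _).trans (hB 0)
  have hM0 : 0 ≤ M := (abs_nonneg _).trans (hw 0)
  by_cases h : Kker d φ w k x = 0
  · rw [h, abs_zero]; positivity
  have hx := hφ.norm_of_Kker_ne_zero h
  rw [Kker, abs_mul, abs_mul, zpow_neg ‖x‖, zpow_natCast, abs_of_nonneg (by positivity :
    0 ≤ (‖x‖ ^ d)⁻¹)]
  gcongr
  · exact hB _
  · exact hw _
  · exact hx.1.le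

theorem measurable_Kker {d : ℕ} {φ : Rd d → ℝ} (hφ : AdmissiblePhi d φ) {w : Rd d → ℝ}
    (hw : Measurable w) (k : ℤ) : Measurable (Kker d φ w k) := by
  have h1 : Measurable fun x : Rd d => φ ((2:ℝ) ^ (-k) • x) :=
    hφ.1.continuous.measurable.comp (measurable_const_smul _)
  exact (h1.mul hw).mul (measurable_norm.pow_const _)

/-- The part of the operator coming from one angular cell is small in `L²`. -/
theorem lintegral_sq_angular_piece_le {d : ℕ} {φ : Rd d → ℝ} (hφ : AdmissiblePhi d φ) :
    ∃ C : ℝ, 0 < C ∧ ∀ (w : Rd d → ℝ) (M R A : ℝ) (s : ℕ) (μ : Fin d → ℤ), Measurable w →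
      (∀ x, |w x| ≤ M) → 1 ≤ R → R ≤ 2 ^ s → 0 ≤ A →
      (∀ x, w x ≠ 0 → x ≠ 0 → cellIdx R x = μ) →
      ∀ (ι : Type) (S : Finset ι) (Q : ι → Set (Rd d)) (b : ι → Rd d → ℝ) (k : ι → ℤ),
        (∀ i ∈ S, MeanZeroAtom (Q i) (b i) A (√d * (2 ^ k i / 2 ^ s))) →
        (S : Set ι).PairwiseDisjoint Q →
        ∫⁻ x, ‖∑ i ∈ S, ∫ y, Kker d φ w (k i) (x - y) * b i y‖ₑ ^ 2
          ≤ ENNReal.ofReal (C * (A * (M * (R / R ^ d))) ^ 2) * ∑ i ∈ S, volume (Q i) := by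
  obtain ⟨B, hB0, hB⟩ := hφ.exists_bound
  set D := √(d:ℝ) with hD
  have hD0 : 0 ≤ D := Real.sqrt_nonneg _
  set c := 3 * D + 2 with hc
  set V := volume.real (closedBall (0 : Rd d) 1) with hV
  have hVe : volume (closedBall (0 : Rd d) 1) = ENNReal.ofReal V :=
    (ofReal_measureReal measure_closedBall_lt_top.ne).symm
  set C := 2 * B * (16 * ((2 + D) * c)) ^ d * V with hC
  have hCnn : 0 ≤ C := by positivity
  refine ⟨2 * C ^ 2 + 1, by positivity, fun w M R A s μ hwm hwM hR hRs hA hwμ ι S Q b k hb hd => ?_⟩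
  have hM : 0 ≤ M := (abs_nonneg _).trans (hwM 0)
  have hR0 : 0 < R := by linarith
  set e : Rd d := cellDir R μ with he
  set m := C * (M * (R / R ^ d)) with hm
  have hm0 : 0 ≤ m := by positivity
  -- support of the kernel
  have hsup : ∀ i, ∀ v, Kker d φ w (k i) v ≠ 0 →
      ‖v‖ ≤ 2 ^ k i ∧ ‖v - ‖v‖ • e‖ ≤ D * (2 ^ k i / R) ∧ v ≠ 0 ∧ cellIdx R v = μ := by
    intro i v hv
    have h2k : (0:ℝ) < 2 ^ k i := by positivity
    obtain ⟨h1, h2, h3⟩ := hφ.norm_of_Kker_ne_zero hv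
    have hv0 : v ≠ 0 := by rw [← norm_pos_iff]; linarith
    have hμ := hwμ v h3 hv0
    have h4 : ‖v‖ ≤ 2 ^ k i := by linarith
    refine ⟨h4, ?_, hv0, hμ⟩
    have h5 := norm_sub_smul_cellDir_le hR0 v
    rw [hμ] at h5
    exact h5.trans (by gcongr)
  set K : ι → Rd d → ℝ≥0∞ := fun i x => ‖Kker d φ w (k i) x‖ₑ with hK
  set U : ι → Set (Rd d) := fun i =>
    {v | (∃ x : Rd d, x ≠ 0 ∧ cellIdx R x = μ) ∧ v ∈ tube (c * 2 ^ k i) (c * 2 ^ k i / R) e}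
    with hU
  set β : ι → ℝ≥0∞ := fun i => ENNReal.ofReal (B * M * (((2:ℝ) ^ k i / 16) ^ d)⁻¹) with hβ
  have hKU : ∀ i, ∀ v, K i v ≠ 0 → v ∈ U i := by
    intro i v hv
    have h2k : (0:ℝ) < 2 ^ k i := by positivity
    obtain ⟨h1, h2, h3, h4⟩ := hsup i v (by simpa [hK] using hv)
    refine ⟨⟨v, h3, h4⟩, ‖v‖, ?_, h2.trans ?_⟩
    · rw [abs_of_nonneg (norm_nonneg _)]
      exact h1.trans (le_mul_of_one_le_left h2k.le (by linarith))
    · rw [mul_div_assoc]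
      gcongr
      linarith
  have hKβ : ∀ i, ∀ x, K i x ≤ β i := fun i x => by
    rw [hK, hβ]
    simp only
    rw [← ofReal_norm, Real.norm_eq_abs]
    exact ENNReal.ofReal_le_ofReal (abs_Kker_le hφ hB hwM _ _)
  have hUm : ∀ i, β i * volume (U i) ≤ ENNReal.ofReal m := by
    intro i
    by_cases hex : ∃ x : Rd d, x ≠ 0 ∧ cellIdx R x = μ
    swap
    · have : U i = ∅ := by
        ext v; simp only [hU, mem_ofPred_eq, mem_empty_iff_false, iff_false]
        exact fun h => hex h.1
      simp [this]
    have hen : ‖e‖ ≤ 1 + D := by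
      obtain ⟨x, hx, hxμ⟩ := hex
      rw [he, ← hxμ]; exact norm_cellDir_le hR hx
    have h2k : (0:ℝ) < 2 ^ k i := by positivity
    have hL : 0 < c * 2 ^ k i := by positivity
    have ht := volume_tube_le (L := c * 2 ^ k i) (δ := c * 2 ^ k i / R) (by positivity)
      (div_le_self hL.le hR) hen
    set L := c * (2:ℝ) ^ k i with hLd
    have ht2 : volume (U i) ≤ ENNReal.ofReal (2 * R * ((2 + D) * L / R) ^ d * V) := by
      have h1 : volume (U i) ≤ volume (tube L (L / R) e) := measure_mono fun v hv => hv.2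
      refine h1.trans ?_
      rw [hVe, ← ENNReal.ofReal_mul (by positivity), mul_comm,
        ← ENNReal.le_div_iff_mul_le (Or.inl (by positivity)) (Or.inl ENNReal.ofReal_ne_top),
        ← ENNReal.ofReal_div_of_pos (by positivity)] at ht
      refine ht.trans (le_of_eq ?_)
      congr 1
      field_simp
      ring
    calc β i * volume (U i) ≤ β i * ENNReal.ofReal (2 * R * ((2 + D) * L / R) ^ d * V) := by
          gcongr
      _ = ENNReal.ofReal m := by
          rw [hβ]
          simp only
          rw [← ENNReal.ofReal_mul (by positivity)]
          congr 1
          rw [hm, hC, hLd]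
          simp only [div_pow, mul_pow]
          field_simp
  have hKm : ∀ i, ∫⁻ x, K i x ≤ ENNReal.ofReal m := fun i => by
    refine le_trans (lintegral_mono fun x => ?_)
      ((lintegral_indicator_const_le (U i) (β i)).trans (hUm i))
    by_cases hx : K i x = 0
    · simp [hx]
    · rw [indicator_of_mem (hKU i x hx)]; exact hKβ i x
  have key := lintegral_sq_sum_conv_le S k (K := K) (g := fun i y => ‖b i y‖ₑ) (Q := Q) (U := U)
    (β := β) (m := ENNReal.ofReal m) (A := ENNReal.ofReal A)
    (fun i _ => (measurable_Kker hφ hwm _).enorm) (fun i hi => (hb i hi).measurable.enorm)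
    (fun i hi => (hb i hi).measurableSet) hd
    (fun i hi y hy => by
      have := notMem_subset (hb i hi).support_subset hy
      simpa using this)
    (fun i hi => (hb i hi).l1_bound) (fun i _ => hKβ i) (fun i _ => hKm i) (fun i _ => hUm i) ?_
  · refine (lintegral_mono fun x => ?_).trans (key.trans ?_)
    · gcongr
      refine (enorm_sum_le _ _).trans (Finset.sum_le_sum fun i _ => ?_)
      refine (enorm_integral_le_lintegral_enorm _).trans (le_of_eq ?_)
      simp only [enorm_mul, hK]
    · gcongr
      rw [← ENNReal.ofReal_pow hA, ← ENNReal.ofReal_pow hm0, ← ENNReal.ofReal_ofNat,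
        ← ENNReal.ofReal_mul (by positivity), ← ENNReal.ofReal_mul (by positivity)]
      refine ENNReal.ofReal_le_ofReal ?_
      rw [hm]
      have : 0 ≤ (A * (M * (R / R ^ d))) ^ 2 := by positivity
      linarith
  · intro i hi j hj hji x y z h1 h2 hz q hq
    obtain ⟨a1, a2, a3, a4⟩ := hsup i _ (by simpa [hK] using h1)
    obtain ⟨b1, b2, b3, b4⟩ := hsup j _ (by simpa [hK] using h2)
    have hij : (2:ℝ) ^ k j ≤ 2 ^ k i := zpow_le_zpow_right₀ (by norm_num) hji
    have h2k : (0:ℝ) < 2 ^ k i := by positivity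
    have h2j : (0:ℝ) < 2 ^ k j := by positivity
    refine ⟨⟨_, a3, a4⟩, ‖x - y‖ - ‖x - z‖, ?_, ?_⟩
    · have := norm_nonneg (x - y)
      have := norm_nonneg (x - z)
      have h3 : (2:ℝ) ^ k i ≤ c * 2 ^ k i := le_mul_of_one_le_left h2k.le (by linarith)
      rw [abs_le]; constructor <;> linarith
    · have h3 := (hb j hj).diam q hq z hz
      have h4 : q - y - (‖x - y‖ - ‖x - z‖) • e
          = (x - y - ‖x - y‖ • e) - (x - z - ‖x - z‖ • e) + (q - z) := by
        rw [sub_smul]; abel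
      rw [h4]
      refine (norm_add_le _ _).trans ((add_le_add (norm_sub_le _ _) h3).trans ?_)
      have h5 : (2:ℝ) ^ k j / R ≤ 2 ^ k i / R := by gcongr
      have h6 : (2:ℝ) ^ k j / 2 ^ s ≤ 2 ^ k i / R := by gcongr
      have h7 := mul_le_mul_of_nonneg_left h5 hD0
      have h8 := mul_le_mul_of_nonneg_left h6 hD0
      have h9 : 0 ≤ 2 ^ k i / R := by positivity
      rw [mul_div_assoc, hc]
      linarith

theorem summable_pow_natAbs {r : ℝ} (h0 : 0 ≤ r) (h1 : r < 1) :
    Summable fun j : ℤ => r ^ j.natAbs :=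
  Summable.of_nat_of_neg (by simpa using summable_geometric_of_lt_one h0 h1)
    (by simpa using summable_geometric_of_lt_one h0 h1)

theorem weight_mul_profile_le {t D : ℝ} (ht : 0 ≤ t) (ht1 : t ≤ 1) (hD : 0 ≤ D) (d : ℕ) (j : ℤ) :
    (4 / 3) ^ j.natAbs * min 1 (((2:ℝ) ^ j) ^ (2 * (d + 3)))
        * ((D * t * 2 ^ (-j)) * (1 + D * t * 2 ^ (-j)) ^ (2 * (d + 1)))
      ≤ t * (D * (1 + D) ^ (2 * (d + 1))) * (2 / 3) ^ j.natAbs := by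
  obtain ⟨n, rfl | rfl⟩ := j.eq_nat_or_neg
  · rw [Int.natAbs_natCast, zpow_neg, zpow_natCast]
    have h2 : ((2:ℝ) ^ n)⁻¹ ≤ 1 := inv_le_one_of_one_le₀ (one_le_pow₀ (by norm_num))
    have h3 : D * t * ((2:ℝ) ^ n)⁻¹ ≤ D := by
      calc D * t * ((2:ℝ) ^ n)⁻¹ ≤ D * 1 * 1 := by gcongr
        _ = D := by ring
    calc (4 / 3 : ℝ) ^ n * min 1 (((2:ℝ) ^ n) ^ (2 * (d + 3)))
        * ((D * t * ((2:ℝ) ^ n)⁻¹) * (1 + D * t * ((2:ℝ) ^ n)⁻¹) ^ (2 * (d + 1)))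
        ≤ (4 / 3 : ℝ) ^ n * 1 * ((D * t * ((2:ℝ) ^ n)⁻¹) * (1 + D) ^ (2 * (d + 1))) := by
          gcongr
          exact min_le_left _ _
      _ = t * (D * (1 + D) ^ (2 * (d + 1))) * ((4 / 3 : ℝ) ^ n * ((2:ℝ) ^ n)⁻¹) := by ring
      _ = _ := by
          rw [← inv_pow, ← mul_pow]; norm_num
  · rw [Int.natAbs_neg, Int.natAbs_natCast, neg_neg, zpow_neg, zpow_natCast]
    have h1 : (1:ℝ) ≤ 2 ^ n := one_le_pow₀ (by norm_num)
    have h3 : 1 + D * t * (2:ℝ) ^ n ≤ (1 + D) * 2 ^ n := by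
      have : D * t * (2:ℝ) ^ n ≤ D * 1 * 2 ^ n := by gcongr
      linarith
    calc (4 / 3 : ℝ) ^ n * min 1 ((((2:ℝ) ^ n)⁻¹) ^ (2 * (d + 3)))
        * ((D * t * (2:ℝ) ^ n) * (1 + D * t * (2:ℝ) ^ n) ^ (2 * (d + 1)))
        ≤ (4 / 3 : ℝ) ^ n * (((2:ℝ) ^ n)⁻¹) ^ (2 * (d + 3))
          * ((D * t * (2:ℝ) ^ n) * ((1 + D) * 2 ^ n) ^ (2 * (d + 1))) := by
          gcongr
          exact min_le_right _ _
      _ = t * (D * (1 + D) ^ (2 * (d + 1))) * ((4 / 3 : ℝ) ^ n * (((2:ℝ) ^ n)⁻¹) ^ 3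
          * ((((2:ℝ) ^ n)⁻¹) * (2:ℝ) ^ n) ^ (2 * d + 3)) := by
          generalize ((2:ℝ) ^ n)⁻¹ = q
          generalize (2:ℝ) ^ n = p
          rw [mul_pow (1 + D)]
          ring
      _ = t * (D * (1 + D) ^ (2 * (d + 1))) * (1 / 6) ^ n := by
          rw [inv_mul_cancel₀ (by positivity), one_pow, mul_one, ← inv_pow, pow_right_comm,
            ← mul_pow]; norm_num
      _ ≤ _ := mul_le_mul_of_nonneg_left (pow_le_pow_left₀ (by norm_num) (by norm_num) n)
          (by positivity)

theorem Summable.sum_shift_le_tsum {p : ℤ → ℝ} (hp : Summable p) (h0 : ∀ j, 0 ≤ p j)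
    (T : Finset ℤ) (L : ℤ) : ∑ κ ∈ T, p (κ + L) ≤ ∑' j, p j := by
  rw [← (Equiv.addRight L).tsum_eq p]
  exact Summable.sum_le_tsum T (fun _ _ => h0 _) ((Equiv.addRight L).summable_iff.2 hp)

theorem enorm_sq_sum_scales_le (d : ℕ) (T : Finset ℤ) {x M R : ℝ} (hx : 0 < x) (hM : 0 ≤ M)
    (hR : 1 ≤ R) {e z : ℤ → ℂ} (he1 : ∀ κ, ‖e κ‖ ≤ M)
    (he2 : ∀ κ, ‖e κ‖ * (R⁻¹ * ((2:ℝ) ^ κ * x)) ^ (d + 3) ≤ M) :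
    ‖∑ κ ∈ T, e κ * z κ‖ₑ ^ 2
      ≤ ENNReal.ofReal ((∑' j : ℤ, (3 / 4 : ℝ) ^ j.natAbs) * (M * R ^ (d + 3)) ^ 2
          * Real.exp (4 * Real.pi))
        * ∑ κ ∈ T, ∑' j : ℤ,
          ENNReal.ofReal ((4 / 3) ^ j.natAbs * min 1 (((2:ℝ) ^ j) ^ (2 * (d + 3))))
          * (ENNReal.ofReal (Real.exp (-(Real.pi * ((2:ℝ) ^ (j + κ)) ^ 2) * x ^ 2))
            * ‖z κ‖ₑ ^ 2) := by
  set W : ℝ := ∑' j : ℤ, (3 / 4 : ℝ) ^ j.natAbs with hW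
  have hWs : Summable fun j : ℤ => (3 / 4 : ℝ) ^ j.natAbs :=
    summable_pow_natAbs (by norm_num) (by norm_num)
  have hW0 : 0 ≤ W := tsum_nonneg fun j => by positivity
  set c : ℤ → ℝ := fun j => (4 / 3) ^ j.natAbs * min 1 (((2:ℝ) ^ j) ^ (2 * (d + 3))) with hc
  have hc0 : ∀ j, 0 ≤ c j := fun j => by
    have : 0 ≤ min 1 (((2:ℝ) ^ j) ^ (2 * (d + 3))) := le_min zero_le_one (by positivity)
    positivity
  set L := Int.log 2 x with hL
  have hL1 : (2:ℝ) ^ L ≤ x := by exact_mod_cast Int.zpow_log_le_self (b := 2) (by norm_num) hx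
  have hL2 : x < (2:ℝ) ^ (L + 1) := by
    exact_mod_cast Int.lt_zpow_succ_log_self (b := 2) (by norm_num) x
  have hek : ∀ κ, ‖e κ‖ ^ 2 ≤
      (M * R ^ (d + 3)) ^ 2 * min 1 (((2:ℝ) ^ (-(κ + L))) ^ (2 * (d + 3))) := by
    intro κ
    have hR1 : (1:ℝ) ≤ R ^ (d + 3) := one_le_pow₀ hR
    rw [mul_min_of_nonneg _ _ (by positivity), mul_one, le_min_iff]
    constructor
    · gcongr
      calc _ ≤ M * 1 := by rw [mul_one]; exact he1 κ
        _ ≤ _ := by gcongr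
    · rw [mul_comm 2, pow_mul, ← mul_pow]
      gcongr
      have h5 : ‖e κ‖ * (R⁻¹ * (2:ℝ) ^ (κ + L)) ^ (d + 3) ≤ M := by
        refine le_trans ?_ (he2 κ)
        rw [zpow_add₀ (by norm_num)]
        gcongr
      calc ‖e κ‖ = ‖e κ‖ * (R⁻¹ * (2:ℝ) ^ (κ + L)) ^ (d + 3)
            * (R * (2:ℝ) ^ (-(κ + L))) ^ (d + 3) := by
            rw [mul_assoc, ← mul_pow]
            rw [zpow_neg, mul_mul_mul_comm, inv_mul_cancel₀ (by positivity),
              mul_inv_cancel₀ (by positivity)]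
            simp
        _ ≤ M * (R * (2:ℝ) ^ (-(κ + L))) ^ (d + 3) := by gcongr
        _ = _ := by ring
  have hCS : ‖∑ κ ∈ T, e κ * z κ‖ ^ 2 ≤ W * ∑ κ ∈ T,
      (M * R ^ (d + 3)) ^ 2 * c (-(κ + L)) * ‖z κ‖ ^ 2 := by
    calc ‖∑ κ ∈ T, e κ * z κ‖ ^ 2 ≤ (∑ κ ∈ T, ‖e κ‖ * ‖z κ‖) ^ 2 := by
          gcongr
          exact (norm_sum_le _ _).trans_eq (Finset.sum_congr rfl fun _ _ => norm_mul _ _)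
      _ ≤ (∑ κ ∈ T, (3 / 4 : ℝ) ^ (κ + L).natAbs) * ∑ κ ∈ T,
          (M * R ^ (d + 3)) ^ 2 * c (-(κ + L)) * ‖z κ‖ ^ 2 := by
          refine Finset.sum_sq_le_sum_mul_sum_of_sq_le_mul T (fun κ _ => by positivity)
            (fun κ _ => mul_nonneg (mul_nonneg (by positivity) (hc0 _)) (by positivity))
            fun κ _ => ?_
          rw [mul_pow]
          calc _ ≤ (M * R ^ (d + 3)) ^ 2 * min 1 (((2:ℝ) ^ (-(κ + L))) ^ (2 * (d + 3)))
              * ‖z κ‖ ^ 2 := by gcongr; exact hek κ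
            _ = ((3 / 4 : ℝ) ^ (κ + L).natAbs * (4 / 3 : ℝ) ^ (κ + L).natAbs)
              * ((M * R ^ (d + 3)) ^ 2 * min 1 (((2:ℝ) ^ (-(κ + L))) ^ (2 * (d + 3)))
              * ‖z κ‖ ^ 2) := by rw [← mul_pow]; norm_num
            _ = _ := by rw [hc]; simp only [Int.natAbs_neg]; ring
      _ ≤ _ := by
          refine mul_le_mul_of_nonneg_right ?_ (Finset.sum_nonneg fun κ _ =>
            mul_nonneg (mul_nonneg (by positivity) (hc0 _)) (by positivity))
          exact hWs.sum_shift_le_tsum (fun _ => by positivity) T L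
  rw [← ofReal_norm, ← ENNReal.ofReal_pow (norm_nonneg _)]
  refine (ENNReal.ofReal_le_ofReal hCS).trans ?_
  rw [Finset.mul_sum, ENNReal.ofReal_sum_of_nonneg fun κ _ => mul_nonneg hW0
    (mul_nonneg (mul_nonneg (by positivity) (hc0 _)) (by positivity)), Finset.mul_sum]
  refine Finset.sum_le_sum fun κ _ => ?_
  refine le_trans ?_ (mul_le_mul_right (ENNReal.le_tsum (-(κ + L))) _)
  rw [← ofReal_norm, ← ENNReal.ofReal_pow (norm_nonneg _), ← ENNReal.ofReal_mul (by positivity),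
    ← ENNReal.ofReal_mul (hc0 _), ← ENNReal.ofReal_mul (by positivity)]
  refine ENNReal.ofReal_le_ofReal ?_
  have hexp : 1 ≤ Real.exp (4 * Real.pi)
      * Real.exp (-(Real.pi * ((2:ℝ) ^ (-(κ + L) + κ)) ^ 2) * x ^ 2) := by
    rw [← Real.exp_add]
    refine Real.one_le_exp ?_
    have h6 : (2:ℝ) ^ (-(κ + L) + κ) * x ≤ 2 := by
      calc (2:ℝ) ^ (-(κ + L) + κ) * x ≤ (2:ℝ) ^ (-(κ + L) + κ) * (2:ℝ) ^ (L + 1) := by gcongr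
        _ = 2 := by rw [← zpow_add₀ (by norm_num)]; ring_nf; norm_num
    have h7 : ((2:ℝ) ^ (-(κ + L) + κ) * x) ^ 2 ≤ 4 := by
      calc _ ≤ (2:ℝ) ^ 2 := by gcongr
        _ = 4 := by norm_num
    nlinarith [Real.pi_pos]
  have hnn : 0 ≤ W * ((M * R ^ (d + 3)) ^ 2 * c (-(κ + L)) * ‖z κ‖ ^ 2) :=
    mul_nonneg hW0 (mul_nonneg (mul_nonneg (by positivity) (hc0 _)) (by positivity))
  calc _ ≤ (W * ((M * R ^ (d + 3)) ^ 2 * c (-(κ + L)) * ‖z κ‖ ^ 2)) * (Real.exp (4 * Real.pi)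
      * Real.exp (-(Real.pi * ((2:ℝ) ^ (-(κ + L) + κ)) ^ 2) * x ^ 2)) :=
        le_mul_of_one_le_right hnn hexp
    _ = _ := by ring

/-- Almost orthogonality of the frequency-localised contributions of distinct scales. -/
theorem lintegral_sq_sum_scales_le (d : ℕ) :
    ∃ C : ℝ, 0 < C ∧ ∀ (M R A : ℝ) (s : ℕ), 0 ≤ M → 1 ≤ R → 0 ≤ A →
      ∀ (ι : Type) (S : Finset ι) (Q : ι → Set (Rd d)) (b : ι → Rd d → ℝ) (k : ι → ℤ),
      (∀ i ∈ S, MeanZeroAtom (Q i) (b i) A (√d * ((2:ℝ) ^ k i / 2 ^ s))) →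
      (S : Set ι).PairwiseDisjoint Q →
      ∀ e : ℤ → Rd d → ℂ, (∀ ξ, ξ ≠ 0 → ∀ κ, ‖e κ ξ‖ ≤ M) →
      (∀ ξ, ξ ≠ 0 → ∀ κ, ‖e κ ξ‖ * (R⁻¹ * ((2:ℝ) ^ κ * ‖ξ‖)) ^ (d + 3) ≤ M) →
      ∫⁻ ξ, ‖∑ i ∈ S, e (k i) ξ * realFourier (b i) ξ‖ₑ ^ 2
        ≤ ENNReal.ofReal (C * M ^ 2 * R ^ (2 * (d + 3)) * A ^ 2 / 2 ^ s)
          * ∑ i ∈ S, volume (Q i) := by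
  classical
  obtain ⟨C₁, hC₁, hG⟩ := gaussian_form_atoms_le (Rd d)
  set W : ℝ := ∑' j : ℤ, (3 / 4 : ℝ) ^ j.natAbs with hW
  set V : ℝ := ∑' j : ℤ, (2 / 3 : ℝ) ^ j.natAbs with hV
  have hWs : Summable fun j : ℤ => (3 / 4 : ℝ) ^ j.natAbs :=
    summable_pow_natAbs (by norm_num) (by norm_num)
  have hVs : Summable fun j : ℤ => (2 / 3 : ℝ) ^ j.natAbs :=
    summable_pow_natAbs (by norm_num) (by norm_num)
  have hW0 : 0 ≤ W := tsum_nonneg fun j => by positivity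
  have hV0 : 0 ≤ V := tsum_nonneg fun j => by positivity
  set D : ℝ := √d * (1 + √d) ^ (2 * (d + 1)) with hD
  have hD0 : 0 ≤ D := by positivity
  refine ⟨W * Real.exp (4 * Real.pi) * C₁ * D * V + 1, by positivity, ?_⟩
  intro M R A s hM hR hA ι S Q b k hat hdis e he1 he2
  set T := S.image k with hT
  set c : ℤ → ℝ := fun j => (4 / 3) ^ j.natAbs * min 1 (((2:ℝ) ^ j) ^ (2 * (d + 3))) with hc
  have hc0 : ∀ j, 0 ≤ c j := fun j => by
    have : 0 ≤ min 1 (((2:ℝ) ^ j) ^ (2 * (d + 3))) := le_min zero_le_one (by positivity)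
    positivity
  set bb : ℤ → Rd d → ℂ := fun κ => realFourier fun x => ∑ i ∈ S with k i = κ, b i x with hbb
  set g : ℤ → ℤ → Rd d → ℝ≥0∞ := fun κ j ξ =>
    ENNReal.ofReal (Real.exp (-(Real.pi * ((2:ℝ) ^ (j + κ)) ^ 2) * ‖ξ‖ ^ 2)) * ‖bb κ ξ‖ₑ ^ 2 with hg
  have hbi : ∀ i ∈ S, Integrable (b i) := fun i hi => (hat i hi).integrable
  have hsum : ∀ ξ, ∑ i ∈ S, e (k i) ξ * realFourier (b i) ξ = ∑ κ ∈ T, e κ ξ * bb κ ξ := by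
    intro ξ
    rw [← Finset.sum_fiberwise_of_maps_to (s := S) (t := T) (g := k)
      fun i hi => Finset.mem_image_of_mem _ hi]
    refine Finset.sum_congr rfl fun κ _ => ?_
    rw [show bb κ ξ = _ from
      realFourier_finset_sum _ (fun i hi => hbi i (Finset.mem_filter.1 hi).1) ξ, Finset.mul_sum]
    refine Finset.sum_congr rfl fun i hi => ?_
    rw [(Finset.mem_filter.1 hi).2]
  have hbb0 : ∀ i ∈ S, realFourier (b i) 0 = 0 := fun i hi => by
    have : ∫ x, ((b i x : ℝ) : ℂ) = 0 := by
      rw [integral_complex_ofReal, (hat i hi).integral_zero]; simp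
    rw [realFourier, Real.fourier_eq]
    simpa using this
  have hcont : ∀ κ, Continuous (bb κ) := fun κ => realFourier_continuous
    (integrable_finsetSum _ fun i hi => hbi i (Finset.mem_filter.1 hi).1)
  have hpt : ∀ ξ, ‖∑ i ∈ S, e (k i) ξ * realFourier (b i) ξ‖ₑ ^ 2
      ≤ ENNReal.ofReal (W * (M * R ^ (d + 3)) ^ 2 * Real.exp (4 * Real.pi))
        * ∑ κ ∈ T, ∑' j : ℤ, ENNReal.ofReal (c j) * g κ j ξ := by
    intro ξ
    rcases eq_or_ne ξ 0 with rfl | hξ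
    · rw [Finset.sum_eq_zero fun i hi => by rw [hbb0 i hi, mul_zero]]
      simp
    have hξ0 : 0 < ‖ξ‖ := norm_pos_iff.2 hξ
    rw [hsum]
    exact enorm_sq_sum_scales_le d T hξ0 hM hR (he1 ξ hξ) (he2 ξ hξ)
  have hgm : ∀ κ j, Measurable (g κ j) := fun κ j => by
    have h1 : Continuous fun ξ : Rd d =>
      Real.exp (-(Real.pi * ((2:ℝ) ^ (j + κ)) ^ 2) * ‖ξ‖ ^ 2) := by fun_prop
    exact h1.measurable.ennreal_ofReal.mul ((hcont κ).enorm.measurable.pow_const 2)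
  have hgi : ∀ κ ∈ T, ∀ j, ENNReal.ofReal (c j) * ∫⁻ ξ, g κ j ξ
      ≤ ENNReal.ofReal (C₁ * A ^ 2 * (D / 2 ^ s) * (2 / 3) ^ j.natAbs)
        * ∑ i ∈ S with k i = κ, volume (Q i) := by
    intro κ _ j
    have h1 := hG ((2:ℝ) ^ (j + κ)) (√d * ((2:ℝ) ^ κ / 2 ^ s)) A (by positivity) (by positivity)
      hA ι {i ∈ S | k i = κ} Q b
      (fun i hi => by
        have := hat i (Finset.mem_filter.1 hi).1
        rwa [(Finset.mem_filter.1 hi).2] at this)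
      (hdis.subset fun i hi => (Finset.mem_filter.1 hi).1)
    calc _ ≤ ENNReal.ofReal (c j) * _ := mul_le_mul_right h1 _
      _ ≤ _ := by
        rw [← mul_assoc, ← ENNReal.ofReal_mul (hc0 j)]
        refine mul_le_mul_left (ENNReal.ofReal_le_ofReal ?_) _
        have h2 : √d * ((2:ℝ) ^ κ / 2 ^ s) / (2:ℝ) ^ (j + κ)
            = √d * ((2:ℝ) ^ s)⁻¹ * 2 ^ (-j) := by
          rw [zpow_add₀ (by norm_num), zpow_neg]
          field_simp
        have h3 := weight_mul_profile_le (t := ((2:ℝ) ^ s)⁻¹) (D := √d) (by positivity)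
          (inv_le_one_of_one_le₀ (one_le_pow₀ (by norm_num))) (by positivity) d j
        rw [h2, finrank_euclideanSpace_fin]
        calc _ = C₁ * A ^ 2 * (c j * (√d * ((2:ℝ) ^ s)⁻¹ * 2 ^ (-j)
              * (1 + √d * ((2:ℝ) ^ s)⁻¹ * 2 ^ (-j)) ^ (2 * (d + 1)))) := by ring
          _ ≤ C₁ * A ^ 2 * (((2:ℝ) ^ s)⁻¹ * (√d * (1 + √d) ^ (2 * (d + 1)))
              * (2 / 3) ^ j.natAbs) := by gcongr
          _ = _ := by rw [hD]; ring
  have hB0 : 0 ≤ C₁ * A ^ 2 * (D / 2 ^ s) := by positivity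
  calc _ ≤ ∫⁻ ξ, ENNReal.ofReal (W * (M * R ^ (d + 3)) ^ 2 * Real.exp (4 * Real.pi))
        * ∑ κ ∈ T, ∑' j : ℤ, ENNReal.ofReal (c j) * g κ j ξ := lintegral_mono hpt
    _ = ENNReal.ofReal (W * (M * R ^ (d + 3)) ^ 2 * Real.exp (4 * Real.pi))
        * ∑ κ ∈ T, ∑' j : ℤ, ENNReal.ofReal (c j) * ∫⁻ ξ, g κ j ξ := by
        have hm : ∀ κ, Measurable fun ξ => ∑' j : ℤ, ENNReal.ofReal (c j) * g κ j ξ := fun κ =>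
          Measurable.tsum fun j => (hgm κ j).const_mul _
        rw [lintegral_const_mul _ (Finset.measurable_fun_sum _ fun κ _ => hm κ),
          lintegral_finsetSum _ fun κ _ => hm κ]
        congr 1
        refine Finset.sum_congr rfl fun κ _ => ?_
        rw [lintegral_tsum fun j => ((hgm κ j).const_mul _).aemeasurable]
        exact tsum_congr fun j => lintegral_const_mul _ (hgm κ j)
    _ ≤ ENNReal.ofReal (W * (M * R ^ (d + 3)) ^ 2 * Real.exp (4 * Real.pi))
        * ∑ κ ∈ T, ENNReal.ofReal (C₁ * A ^ 2 * (D / 2 ^ s) * V)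
          * ∑ i ∈ S with k i = κ, volume (Q i) := by
        gcongr with κ hκ
        refine (ENNReal.tsum_le_tsum fun j => hgi κ hκ j).trans_eq ?_
        rw [ENNReal.tsum_mul_right, ← ENNReal.ofReal_tsum_of_nonneg (fun j => by positivity)
          (hVs.mul_left _), tsum_mul_left]
    _ = ENNReal.ofReal (W * (M * R ^ (d + 3)) ^ 2 * Real.exp (4 * Real.pi))
        * (ENNReal.ofReal (C₁ * A ^ 2 * (D / 2 ^ s) * V) * ∑ i ∈ S, volume (Q i)) := by
        rw [← Finset.mul_sum, Finset.sum_fiberwise_of_maps_to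
          fun i hi => Finset.mem_image_of_mem _ hi]
    _ ≤ _ := by
        rw [← mul_assoc, ← ENNReal.ofReal_mul (by positivity)]
        gcongr
        have h0 : 0 ≤ M ^ 2 * R ^ (2 * (d + 3)) * A ^ 2 / 2 ^ s := by positivity
        calc _ = W * Real.exp (4 * Real.pi) * C₁ * D * V
              * (M ^ 2 * R ^ (2 * (d + 3)) * A ^ 2 / 2 ^ s) := by ring
          _ ≤ (W * Real.exp (4 * Real.pi) * C₁ * D * V + 1)
              * (M ^ 2 * R ^ (2 * (d + 3)) * A ^ 2 / 2 ^ s) := by gcongr; linarith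
          _ = _ := by ring

theorem memLp_two_of_integrable_of_bound {α : Type*} [MeasurableSpace α] {μ : Measure α}
    {f : α → ℝ} (hf : Integrable f μ) {B : ℝ} (hB : ∀ x, |f x| ≤ B) : MemLp f 2 μ := by
  refine (memLp_two_iff_integrable_sq hf.aestronglyMeasurable).2 ?_
  refine (hf.abs.const_mul B).mono' (hf.aestronglyMeasurable.pow 2) (ae_of_all _ fun x => ?_)
  rw [Real.norm_of_nonneg (sq_nonneg _), ← sq_abs, sq]
  gcongr
  exact hB x

theorem AdmissiblePhi.integrable_Kker {d : ℕ} {φ : Rd d → ℝ} (hφ : AdmissiblePhi d φ)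
    {w : Rd d → ℝ} {M : ℝ} (hw : Measurable w) (hM : ∀ x, |w x| ≤ M) (k : ℤ) :
    Integrable (Kker d φ w k) := by
  obtain ⟨B, -, hB⟩ := hφ.exists_bound
  have hs : Function.support (Kker d φ w k) ⊆ closedBall 0 ((2:ℝ) ^ k / 4) := fun x hx => by
    rw [mem_closedBall_zero_iff]
    exact (hφ.norm_of_Kker_ne_zero hx).2.1.le
  rw [← integrableOn_iff_integrable_of_support_subset hs]
  exact Measure.integrableOn_of_bounded measure_closedBall_lt_top.ne
    (measurable_Kker hφ hw k).aestronglyMeasurable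
    (ae_of_all _ fun x => abs_Kker_le hφ hB hM k x)

theorem abs_integral_sub_mul_le {E : Type*} [NormedAddCommGroup E] [MeasureSpace E]
    {K b : E → ℝ} {B : ℝ} (hK : ∀ x, |K x| ≤ B) (hb : Integrable b) (x : E) :
    |∫ y, K (x - y) * b y| ≤ B * ∫ y, |b y| := by
  rw [← integral_const_mul, ← Real.norm_eq_abs]
  refine norm_integral_le_of_norm_le (hb.abs.const_mul B) (ae_of_all _ fun y => ?_)
  rw [norm_mul]
  exact mul_le_mul_of_nonneg_right (hK _) (abs_nonneg _)

theorem AdmissiblePhi.integrable_sum_conv {d : ℕ} {φ : Rd d → ℝ} (hφ : AdmissiblePhi d φ)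
    {w : Rd d → ℝ} {M : ℝ} (hw : Measurable w) (hM : ∀ x, |w x| ≤ M) {ι : Type} (S : Finset ι)
    {b : ι → Rd d → ℝ} (k : ι → ℤ) (hb : ∀ i ∈ S, Integrable (b i)) :
    Integrable (fun x => ∑ i ∈ S, ∫ y, Kker d φ w (k i) (x - y) * b i y) :=
  integrable_finsetSum _ fun i hi =>
    integrable_integral_sub_mul (hφ.integrable_Kker hw hM _) (hb i hi)

theorem AdmissiblePhi.lintegral_realFourier_sum_conv_sq {d : ℕ} {φ : Rd d → ℝ}
    (hφ : AdmissiblePhi d φ)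
    {w : Rd d → ℝ} {M : ℝ} (hw : Measurable w) (hM : ∀ x, |w x| ≤ M) {ι : Type} (S : Finset ι)
    {b : ι → Rd d → ℝ} (k : ι → ℤ) (hb : ∀ i ∈ S, Integrable (b i)) :
    ∫⁻ ξ, ‖∑ i ∈ S, realFourier (Kker d φ w (k i)) ξ * realFourier (b i) ξ‖ₑ ^ 2
      = ∫⁻ x, ‖∑ i ∈ S, ∫ y, Kker d φ w (k i) (x - y) * b i y‖ₑ ^ 2 := by
  obtain ⟨B, -, hB⟩ := hφ.exists_bound
  have h2 : MemLp (fun x => ∑ i ∈ S, ∫ y, Kker d φ w (k i) (x - y) * b i y) 2 :=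
    memLp_finsetSum _ fun i hi => memLp_two_of_integrable_of_bound
      (integrable_integral_sub_mul (hφ.integrable_Kker hw hM _) (hb i hi))
      (abs_integral_sub_mul_le (abs_Kker_le hφ hB hM _) (hb i hi))
  rw [← lintegral_realFourier_sq (hφ.integrable_sum_conv hw hM S k hb) h2]
  refine lintegral_congr fun ξ => ?_
  rw [realFourier_finset_sum _ fun i hi =>
    integrable_integral_sub_mul (hφ.integrable_Kker hw hM _) (hb i hi)]
  congr 2
  exact Finset.sum_congr rfl fun i hi =>
    (realFourier_conv (hφ.integrable_Kker hw hM _) (hb i hi) ξ).symm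

theorem Kker_eq_sum_indicator_add {d : ℕ} (φ w : Rd d → ℝ) {β : Type*} [DecidableEq β]
    (cell : Rd d → β) (J : Finset β) (k : ℤ) (x : Rd d) :
    Kker d φ w k x = (∑ μ ∈ J, Kker d φ ({x | cell x = μ}.indicator w) k x)
      + Kker d φ ({x | cell x ∉ J}.indicator w) k x := by
  simp only [Kker, ← Finset.sum_mul, ← Finset.mul_sum, ← add_mul, ← mul_add]
  congr 2
  simp only [indicator_apply, mem_ofPred_eq, Finset.sum_ite_eq]
  by_cases h : cell x ∈ J <;> simp [h]

theorem enorm_sq_sum_add_le {β : Type*} (J J₀ : Finset β) (h : J ⊆ J₀) (a : β → ℂ) (z : ℂ) {N : ℝ}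
    (hN : (J.card : ℝ) ≤ N) :
    ‖(∑ μ ∈ J, a μ) + z‖ₑ ^ 2
      ≤ ENNReal.ofReal (2 * N) * (∑ μ ∈ J₀, ‖a μ‖ₑ ^ 2) + 2 * ‖z‖ₑ ^ 2 := by
  have hN0 : 0 ≤ N := (Nat.cast_nonneg _).trans hN
  have hr : ‖(∑ μ ∈ J, a μ) + z‖ ^ 2 ≤ 2 * N * (∑ μ ∈ J₀, ‖a μ‖ ^ 2) + 2 * ‖z‖ ^ 2 := by
    have h1 : ‖(∑ μ ∈ J, a μ) + z‖ ≤ (∑ μ ∈ J, ‖a μ‖) + ‖z‖ :=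
      (norm_add_le _ _).trans (by gcongr; exact norm_sum_le _ _)
    have h2 : (∑ μ ∈ J, ‖a μ‖) ^ 2 ≤ N * ∑ μ ∈ J₀, ‖a μ‖ ^ 2 := by
      refine sq_sum_le_card_mul_sum_sq.trans ?_
      gcongr
    have h0 : 0 ≤ ∑ μ ∈ J, ‖a μ‖ := Finset.sum_nonneg fun _ _ => norm_nonneg _
    calc _ ≤ ((∑ μ ∈ J, ‖a μ‖) + ‖z‖) ^ 2 := by gcongr
      _ ≤ _ := by nlinarith [sq_nonneg ((∑ μ ∈ J, ‖a μ‖) - ‖z‖)]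
  simp only [← ofReal_norm, ← ENNReal.ofReal_pow (norm_nonneg _)]
  rw [← ENNReal.ofReal_sum_of_nonneg fun _ _ => by positivity,
    ← ENNReal.ofReal_mul (by positivity), show (2:ℝ≥0∞) = ENNReal.ofReal 2 by simp,
    ← ENNReal.ofReal_mul (by positivity), ← ENNReal.ofReal_add
      (mul_nonneg (by positivity) (Finset.sum_nonneg fun _ _ => by positivity)) (by positivity)]
  exact ENNReal.ofReal_le_ofReal hr

theorem lintegral_sq_sum_conv_atoms_le_param {d : ℕ} {φ : Rd d → ℝ} (hφ : AdmissiblePhi d φ) :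
    ∃ C : ℝ, 0 < C ∧ ∀ (w : Rd d → ℝ) (M R A : ℝ) (s : ℕ), Measurable w → Homogeneous0 d w →
      (∀ x, |w x| ≤ M) → 1 ≤ R → R ≤ 2 ^ s → 0 ≤ A →
      ∀ (ι : Type) (S : Finset ι) (Q : ι → Set (Rd d)) (b : ι → Rd d → ℝ) (k : ι → ℤ),
        (∀ i ∈ S, MeanZeroAtom (Q i) (b i) A (√d * (2 ^ k i / 2 ^ s))) →
        (S : Set ι).PairwiseDisjoint Q →
        ∫⁻ x, ‖∑ i ∈ S, ∫ y, Kker d φ w (k i) (x - y) * b i y‖ₑ ^ 2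
          ≤ ENNReal.ofReal (C * (M * A) ^ 2 * (R⁻¹ + R ^ (2 * (d + 3)) / 2 ^ s))
            * ∑ i ∈ S, volume (Q i) := by
  classical
  obtain ⟨C₁, hC₁, hcell⟩ := exists_cell_count d
  obtain ⟨C₂, hC₂, hpiece⟩ := lintegral_sq_angular_piece_le hφ
  obtain ⟨C₃, hC₃, hscale⟩ := lintegral_sq_sum_scales_le d
  obtain ⟨D₀, hD₀, hdec0⟩ := kernel_fourier_decay hφ 0
  obtain ⟨D₁, hD₁, hdec1⟩ := kernel_fourier_decay hφ (d + 3)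
  refine ⟨2 * C₁ ^ 2 * C₂ + 2 * C₃ * (D₀ + D₁) ^ 2, by positivity, ?_⟩
  intro w M R A s hw hhom hM hR hRs hA ι S Q b k hat hdis
  have hM0 : 0 ≤ M := (abs_nonneg _).trans (hM 0)
  have hR0 : 0 < R := by linarith
  have hb : ∀ i ∈ S, Integrable (b i) := fun i hi => (hat i hi).integrable
  obtain ⟨J, -, hJcard, hJ'⟩ := hcell R hR
  have hJ'' : ∀ ξ : Rd d, ∃ J' ⊆ J, (J'.card : ℝ) ≤ C₁ * R⁻¹ ^ 2 * R ^ d ∧ (ξ ≠ 0 → ∀ x : Rd d,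
      x ≠ 0 → cellIdx R x ∉ J' → R⁻¹ * ‖x‖ * ‖ξ‖ ≤ |⟪x, ξ⟫|) := fun ξ => by
    by_cases h : ξ = 0
    · exact ⟨∅, by simp, by simp only [Finset.card_empty, Nat.cast_zero]; positivity,
        fun h' => absurd h h'⟩
    · obtain ⟨J', h1, h2, h3⟩ := hJ' ξ h
      exact ⟨J', h1, h2, fun _ => h3⟩
  choose Jx hJsub hJc hJang using hJ''
  have hind : ∀ (s : Set (Rd d)) x, |s.indicator w x| ≤ M := fun s x => by
    by_cases h : x ∈ s
    · rw [indicator_of_mem h]; exact hM x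
    · rw [indicator_of_notMem h, abs_zero]; exact hM0
  set wc : (Fin d → ℤ) → Rd d → ℝ := fun μ => {x | cellIdx R x = μ}.indicator w with hwc
  set we : Rd d → Rd d → ℝ := fun ξ => {x | cellIdx R x ∉ Jx ξ}.indicator w with hwe
  have hwcm : ∀ μ, Measurable (wc μ) := fun μ =>
    hw.indicator (measurable_cellIdx R (measurableSet_singleton μ))
  have hwem : ∀ ξ, Measurable (we ξ) := fun ξ =>
    hw.indicator (measurable_cellIdx R ((Jx ξ : Set (Fin d → ℤ)).to_countable.measurableSet.compl))
  have hweh : ∀ ξ, Homogeneous0 d (we ξ) := fun ξ x hx r hr => by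
    simp only [hwe, indicator_apply, mem_ofPred_eq, cellIdx_smul R x hr, hhom x hx r hr]
  have hwes : ∀ ξ, ξ ≠ 0 → ∀ x, we ξ x ≠ 0 → R⁻¹ * ‖x‖ * ‖ξ‖ ≤ |⟪x, ξ⟫| := fun ξ hξ x hx => by
    by_cases hx0 : x = 0
    · simp [hx0]
    · exact hJang ξ hξ x hx0 (mem_of_indicator_ne_zero (s := {x | cellIdx R x ∉ Jx ξ}) hx)
  set e : ℤ → Rd d → ℂ := fun κ ξ => realFourier (Kker d φ (we ξ) κ) ξ with he
  set G : (Fin d → ℤ) → Rd d → ℂ := fun μ ξ =>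
    ∑ i ∈ S, realFourier (Kker d φ (wc μ) (k i)) ξ * realFourier (b i) ξ with hG
  have hGc : ∀ μ, Continuous (G μ) := fun μ => continuous_finsetSum _ fun i hi =>
    (realFourier_continuous (hφ.integrable_Kker (hwcm μ) (hind _) _)).mul
      (realFourier_continuous (hb i hi))
  have hsplit : ∀ ξ, ∑ i ∈ S, realFourier (Kker d φ w (k i)) ξ * realFourier (b i) ξ
      = (∑ μ ∈ Jx ξ, G μ ξ) + ∑ i ∈ S, e (k i) ξ * realFourier (b i) ξ := fun ξ => by
    rw [hG, Finset.sum_comm, ← Finset.sum_add_distrib]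
    refine Finset.sum_congr rfl fun i _ => ?_
    rw [← Finset.sum_mul, ← add_mul]
    congr 1
    have h1 : ∀ μ ∈ Jx ξ, Integrable (Kker d φ (wc μ) (k i)) := fun μ _ =>
      hφ.integrable_Kker (hwcm μ) (hind _) _
    rw [← realFourier_finset_sum _ h1, ← realFourier_add (integrable_finsetSum _ h1)
      (hφ.integrable_Kker (hwem ξ) (hind _) _)]
    congr 1
    ext x
    exact Kker_eq_sum_indicator_add φ w (cellIdx R) (Jx ξ) (k i) x
  have hmain : ∀ μ, ∫⁻ ξ, ‖G μ ξ‖ₑ ^ 2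
      ≤ ENNReal.ofReal (C₂ * (A * (M * (R / R ^ d))) ^ 2) * ∑ i ∈ S, volume (Q i) := fun μ => by
    rw [hφ.lintegral_realFourier_sum_conv_sq (hwcm μ) (hind _) S k hb]
    exact hpiece (wc μ) M R A s μ (hwcm μ) (hind _) hR hRs hA
      (fun x hx _ => mem_of_indicator_ne_zero (s := {x | cellIdx R x = μ}) hx) ι S Q b k hat hdis
  have herr := hscale ((D₀ + D₁) * M) R A s (by positivity) hR hA ι S Q b k hat hdis e
    (fun ξ hξ κ => by
      have := hdec0 (we ξ) M (hwem ξ) (hweh ξ) (hind _) ξ R⁻¹ (by positivity) (hwes ξ hξ) κ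
      rw [pow_zero, mul_one] at this
      exact this.trans (by gcongr; linarith))
    (fun ξ hξ κ => by
      have := hdec1 (we ξ) M (hwem ξ) (hweh ξ) (hind _) ξ R⁻¹ (by positivity) (hwes ξ hξ) κ
      exact this.trans (by gcongr; linarith))
  set V := ∑ i ∈ S, volume (Q i) with hV
  rw [← hφ.lintegral_realFourier_sum_conv_sq hw hM S k hb]
  have hRd : R / R ^ d * (R / R ^ d) * (R⁻¹ ^ 2 * R ^ d) * (R⁻¹ * R ^ d) = R⁻¹ := by
    field_simp
  calc _ ≤ ∫⁻ ξ, (ENNReal.ofReal (2 * (C₁ * R⁻¹ ^ 2 * R ^ d)) * (∑ μ ∈ J, ‖G μ ξ‖ₑ ^ 2)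
        + 2 * ‖∑ i ∈ S, e (k i) ξ * realFourier (b i) ξ‖ₑ ^ 2) := by
        refine lintegral_mono fun ξ => ?_
        simp only [hsplit ξ]
        exact enorm_sq_sum_add_le _ _ (hJsub ξ) _ _ (hJc ξ)
    _ = ENNReal.ofReal (2 * (C₁ * R⁻¹ ^ 2 * R ^ d)) * (∑ μ ∈ J, ∫⁻ ξ, ‖G μ ξ‖ₑ ^ 2)
        + 2 * ∫⁻ ξ, ‖∑ i ∈ S, e (k i) ξ * realFourier (b i) ξ‖ₑ ^ 2 := by
        have hm : ∀ μ, Measurable fun ξ => ‖G μ ξ‖ₑ ^ 2 := fun μ =>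
          (hGc μ).enorm.measurable.pow_const 2
        have hms : Measurable fun ξ => ∑ μ ∈ J, ‖G μ ξ‖ₑ ^ 2 :=
          Finset.measurable_fun_sum _ fun μ _ => hm μ
        rw [lintegral_add_left (hms.const_mul _), lintegral_const_mul _ hms,
          lintegral_finsetSum _ fun μ _ => hm μ, lintegral_const_mul' _ _ (by simp)]
    _ ≤ ENNReal.ofReal (2 * (C₁ * R⁻¹ ^ 2 * R ^ d)) * (∑ _μ ∈ J,
          ENNReal.ofReal (C₂ * (A * (M * (R / R ^ d))) ^ 2) * V)
        + 2 * (ENNReal.ofReal (C₃ * ((D₀ + D₁) * M) ^ 2 * R ^ (2 * (d + 3)) * A ^ 2 / 2 ^ s)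
          * V) := by
        gcongr with μ _
        exact hmain μ
    _ ≤ ENNReal.ofReal (2 * C₁ ^ 2 * C₂ * (M * A) ^ 2 * R⁻¹) * V
        + ENNReal.ofReal (2 * C₃ * (D₀ + D₁) ^ 2 * (M * A) ^ 2 * (R ^ (2 * (d + 3)) / 2 ^ s))
          * V := by
        rw [Finset.sum_const, nsmul_eq_mul, ← mul_assoc, ← mul_assoc, ← mul_assoc (2 : ℝ≥0∞),
          ← ENNReal.ofReal_natCast, show (2:ℝ≥0∞) = ENNReal.ofReal 2 by simp,
          ← ENNReal.ofReal_mul (by positivity), ← ENNReal.ofReal_mul (by positivity),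
          ← ENNReal.ofReal_mul (by positivity)]
        refine add_le_add (mul_le_mul_left (ENNReal.ofReal_le_ofReal ?_) _)
          (mul_le_mul_left (ENNReal.ofReal_le_ofReal ?_) _)
        · calc _ ≤ 2 * (C₁ * R⁻¹ ^ 2 * R ^ d) * (C₁ * R⁻¹ * R ^ d)
                * (C₂ * (A * (M * (R / R ^ d))) ^ 2) := by gcongr
            _ = 2 * C₁ ^ 2 * C₂ * (M * A) ^ 2 *
              (R / R ^ d * (R / R ^ d) * (R⁻¹ ^ 2 * R ^ d) * (R⁻¹ * R ^ d)) := by ring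
            _ = _ := by rw [hRd]
        · exact le_of_eq (by ring)
    _ ≤ _ := by
        rw [← add_mul, ← ENNReal.ofReal_add (by positivity) (by positivity)]
        gcongr
        have h1 : 0 ≤ 2 * C₁ ^ 2 * C₂ * (M * A) ^ 2 * (R ^ (2 * (d + 3)) / 2 ^ s) := by positivity
        have h2 : 0 ≤ 2 * C₃ * (D₀ + D₁) ^ 2 * (M * A) ^ 2 * R⁻¹ := by positivity
        nlinarith

/-- `L²` decay in `s` for a sum of rough dyadic convolutions applied to mean-zero atoms that live
`2^s` times below the scale of the kernels. -/
theorem lintegral_sq_sum_conv_atoms_le {d : ℕ} {φ : Rd d → ℝ} (hφ : AdmissiblePhi d φ) :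
    ∃ C : ℝ, 0 < C ∧ ∃ δ : ℝ, 0 < δ ∧ ∀ (w : Rd d → ℝ) (M A : ℝ) (s : ℕ), Measurable w →
      Homogeneous0 d w → (∀ x, |w x| ≤ M) → 0 ≤ A →
      ∀ (ι : Type) (S : Finset ι) (Q : ι → Set (Rd d)) (b : ι → Rd d → ℝ) (k : ι → ℤ),
        (∀ i ∈ S, MeanZeroAtom (Q i) (b i) A (√d * (2 ^ k i / 2 ^ s))) →
        (S : Set ι).PairwiseDisjoint Q →
        ∫⁻ x, ‖∑ i ∈ S, ∫ y, Kker d φ w (k i) (x - y) * b i y‖ₑ ^ 2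
          ≤ ENNReal.ofReal (C * (M * A) ^ 2 * (2:ℝ) ^ (-δ * s)) * ∑ i ∈ S, volume (Q i) := by
  obtain ⟨C, hC, h⟩ := lintegral_sq_sum_conv_atoms_le_param hφ
  set P : ℕ := 2 * (d + 3) with hP
  refine ⟨2 * C, by positivity, 1 / (P + 1), by positivity, ?_⟩
  intro w M A s hw hhom hM hA ι S Q b k hat hdis
  set R : ℝ := (2:ℝ) ^ ((s:ℝ) / (P + 1)) with hR
  have hR0 : 0 < R := by positivity
  have hRp : R ^ (P + 1) = 2 ^ s := by
    rw [hR, ← Real.rpow_natCast, ← Real.rpow_mul (by norm_num), ← Real.rpow_natCast]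
    congr 1
    push_cast
    field_simp
  have hR1 : 1 ≤ R := Real.one_le_rpow (by norm_num) (by positivity)
  have hRi : R⁻¹ = (2:ℝ) ^ (-(1 / ((P:ℝ) + 1)) * s) := by
    rw [hR, ← Real.rpow_neg (by norm_num)]
    congr 1
    ring
  refine (h w M R A s hw hhom hM hR1 (hRp ▸ le_self_pow₀ hR1 (by omega)) hA ι S Q b k hat
    hdis).trans (le_of_eq ?_)
  rw [← hRi, ← hRp, pow_succ]
  congr 2
  field_simp
  ring

theorem omegaL1_nonneg (d : ℕ) (Ω : Rd d → ℝ) : 0 ≤ omegaL1 d Ω :=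
  integral_nonneg fun _ => abs_nonneg _

theorem log_two_mul_omegaL1_le_constCOmega {d : ℕ} {Ω : Rd d → ℝ} (hΩ : OmegaHyp d Ω) :
    Real.log 2 * omegaL1 d Ω ≤ constCOmega d Ω := by
  have h1 : Real.log 2 * omegaL1 d Ω ≤ omegaLlogL d Ω := by
    rw [omegaL1, omegaLlogL, sphInt, sphInt, ← integral_const_mul]
    refine integral_mono (hΩ.2.1.abs.const_mul _) hΩ.2.2.2 fun θ => ?_
    rw [mul_comm]
    refine mul_le_mul_of_nonneg_left (Real.log_le_log (by norm_num) ?_) (abs_nonneg _)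
    linarith [abs_nonneg (Ω θ)]
  have h2 : 0 ≤ sphInt d (fun x => |Ω x| * (1 + max (Real.log (|Ω x| / omegaL1 d Ω)) 0)) :=
    integral_nonneg fun θ => mul_nonneg (abs_nonneg _)
      (add_nonneg zero_le_one (le_max_right _ _))
  rw [constCOmega]
  linarith

theorem Homogeneous0.ae_eq_of_sphere {d : ℕ} (hd : 1 ≤ d) {Ω Ω' : Rd d → ℝ}
    (h : Homogeneous0 d Ω) (h' : Homogeneous0 d Ω')
    (hs : ∀ᵐ θ : sphere (0 : Rd d) 1 ∂sphereMeasure d, Ω θ = Ω' θ) :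
    Ω =ᵐ[volume] Ω' := by
  have : Nonempty (Fin d) := ⟨⟨0, hd⟩⟩
  have h1 : ∀ᵐ p : sphere (0 : Rd d) 1 × Ioi (0:ℝ) ∂(sphereMeasure d).prod
      (Measure.volumeIoiPow (Module.finrank ℝ (Rd d) - 1)), Ω p.1 = Ω' p.1 :=
    Measure.quasiMeasurePreserving_fst.ae hs
  have h2 := ((volume : Measure (Rd d)).measurePreserving_homeomorphUnitSphereProd).quasiMeasurePreserving.ae h1
  have h3 : ∀ᵐ x : ({0}ᶜ : Set (Rd d)) ∂(volume : Measure (Rd d)).comap (↑), Ω x = Ω' x := by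
    filter_upwards [h2] with x hx
    have hx0 : 0 < ‖(x : Rd d)‖ := norm_pos_iff.2 x.2
    simp only [homeomorphUnitSphereProd_apply_fst_coe] at hx
    rwa [h _ x.2 _ (inv_pos.2 hx0), h' _ x.2 _ (inv_pos.2 hx0)] at hx
  rw [← ae_restrict_iff_subtype (p := fun x => Ω x = Ω' x) (measurableSet_singleton 0).compl,
    ae_restrict_iff' (measurableSet_singleton 0).compl] at h3
  filter_upwards [h3, compl_mem_ae_iff.2 (measure_singleton (0 : Rd d))] with x hx hx0
  exact hx hx0

/-- A bounded homogeneous function that is a.e.-measurable on the sphere has a measurable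
homogeneous representative with the same bound. -/
theorem Homogeneous0.exists_measurable_representative {d : ℕ} (hd : 1 ≤ d) {Ω : Rd d → ℝ}
    (h : Homogeneous0 d Ω)
    (hm : AEMeasurable (fun θ : sphere (0 : Rd d) 1 => Ω θ) (sphereMeasure d))
    {M : ℝ} (hM : ∀ x, |Ω x| ≤ M) :
    ∃ Ω' : Rd d → ℝ, Measurable Ω' ∧ Homogeneous0 d Ω' ∧ (∀ x, |Ω' x| ≤ M) ∧
      Ω =ᵐ[volume] Ω' := by
  have hM0 : 0 ≤ M := (abs_nonneg _).trans (hM 0)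
  set G : Rd d → ℝ := Function.extend (Subtype.val : sphere (0 : Rd d) 1 → Rd d) (hm.mk _) 0 with hG
  have hemb : MeasurableEmbedding (Subtype.val : sphere (0 : Rd d) 1 → Rd d) :=
    MeasurableEmbedding.subtype_coe isClosed_sphere.measurableSet
  have hGm : Measurable G := hemb.measurable_extend hm.measurable_mk measurable_zero
  have hΩ'h : Homogeneous0 d fun x => max (-M) (min (G (‖x‖⁻¹ • x)) M) := fun x hx r hr => by
    have : ‖r • x‖⁻¹ • r • x = ‖x‖⁻¹ • x := by
      rw [norm_smul, Real.norm_of_nonneg hr.le, smul_smul, mul_inv, mul_comm r⁻¹, mul_assoc,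
        inv_mul_cancel₀ hr.ne', mul_one]
    simp only [this]
  refine ⟨fun x => max (-M) (min (G (‖x‖⁻¹ • x)) M), ?_, hΩ'h, fun x => ?_, ?_⟩
  · have h1 : Measurable fun x : Rd d => ‖x‖⁻¹ • x := measurable_norm.inv.smul measurable_id
    exact measurable_const.max ((hGm.comp h1).min measurable_const)
  · exact abs_le.2 ⟨le_max_left _ _, max_le (by linarith) (min_le_right _ _)⟩
  · refine h.ae_eq_of_sphere hd hΩ'h ?_
    filter_upwards [hm.ae_eq_mk] with θ hθ
    have hθ1 : ‖(θ : Rd d)‖ = 1 := by simp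
    have hGθ : G θ = Ω θ := by
      rw [hG, hemb.injective.extend_apply]
      exact hθ.symm
    obtain ⟨h1, h2⟩ := abs_le.1 (hM θ)
    rw [hθ1, inv_one, one_smul, hGθ, min_eq_left h2, max_eq_right h1]

theorem abs_Omega2_le (d : ℕ) (Ω : Rd d → ℝ) (η : ℝ) (s : ℕ) (x : Rd d) :
    |Omega2 d Ω η s x| ≤ (2:ℝ) ^ (η * s) * omegaL1 d Ω := by
  have : 0 ≤ (2:ℝ) ^ (η * s) * omegaL1 d Ω := mul_nonneg (by positivity) (omegaL1_nonneg d Ω)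
  rw [Omega2]
  split_ifs with h
  · exact h.le
  · rwa [abs_zero]

theorem OmegaHyp.exists_representative_Omega2 {d : ℕ} (hd : 1 ≤ d) {Ω : Rd d → ℝ}
    (hΩ : OmegaHyp d Ω) (η : ℝ) (s : ℕ) :
    ∃ Ω' : Rd d → ℝ, Measurable Ω' ∧ Homogeneous0 d Ω' ∧
      (∀ x, |Ω' x| ≤ (2:ℝ) ^ (η * s) * omegaL1 d Ω) ∧ Omega2 d Ω η s =ᵐ[volume] Ω' := by
  refine Homogeneous0.exists_measurable_representative hd (fun x hx r hr => ?_) ?_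
    (abs_Omega2_le d Ω η s)
  · simp only [Omega2, hΩ.1 x hx r hr]
  · have h1 : Measurable fun t : ℝ => if |t| < (2:ℝ) ^ (η * s) * omegaL1 d Ω then t else 0 :=
      Measurable.ite (measurableSet_lt continuous_abs.measurable measurable_const) measurable_id
        measurable_const
    exact h1.comp_aemeasurable hΩ.2.1.aemeasurable

theorem integral_Kker_sub_mul_congr {d : ℕ} (φ : Rd d → ℝ) {w w' : Rd d → ℝ}
    (h : w =ᵐ[volume] w') (k : ℤ) (g : Rd d → ℝ) (x : Rd d) :
    ∫ y, Kker d φ w k (x - y) * g y = ∫ y, Kker d φ w' k (x - y) * g y := by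
  refine integral_congr_ae ?_
  filter_upwards [(Measure.measurePreserving_sub_left volume x).quasiMeasurePreserving.ae h] with y hy
  simp only [Kker, hy]

theorem mem_dcube_iff {d : ℕ} {w : Fin d → ℝ} {k : ℤ} {m : Fin d → ℤ} {x : Rd d} :
    x ∈ dcube d w k m ↔ m = fun i => ⌊x i / 2 ^ k - w i⌋ := by
  have hk : (0:ℝ) < 2 ^ k := by positivity
  simp only [dcube, mem_ofPred_eq, funext_iff]
  refine forall_congr' fun i => ?_
  rw [eq_comm, Int.floor_eq_iff, le_sub_iff_add_le, sub_lt_iff_lt_add, le_div_iff₀ hk,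
    div_lt_iff₀ hk]
  constructor <;> rintro ⟨h1, h2⟩ <;> constructor <;> linarith

theorem eq_of_mem_dcube {d : ℕ} {w : Fin d → ℝ} {k : ℤ} {m m' : Fin d → ℤ} {x : Rd d}
    (h : x ∈ dcube d w k m) (h' : x ∈ dcube d w k m') : m = m' :=
  (mem_dcube_iff.1 h).trans (mem_dcube_iff.1 h').symm

theorem measurableSet_dcube {d : ℕ} (w : Fin d → ℝ) (k : ℤ) (m : Fin d → ℤ) :
    MeasurableSet (dcube d w k m) :=
  measurableSet_box _ _

theorem volume_dcube {d : ℕ} (w : Fin d → ℝ) (k : ℤ) (m : Fin d → ℤ) :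
    volume (dcube d w k m) = ENNReal.ofReal (2 ^ k) ^ d := by
  rw [← volume_box (fun i => (2:ℝ) ^ k * (w i + m i))]
  congr 1
  ext x
  simp only [dcube, mem_ofPred_eq]
  refine forall_congr' fun i => ?_
  rw [show (2:ℝ) ^ k * (w i + m i + 1) = 2 ^ k * (w i + m i) + 2 ^ k by ring]

theorem volume_dcube_ne_top {d : ℕ} (w : Fin d → ℝ) (k : ℤ) (m : Fin d → ℤ) :
    volume (dcube d w k m) ≠ ∞ := by
  rw [volume_dcube]
  exact ENNReal.pow_ne_top ENNReal.ofReal_ne_top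

theorem volume_dcube_eq_mul {d : ℕ} (w w' : Fin d → ℝ) (k : ℤ) (s : ℕ) (m m' : Fin d → ℤ) :
    volume (dcube d w k m) = ENNReal.ofReal (2 ^ (d * s)) * volume (dcube d w' (k - s) m') := by
  rw [volume_dcube, volume_dcube, mul_comm d s, pow_mul, ENNReal.ofReal_pow (by positivity),
    ← mul_pow, ← ENNReal.ofReal_mul (by positivity), ← zpow_natCast (2:ℝ) s, ← zpow_add₀ two_ne_zero]
  congr 3
  ring_nf

theorem norm_sub_le_of_mem_dcube {d : ℕ} {w : Fin d → ℝ} {k : ℤ} {m : Fin d → ℤ} {x y : Rd d}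
    (hx : x ∈ dcube d w k m) (hy : y ∈ dcube d w k m) : ‖x - y‖ ≤ √d * 2 ^ k := by
  refine norm_le_sqrt_mul_of_forall_abs_le (by positivity) fun i => ?_
  have h1 := hx i
  have h2 := hy i
  rw [PiLp.sub_apply, abs_le]
  constructor <;> linarith

theorem dhalf_subset_dcube {d : ℕ} (w : Fin d → ℝ) (k : ℤ) (m : Fin d → ℤ) :
    dhalf d w k m ⊆ dcube d w k m := fun x hx i => by
  have hk : (0:ℝ) < 2 ^ k := by positivity
  have := hx i
  constructor <;> linarith

theorem mem_dcube_of_norm_sub_le {d : ℕ} {w : Fin d → ℝ} {k : ℤ} {m : Fin d → ℤ} {x y : Rd d}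
    (hy : y ∈ dhalf d w k m) (h : ‖x - y‖ < 2 ^ k / 4) : x ∈ dcube d w k m := fun i => by
  have h1 := hy i
  have h2 := abs_lt.1 ((PiLp.norm_apply_le (x - y) i).trans_lt h)
  rw [PiLp.sub_apply] at h2
  constructor <;> linarith

/-- The half cubes of the shifted grids are unions of standard dyadic cubes that are at least
four times smaller. -/
theorem GridShift.dcube_subset_dhalf {d : ℕ} {w : Fin d → ℝ} (hw : GridShift d w) {k : ℤ} {s : ℕ}
    (hs : 2 ≤ s) {m mv : Fin d → ℤ} {y : Rd d} (hy : y ∈ dcube d 0 (k - s) mv)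
    (hy' : y ∈ dhalf d w k m) : dcube d 0 (k - s) mv ⊆ dhalf d w k m := fun x hx i => by
  have hh : (0:ℝ) < 2 ^ (k - s) := by positivity
  obtain ⟨r, rfl⟩ := Nat.exists_eq_add_of_le hs
  obtain ⟨j, hj⟩ : ∃ j : ℤ, 4 * w i = j := by
    rcases hw i with h | h <;> rw [h]
    · exact ⟨0, by norm_num⟩
    · exact ⟨2, by norm_num⟩
  have hk : (2:ℝ) ^ k * 4⁻¹ = 2 ^ (k - ↑(2 + r)) * 2 ^ r := by
    rw [← zpow_natCast, ← zpow_add₀ two_ne_zero, show (4:ℝ)⁻¹ = 2 ^ (-2 : ℤ) by norm_num,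
      ← zpow_add₀ two_ne_zero]
    congr 1
    push_cast
    ring
  have hlo : (2:ℝ) ^ k * (w i + m i + 1/4)
      = 2 ^ (k - ↑(2 + r)) * ((2 ^ r * (j + 4 * m i + 1) : ℤ) : ℝ) := by
    simp only [Int.cast_mul, Int.cast_pow, Int.cast_add, Int.cast_ofNat, Int.cast_one]
    rw [← hj, ← mul_assoc, ← hk]
    ring
  have hhi : (2:ℝ) ^ k * (w i + m i + 3/4)
      = 2 ^ (k - ↑(2 + r)) * ((2 ^ r * (j + 4 * m i + 3) : ℤ) : ℝ) := by
    simp only [Int.cast_mul, Int.cast_pow, Int.cast_add, Int.cast_ofNat]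
    rw [← hj, ← mul_assoc, ← hk]
    ring
  have h1 := hx i
  have h2 := hy i
  have h3 := hy' i
  rw [hlo, hhi] at h3 ⊢
  simp only [Pi.zero_apply, zero_add] at h1 h2
  have h4 : (2 ^ r * (j + 4 * m i + 1) : ℤ) < mv i + 1 := by
    have := lt_of_mul_lt_mul_left (h3.1.trans_lt h2.2) hh.le
    exact_mod_cast this
  have h5 : mv i < (2 ^ r * (j + 4 * m i + 3) : ℤ) := by
    have := lt_of_mul_lt_mul_left (h2.1.trans_lt h3.2) hh.le
    exact_mod_cast this
  have h6 : ((2 ^ r * (j + 4 * m i + 1) : ℤ) : ℝ) ≤ mv i := by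
    exact_mod_cast Int.lt_add_one_iff.1 h4
  have h7 : (mv i : ℝ) + 1 ≤ ((2 ^ r * (j + 4 * m i + 3) : ℤ) : ℝ) := by
    exact_mod_cast h5
  exact ⟨(mul_le_mul_of_nonneg_left h6 hh.le).trans h1.1,
    h1.2.trans_le (mul_le_mul_of_nonneg_left h7 hh.le)⟩

/-- The indices of the cubes of `𝒬` of sidelength `2^{k-s}` contained in `½K`. -/
def subIdx (d : ℕ) (w : Fin d → ℝ) (Qset : Set (ℤ × (Fin d → ℤ))) (s : ℕ)
    (km : ℤ × (Fin d → ℤ)) : Set (Fin d → ℤ) :=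
  {mv | (km.1 - (s : ℤ), mv) ∈ Qset ∧ dcube d 0 (km.1 - s) mv ⊆ dhalf d w km.1 km.2}

theorem dcube_nonempty {d : ℕ} (w : Fin d → ℝ) (k : ℤ) (m : Fin d → ℤ) :
    (dcube d w k m).Nonempty := by
  have hk : (0:ℝ) < 2 ^ k := by positivity
  refine ⟨WithLp.toLp 2 fun i => (2:ℝ) ^ k * (w i + m i), fun i => ⟨le_rfl, ?_⟩⟩
  exact mul_lt_mul_of_pos_left (lt_add_one _) hk

theorem finite_subIdx {d : ℕ} (w : Fin d → ℝ) (Qset : Set (ℤ × (Fin d → ℤ))) (s : ℕ)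
    (km : ℤ × (Fin d → ℤ)) : (subIdx d w Qset s km).Finite := by
  have hh : (0:ℝ) < 2 ^ (km.1 - s) := by positivity
  set a : Fin d → ℝ := fun i => 2 ^ km.1 * (w i + km.2 i + 1/4) with ha
  set c : Fin d → ℝ := fun i => 2 ^ km.1 * (w i + km.2 i + 3/4) with hc
  refine (finite_Icc (fun i => ⌊a i / 2 ^ (km.1 - s)⌋ - 1) fun i => ⌈c i / 2 ^ (km.1 - s)⌉).subset
    fun mv hmv => ?_
  obtain ⟨y, hy⟩ := dcube_nonempty 0 (km.1 - s) mv
  have hy' := hmv.2 hy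
  refine ⟨fun i => ?_, fun i => ?_⟩
  · have h1 : a i / 2 ^ (km.1 - s) < mv i + 1 := by
      rw [div_lt_iff₀' hh]
      have := (hy' i).1.trans_lt (hy i).2
      simpa only [Pi.zero_apply, zero_add] using this
    have h2 : (⌊a i / 2 ^ (km.1 - s)⌋ : ℝ) < mv i + 1 := (Int.floor_le _).trans_lt h1
    have h3 : ⌊a i / 2 ^ (km.1 - s)⌋ < mv i + 1 := by exact_mod_cast h2
    change _ - 1 ≤ _
    linarith
  · have h1 : (mv i : ℝ) ≤ c i / 2 ^ (km.1 - s) := by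
      rw [le_div_iff₀' hh]
      have := (hy i).1.trans (hy' i).2.le
      simpa only [Pi.zero_apply, zero_add] using this
    exact_mod_cast h1.trans (Int.le_ceil _)

theorem CZData.indicator_dhalf_bsum {d : ℕ} {COm Cc c₁ c₂ lam : ℝ} {f : Rd d → ℝ}
    {Qset : Set (ℤ × (Fin d → ℤ))} {b : ℤ × (Fin d → ℤ) → Rd d → ℝ}
    (hCZ : CZData d COm Cc c₁ c₂ f lam Qset b) {w : Fin d → ℝ} (hw : GridShift d w) {s : ℕ}
    (hs : 2 ≤ s) (km : ℤ × (Fin d → ℤ)) (y : Rd d) :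
    (dhalf d w km.1 km.2).indicator (bsum d Qset b (km.1 - s)) y
      = ∑ mv ∈ (finite_subIdx w Qset s km).toFinset, b (km.1 - s, mv) y := by
  have h0 : ∀ mv, (km.1 - (s:ℤ), mv) ∈ Qset → y ∉ dcube d 0 (km.1 - s) mv →
      b (km.1 - s, mv) y = 0 := fun mv hmv hy => by
    by_contra h
    exact hy (hCZ.support_subset _ hmv h)
  by_cases hy : y ∈ dhalf d w km.1 km.2
  · rw [indicator_of_mem hy, bsum, tsum_eq_sum (s := (finite_subIdx w Qset s km).toFinset)]
    · refine Finset.sum_congr rfl fun mv hmv => ?_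
      rw [Finite.mem_toFinset] at hmv
      rw [indicator_of_mem hmv.1]
    · intro mv hmv
      rw [Finite.mem_toFinset] at hmv
      by_cases hQ : (km.1 - (s:ℤ), mv) ∈ Qset
      · rw [indicator_of_mem hQ]
        exact h0 mv hQ fun hym => hmv ⟨hQ, hw.dcube_subset_dhalf hs hym hy⟩
      · rw [indicator_of_notMem hQ]
  · rw [indicator_of_notMem hy, Finset.sum_eq_zero]
    intro mv hmv
    rw [Finite.mem_toFinset] at hmv
    exact h0 mv hmv.1 fun hym => hy (hmv.2 hym)

theorem AdmissiblePhi.TKop_eq_zero {d : ℕ} {φ : Rd d → ℝ} (hφ : AdmissiblePhi d φ)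
    (Om : Rd d → ℝ) (w : Fin d → ℝ) (k : ℤ) (m : Fin d → ℤ) (g : Rd d → ℝ) {x : Rd d}
    (hx : x ∉ dcube d w k m) : TKop d φ Om w k m g x = 0 := by
  refine (integral_congr_ae (ae_of_all _ fun y => ?_)).trans (integral_zero _ _)
  by_contra h
  obtain ⟨h1, h2⟩ := mul_ne_zero_iff.1 h
  exact hx (mem_dcube_of_norm_sub_le (mem_of_indicator_ne_zero h2)
    (hφ.norm_of_Kker_ne_zero h1).2.1)

/-- The cubes `K ∈ 𝔇^w` contained in `F` for which `b_{k-s}·χ_{½K}` is not a.e. zero. -/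
def activeCubes (d : ℕ) (w : Fin d → ℝ) (Qset : Set (ℤ × (Fin d → ℤ)))
    (b : ℤ × (Fin d → ℤ) → Rd d → ℝ) (s : ℕ) (F : Set (Rd d)) : Set (ℤ × (Fin d → ℤ)) :=
  {km | dcube d w km.1 km.2 ⊆ F ∧
    ¬ ((dhalf d w km.1 km.2).indicator (bsum d Qset b (km.1 - (s : ℤ)))
      =ᵐ[(volume : Measure (Rd d))] (fun _ => (0:ℝ)))}

/-- The union of the cubes of `𝒬`. -/
def czUnion (d : ℕ) (Qset : Set (ℤ × (Fin d → ℤ))) : Set (Rd d) :=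
  ⋃ q ∈ Qset, dcube d 0 q.1 q.2

section

variable {d : ℕ} {COm Cc c₁ c₂ lam : ℝ} {f : Rd d → ℝ} {Qset : Set (ℤ × (Fin d → ℤ))}
  {b : ℤ × (Fin d → ℤ) → Rd d → ℝ} {w : Fin d → ℝ} {s : ℕ}

theorem CZData.subIdx_nonempty (hCZ : CZData d COm Cc c₁ c₂ f lam Qset b) (hw : GridShift d w)
    (hs : 2 ≤ s) {F : Set (Rd d)} {km : ℤ × (Fin d → ℤ)}
    (hkm : km ∈ activeCubes d w Qset b s F) : (subIdx d w Qset s km).Nonempty := by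
  by_contra h
  rw [not_nonempty_iff_eq_empty] at h
  refine hkm.2 (ae_of_all _ fun y => ?_)
  rw [hCZ.indicator_dhalf_bsum hw hs, Finset.sum_eq_zero]
  intro mv hmv
  rw [Finite.mem_toFinset, h] at hmv
  exact absurd hmv (notMem_empty _)

theorem CZData.pairwiseDisjoint_subIdx (hCZ : CZData d COm Cc c₁ c₂ f lam Qset b)
    (w : Fin d → ℝ) (s : ℕ) :
    {p : (ℤ × (Fin d → ℤ)) × (Fin d → ℤ) | p.2 ∈ subIdx d w Qset s p.1}.PairwiseDisjoint
      fun p => dcube d 0 (p.1.1 - s) p.2 := by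
  rintro ⟨⟨k, m⟩, mv⟩ h ⟨⟨k', m'⟩, mv'⟩ h' hne
  by_contra hd
  have hq : (k - (s:ℤ), mv) = (k' - (s:ℤ), mv') := by
    by_contra hq
    exact hd (hCZ.pairwise_disjoint h.1 h'.1 hq)
  obtain ⟨hk, rfl⟩ := Prod.mk.inj hq
  obtain rfl : k = k' := by linarith
  obtain ⟨y, hy⟩ := dcube_nonempty 0 (k - s) mv
  obtain rfl : m = m' := eq_of_mem_dcube (dhalf_subset_dcube _ _ _ (h.2 hy))
    (dhalf_subset_dcube _ _ _ (h'.2 hy))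
  exact hne rfl

theorem dcube_subset_of_mem_subIdx {F : Set (Rd d)} {km : ℤ × (Fin d → ℤ)} {mv : Fin d → ℤ}
    (hkm : dcube d w km.1 km.2 ⊆ F) (hmv : mv ∈ subIdx d w Qset s km) :
    dcube d 0 (km.1 - s) mv ⊆ czUnion d Qset ∩ F :=
  subset_inter (subset_biUnion_of_mem (u := fun q : ℤ × (Fin d → ℤ) => dcube d 0 q.1 q.2) hmv.1)
    (hmv.2.trans ((dhalf_subset_dcube _ _ _).trans hkm))

theorem CZData.tsum_volume_activeCubes_le (hCZ : CZData d COm Cc c₁ c₂ f lam Qset b)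
    (hw : GridShift d w) (hs : 2 ≤ s) (F : Set (Rd d)) :
    ∑' km : activeCubes d w Qset b s F, volume (dcube d w km.1.1 km.1.2)
      ≤ ENNReal.ofReal (2 ^ (d * s)) * volume (czUnion d Qset ∩ F) := by
  choose q hq using fun km : activeCubes d w Qset b s F => hCZ.subIdx_nonempty hw hs km.2
  have h1 : Pairwise (Function.onFun Disjoint
      fun km : activeCubes d w Qset b s F => dcube d 0 (km.1.1 - s) (q km)) := fun x y hxy =>
    hCZ.pairwiseDisjoint_subIdx w s (x := (x.1, q x)) (hq x) (y := (y.1, q y)) (hq y)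
      fun h => hxy (Subtype.ext (Prod.mk.inj h).1)
  calc ∑' km : activeCubes d w Qset b s F, volume (dcube d w km.1.1 km.1.2)
      = ∑' km : activeCubes d w Qset b s F,
          ENNReal.ofReal (2 ^ (d * s)) * volume (dcube d 0 (km.1.1 - s) (q km)) :=
        tsum_congr fun km => volume_dcube_eq_mul _ _ _ _ _ _
    _ = ENNReal.ofReal (2 ^ (d * s))
          * volume (⋃ km : activeCubes d w Qset b s F, dcube d 0 (km.1.1 - s) (q km)) := by
        rw [ENNReal.tsum_mul_left, measure_iUnion h1 fun km => measurableSet_dcube _ _ _]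
    _ ≤ _ := by
        gcongr
        exact iUnion_subset fun km => dcube_subset_of_mem_subIdx km.2.1 (hq km)

theorem CZData.volume_czUnion_le (hCZ : CZData d COm Cc c₁ c₂ f lam Qset b) (hf : Integrable f)
    (hc₁ : 0 < c₁) (hlam : 0 < lam) (hC : 0 < COm) :
    volume (czUnion d Qset) ≤ ENNReal.ofReal (COm / (c₁ * lam) * ∫ x, |f x|) := by
  have h1 : ∀ q ∈ Qset, volume (dcube d 0 q.1 q.2)
      ≤ ENNReal.ofReal (COm / (c₁ * lam)) * ∫⁻ x in dcube d 0 q.1 q.2, ‖f x‖ₑ := fun q hq => by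
    have h := hCZ.avg_lower q hq
    have hv : 0 < (volume (dcube d 0 q.1 q.2)).toReal := by
      rw [volume_dcube]
      exact ENNReal.toReal_pos (pow_ne_zero _ (by positivity))
        (ENNReal.pow_ne_top ENNReal.ofReal_ne_top)
    rw [le_div_iff₀ hv, div_mul_eq_mul_div, div_le_iff₀ hC] at h
    rw [← ofReal_integral_norm_eq_lintegral_enorm hf.integrableOn,
      ← ENNReal.ofReal_mul (by positivity), ← ENNReal.ofReal_toReal (volume_dcube_ne_top 0 q.1 q.2)]
    refine ENNReal.ofReal_le_ofReal ?_
    simp only [Real.norm_eq_abs]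
    rw [div_mul_eq_mul_div, le_div_iff₀ (by positivity)]
    linarith
  rw [ENNReal.ofReal_mul (by positivity)]
  calc volume (czUnion d Qset) ≤ ∑' q : Qset, volume (dcube d 0 q.1.1 q.1.2) := by
        rw [czUnion, biUnion_eq_iUnion]
        exact measure_iUnion_le _
    _ ≤ ∑' q : Qset, ENNReal.ofReal (COm / (c₁ * lam))
          * ∫⁻ x in dcube d 0 q.1.1 q.1.2, ‖f x‖ₑ := ENNReal.tsum_le_tsum fun q => h1 q q.2
    _ = ENNReal.ofReal (COm / (c₁ * lam))
          * ∫⁻ x in ⋃ q : Qset, dcube d 0 q.1.1 q.1.2, ‖f x‖ₑ := by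
        rw [ENNReal.tsum_mul_left, lintegral_iUnion fun q => measurableSet_dcube _ _ _]
        exact fun x y hxy => hCZ.pairwise_disjoint x.2 y.2 (Subtype.coe_ne_coe.2 hxy)
    _ ≤ _ := by
        gcongr
        refine (setLIntegral_le_lintegral _ _).trans_eq ?_
        simp only [← ofReal_integral_norm_eq_lintegral_enorm hf, Real.norm_eq_abs]

theorem lintegral_tsum_indicator_dcube (w : Fin d → ℝ) (S : Set (ℤ × (Fin d → ℤ))) :
    ∫⁻ x, ∑' km, S.indicator (fun km' => (dcube d w km'.1 km'.2).indicator
        (fun _ => (1:ℝ≥0∞)) x) km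
      = ∑' km : S, volume (dcube d w km.1.1 km.1.2) := by
  simp only [← tsum_subtype S]
  rw [lintegral_tsum fun km =>
    (measurable_const.indicator (measurableSet_dcube _ _ _)).aemeasurable]
  exact tsum_congr fun km => lintegral_indicator_one (measurableSet_dcube _ _ _)

theorem Measurable.tsum_indicator_dcube (w : Fin d → ℝ) (S : Set (ℤ × (Fin d → ℤ))) :
    Measurable fun x => ∑' km, S.indicator (fun km' => (dcube d w km'.1 km'.2).indicator
        (fun _ => (1:ℝ≥0∞)) x) km := by
  simp only [← tsum_subtype S]
  exact Measurable.tsum fun km => measurable_const.indicator (measurableSet_dcube _ _ _)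

theorem CZData.volume_czUnion_inter_Fset_le (hCZ : CZData d COm Cc c₁ c₂ f lam Qset b)
    (hw : GridShift d w) (hs : 2 ≤ s) (n : ℕ) :
    volume (czUnion d Qset ∩ Fset d w Qset b s 4 n)
      ≤ ENNReal.ofReal (4⁻¹ ^ n) * volume (czUnion d Qset) := by
  induction n with
  | zero => simp [Fset]
  | succ n ih =>
    have h1 := mul_meas_ge_le_lintegral (μ := volume) (Measurable.tsum_indicator_dcube w
      (activeCubes d w Qset b s (Fset d w Qset b s 4 n))) (ENNReal.ofReal (4 * 2 ^ (d * s)))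
    rw [lintegral_tsum_indicator_dcube] at h1
    have h2 : ENNReal.ofReal (4 * 2 ^ (d * s)) * volume (Fset d w Qset b s 4 (n + 1))
        ≤ ENNReal.ofReal (2 ^ (d * s)) * volume (czUnion d Qset ∩ Fset d w Qset b s 4 n) := by
      refine le_trans ?_ (h1.trans (hCZ.tsum_volume_activeCubes_le hw hs _))
      refine mul_le_mul_right (measure_mono fun x hx => ?_) _
      exact le_of_lt (α := ℝ≥0∞) hx
    rw [ENNReal.ofReal_mul (by norm_num), mul_comm (ENNReal.ofReal 4), mul_assoc,
      ENNReal.mul_le_mul_iff_right (by positivity) ENNReal.ofReal_ne_top] at h2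
    have h3 : volume (Fset d w Qset b s 4 (n + 1))
        ≤ ENNReal.ofReal 4⁻¹ * volume (czUnion d Qset ∩ Fset d w Qset b s 4 n) := by
      rw [← ENNReal.mul_le_mul_iff_right (a := ENNReal.ofReal 4) (by norm_num)
        ENNReal.ofReal_ne_top, ← mul_assoc, ← ENNReal.ofReal_mul (by norm_num)]
      simpa using h2
    calc volume (czUnion d Qset ∩ Fset d w Qset b s 4 (n + 1))
        ≤ volume (Fset d w Qset b s 4 (n + 1)) := measure_mono inter_subset_right
      _ ≤ ENNReal.ofReal 4⁻¹ * (ENNReal.ofReal (4⁻¹ ^ n) * volume (czUnion d Qset)) :=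
          h3.trans (mul_le_mul_right ih _)
      _ = _ := by rw [← mul_assoc, ← ENNReal.ofReal_mul (by norm_num), pow_succ']

theorem CZData.ae_finite_activeCubes (hCZ : CZData d COm Cc c₁ c₂ f lam Qset b)
    (hw : GridShift d w) (hs : 2 ≤ s) (hU : volume (czUnion d Qset) ≠ ∞) :
    ∀ᵐ x : Rd d, {km ∈ activeCubes d w Qset b s univ | x ∈ dcube d w km.1 km.2}.Finite := by
  have h1 : ∫⁻ x, ∑' km, (activeCubes d w Qset b s univ).indicator
      (fun km' => (dcube d w km'.1 km'.2).indicator (fun _ => (1:ℝ≥0∞)) x) km ≠ ∞ := by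
    rw [lintegral_tsum_indicator_dcube]
    refine ((hCZ.tsum_volume_activeCubes_le hw hs univ).trans_lt ?_).ne
    rw [inter_univ]
    exact ENNReal.mul_lt_top ENNReal.ofReal_lt_top hU.lt_top
  filter_upwards [ae_lt_top (Measurable.tsum_indicator_dcube w _) h1] with x hx
  refine (ENNReal.finite_const_le_of_tsum_ne_top hx.ne one_ne_zero).subset fun km hkm => ?_
  rw [mem_ofPred_eq, indicator_of_mem hkm.1, indicator_of_mem hkm.2]

end

theorem MeanZeroAtom.const_mul {E : Type*} [NormedAddCommGroup E] [MeasureSpace E] {Q : Set E}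
    {b : E → ℝ} {A ρ : ℝ} (h : MeanZeroAtom Q b A ρ) {c : ℝ} (hc : |c| ≤ 1) :
    MeanZeroAtom Q (fun x => c * b x) A ρ where
  measurableSet := h.measurableSet
  measurable := h.measurable.const_mul c
  integrable := h.integrable.const_mul c
  support_subset := fun _ hx => h.support_subset (right_ne_zero_of_mul hx)
  integral_zero := by rw [integral_const_mul, h.integral_zero, mul_zero]
  l1_bound := by
    refine (lintegral_mono fun x => ?_).trans h.l1_bound
    rw [enorm_mul]
    refine mul_le_of_le_one_left' ?_
    rwa [Real.enorm_eq_ofReal_abs, ENNReal.ofReal_le_one]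
  diam := h.diam

theorem AdmissiblePhi.integrable_Kker_sub_mul {d : ℕ} {φ : Rd d → ℝ} (hφ : AdmissiblePhi d φ)
    {w : Rd d → ℝ} {M : ℝ} (hw : Measurable w) (hM : ∀ x, |w x| ≤ M) (k : ℤ) {g : Rd d → ℝ}
    (hg : Integrable g) (x : Rd d) : Integrable fun y => Kker d φ w k (x - y) * g y := by
  obtain ⟨B, -, hB⟩ := hφ.exists_bound
  exact hg.bdd_mul ((measurable_Kker hφ hw k).comp (measurable_const.sub
    measurable_id)).aestronglyMeasurable (ae_of_all _ fun y => abs_Kker_le hφ hB hM k (x - y))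

theorem lintegral_sq_le_of_tendsto {α : Type*} [MeasurableSpace α] {μ : Measure α}
    {F : ℕ → α → ℝ} {G : α → ℝ} (hF : ∀ n, AEMeasurable (F n) μ)
    (hG : ∀ᵐ x ∂μ, Filter.Tendsto (fun n => F n x) Filter.atTop (nhds (G x))) {B : ℝ≥0∞}
    (hB : ∀ n, ∫⁻ x, ‖F n x‖ₑ ^ 2 ∂μ ≤ B) : ∫⁻ x, ‖G x‖ₑ ^ 2 ∂μ ≤ B := by
  calc ∫⁻ x, ‖G x‖ₑ ^ 2 ∂μ
      = ∫⁻ x, Filter.liminf (fun n => ‖F n x‖ₑ ^ 2) Filter.atTop ∂μ := by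
        refine lintegral_congr_ae ?_
        filter_upwards [hG] with x hx
        exact (((ENNReal.continuous_pow 2).comp continuous_enorm).continuousAt.tendsto.comp
          hx).liminf_eq.symm
    _ ≤ Filter.liminf (fun n => ∫⁻ x, ‖F n x‖ₑ ^ 2 ∂μ) Filter.atTop :=
        lintegral_liminf_le' fun n => (hF n).enorm.pow_const 2
    _ ≤ B := Filter.liminf_le_of_le (by isBoundedDefault) fun b hb => by
        obtain ⟨n, hn⟩ := hb.exists
        exact hn.trans (hB n)

section

variable {d : ℕ} {COm Cc c₁ c₂ lam : ℝ} {f : Rd d → ℝ} {Qset : Set (ℤ × (Fin d → ℤ))}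
  {b : ℤ × (Fin d → ℤ) → Rd d → ℝ} {w : Fin d → ℝ} {s : ℕ}

theorem CZData.exists_meanZeroAtom (hCZ : CZData d COm Cc c₁ c₂ f lam Qset b) (hCc : 0 ≤ Cc)
    {q : ℤ × (Fin d → ℤ)} (hq : q ∈ Qset) :
    ∃ b', b q =ᵐ[volume] b' ∧
      MeanZeroAtom (dcube d 0 q.1 q.2) b' (Cc * (c₂ * lam / COm)) (√d * 2 ^ q.1) := by
  have hi := hCZ.integrable q hq
  have hm := measurableSet_dcube 0 q.1 q.2
  set b' : Rd d → ℝ := (dcube d 0 q.1 q.2).indicator (hi.aemeasurable.mk _) with hb'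
  have hae : b q =ᵐ[volume] b' := by
    filter_upwards [hi.aemeasurable.ae_eq_mk] with x hx
    by_cases hxq : x ∈ dcube d 0 q.1 q.2
    · rw [hb', indicator_of_mem hxq, hx]
    · rw [hb', indicator_of_notMem hxq]
      by_contra h
      exact hxq (hCZ.support_subset q hq h)
  refine ⟨b', hae, hm, hi.aemeasurable.measurable_mk.indicator hm, hi.congr hae,
    support_indicator_subset, ?_, ?_, fun x hx y hy => norm_sub_le_of_mem_dcube hx hy⟩
  · rw [← integral_congr_ae hae, hCZ.integral_zero q hq]
  · have hv : 0 < (volume (dcube d 0 q.1 q.2)).toReal := by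
      rw [volume_dcube]
      exact ENNReal.toReal_pos (pow_ne_zero _ (by positivity))
        (ENNReal.pow_ne_top ENNReal.ofReal_ne_top)
    have h1 := hCZ.avg_upper q hq
    rw [div_le_iff₀ hv] at h1
    have h2 : ∫ x, |b q x| ≤ Cc * (c₂ * lam / COm) * (volume (dcube d 0 q.1 q.2)).toReal := by
      rw [mul_assoc]
      exact (hCZ.l1_bound q hq).trans (mul_le_mul_of_nonneg_left h1 hCc)
    have h3 : ∫⁻ x, ‖b q x‖ₑ = ∫⁻ x, ‖b' x‖ₑ := lintegral_congr_ae (hae.fun_comp enorm)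
    rw [← h3, ← ofReal_integral_norm_eq_lintegral_enorm hi]
    conv_rhs => rw [← ENNReal.ofReal_toReal (volume_dcube_ne_top 0 q.1 q.2),
      ← ENNReal.ofReal_mul' hv.le]
    exact ENNReal.ofReal_le_ofReal h2

theorem CZData.TKop_bsum_eq_sum {φ : Rd d → ℝ} (hφ : AdmissiblePhi d φ)
    (hCZ : CZData d COm Cc c₁ c₂ f lam Qset b) (hw : GridShift d w) (hs : 2 ≤ s)
    {Om Om' : Rd d → ℝ} {M : ℝ} (hOm' : Measurable Om') (hM : ∀ x, |Om' x| ≤ M)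
    (hae : Om =ᵐ[volume] Om') {b' : ℤ × (Fin d → ℤ) → Rd d → ℝ}
    (hb' : ∀ q ∈ Qset, b q =ᵐ[volume] b' q) (km : ℤ × (Fin d → ℤ)) (x : Rd d) :
    TKop d φ Om w km.1 km.2 (bsum d Qset b (km.1 - s)) x
      = ∑ mv ∈ (finite_subIdx w Qset s km).toFinset,
          ∫ y, Kker d φ Om' km.1 (x - y) * b' (km.1 - s, mv) y := by
  have h1 : ∀ mv ∈ (finite_subIdx w Qset s km).toFinset, (km.1 - (s:ℤ), mv) ∈ Qset :=
    fun mv hmv => ((Finite.mem_toFinset _).1 hmv).1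
  rw [TKop, integral_Kker_sub_mul_congr φ hae, ← integral_finsetSum _ fun mv hmv =>
    hφ.integrable_Kker_sub_mul hOm' hM _ ((hCZ.integrable _ (h1 mv hmv)).congr (hb' _ (h1 mv hmv))) x]
  refine integral_congr_ae ?_
  have h2 : ∀ᵐ y, ∀ mv ∈ (finite_subIdx w Qset s km).toFinset,
      b (km.1 - s, mv) y = b' (km.1 - s, mv) y :=
    (Finset.eventually_all _).2 fun mv hmv => hb' _ (h1 mv hmv)
  filter_upwards [h2] with y hy
  rw [hCZ.indicator_dhalf_bsum hw hs, Finset.sum_congr rfl hy, Finset.mul_sum]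

theorem AdmissiblePhi.lintegral_sq_sum_TKop_le {φ : Rd d → ℝ} (hφ : AdmissiblePhi d φ) :
    ∃ C : ℝ, 0 < C ∧ ∃ δ : ℝ, 0 < δ ∧ ∀ {COm Cc c₁ c₂ lam : ℝ} {f : Rd d → ℝ}
      {Qset : Set (ℤ × (Fin d → ℤ))} {b : ℤ × (Fin d → ℤ) → Rd d → ℝ} {w : Fin d → ℝ} {s : ℕ},
      CZData d COm Cc c₁ c₂ f lam Qset b → 0 ≤ Cc → 0 ≤ c₂ * lam / COm → GridShift d w → 2 ≤ s →
      ∀ {Om Om' : Rd d → ℝ} {M : ℝ}, Measurable Om' → Homogeneous0 d Om' → (∀ x, |Om' x| ≤ M) →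
      Om =ᵐ[volume] Om' → ∀ (F : Set (Rd d)) (c : ℤ × (Fin d → ℤ) → ℝ), (∀ km, |c km| ≤ 1) →
      ∀ P : Finset (ℤ × (Fin d → ℤ)), (∀ km ∈ P, dcube d w km.1 km.2 ⊆ F) →
      AEMeasurable (fun x => ∑ km ∈ P,
          c km * TKop d φ Om w km.1 km.2 (bsum d Qset b (km.1 - s)) x) ∧
      ∫⁻ x, ‖∑ km ∈ P, c km * TKop d φ Om w km.1 km.2 (bsum d Qset b (km.1 - s)) x‖ₑ ^ 2
        ≤ ENNReal.ofReal (C * (M * (Cc * (c₂ * lam / COm))) ^ 2 * (2:ℝ) ^ (-δ * s))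
          * volume (czUnion d Qset ∩ F) := by
  obtain ⟨C, hC, δ, hδ, hmain⟩ := lintegral_sq_sum_conv_atoms_le hφ
  refine ⟨C, hC, δ, hδ, ?_⟩
  intro COm Cc c₁ c₂ lam f Qset b w s hCZ hCc hA hw hs Om Om' M hOm' hhom hM hae F c hc P hP
  have hex : ∀ q, ∃ b', q ∈ Qset → b q =ᵐ[volume] b' ∧
      MeanZeroAtom (dcube d 0 q.1 q.2) b' (Cc * (c₂ * lam / COm)) (√d * 2 ^ q.1) := fun q => by
    by_cases hq : q ∈ Qset
    · obtain ⟨b', hb'⟩ := hCZ.exists_meanZeroAtom hCc hq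
      exact ⟨b', fun _ => hb'⟩
    · exact ⟨0, fun h => absurd h hq⟩
  choose b' hb' using hex
  set S : Finset (Σ _ : ℤ × (Fin d → ℤ), Fin d → ℤ) :=
    P.sigma fun km => (finite_subIdx w Qset s km).toFinset with hS
  have hmem : ∀ i ∈ S, i.1 ∈ P ∧ i.2 ∈ subIdx d w Qset s i.1 := fun i hi => by
    rwa [hS, Finset.mem_sigma, Finite.mem_toFinset] at hi
  have hatom : ∀ i ∈ S, MeanZeroAtom (dcube d 0 (i.1.1 - s) i.2)
      (fun y => c i.1 * b' (i.1.1 - s, i.2) y) (Cc * (c₂ * lam / COm))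
      (√d * (2 ^ i.1.1 / 2 ^ s)) := fun i hi => by
    have := (hb' _ (hmem i hi).2.1).2.const_mul (hc i.1)
    rwa [zpow_sub₀ two_ne_zero, zpow_natCast] at this
  have hdis : (S : Set (Σ _ : ℤ × (Fin d → ℤ), Fin d → ℤ)).PairwiseDisjoint
      fun i => dcube d 0 (i.1.1 - s) i.2 := fun i hi j hj hij =>
    hCZ.pairwiseDisjoint_subIdx w s (x := (i.1, i.2)) (hmem i hi).2 (y := (j.1, j.2))
      (hmem j hj).2 fun h => hij (Sigma.ext (Prod.mk.inj h).1 (heq_of_eq (Prod.mk.inj h).2))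
  have heq : (fun x => ∑ km ∈ P, c km * TKop d φ Om w km.1 km.2 (bsum d Qset b (km.1 - s)) x)
      = fun x => ∑ i ∈ S, ∫ y, Kker d φ Om' i.1.1 (x - y) * (c i.1 * b' (i.1.1 - s, i.2) y) := by
    funext x
    rw [hS, Finset.sum_sigma]
    refine Finset.sum_congr rfl fun km _ => ?_
    rw [hCZ.TKop_bsum_eq_sum hφ hw hs hOm' hM hae fun q hq => (hb' q hq).1, Finset.mul_sum]
    refine Finset.sum_congr rfl fun mv _ => ?_
    rw [← integral_const_mul]
    exact integral_congr_ae (ae_of_all _ fun y => mul_left_comm _ _ _)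
  rw [heq]
  refine ⟨(hφ.integrable_sum_conv hOm' hM S (fun i => i.1.1) fun i hi =>
    (hatom i hi).integrable).aemeasurable, ?_⟩
  calc ∫⁻ x, ‖∑ km ∈ P, c km * TKop d φ Om w km.1 km.2 (bsum d Qset b (km.1 - s)) x‖ₑ ^ 2
      = ∫⁻ x, ‖∑ i ∈ S,
          ∫ y, Kker d φ Om' i.1.1 (x - y) * (c i.1 * b' (i.1.1 - s, i.2) y)‖ₑ ^ 2 :=
        lintegral_congr fun x => by rw [congrFun heq x]
    _ ≤ _ := hmain Om' M _ s hOm' hhom hM (mul_nonneg hCc hA) _ S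
          (fun i => dcube d 0 (i.1.1 - s) i.2) _ (fun i => i.1.1) hatom hdis
    _ ≤ _ := by
        refine mul_le_mul_right ?_ _
        rw [← measure_biUnion_finset hdis fun i _ => measurableSet_dcube _ _ _]
        exact measure_mono (iUnion₂_subset fun i hi =>
          dcube_subset_of_mem_subIdx (hP _ (hmem i hi).1) (hmem i hi).2)

end

theorem antitone_restCubes {d : ℕ} (w : Fin d → ℝ) (S : Set (ℤ × (Fin d → ℤ))) :
    Antitone (restCubes d w S) :=
  antitone_nat_of_succ_le fun _ => sdiff_subset

theorem maxCubes_restCubes_subset {d : ℕ} (w : Fin d → ℝ) (S : Set (ℤ × (Fin d → ℤ))) (u : ℕ) :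
    maxCubes d w (restCubes d w S u) ⊆ S := fun _ h =>
  antitone_restCubes w S (Nat.zero_le u) h.1

theorem eq_of_mem_maxCubes_restCubes {d : ℕ} {w : Fin d → ℝ} {S : Set (ℤ × (Fin d → ℤ))}
    {km : ℤ × (Fin d → ℤ)} {u v : ℕ} (hu : km ∈ maxCubes d w (restCubes d w S u))
    (hv : km ∈ maxCubes d w (restCubes d w S v)) : u = v := by
  wlog h : u < v generalizing u v
  · rcases (not_lt.1 h).eq_or_lt with h | h
    · exact h.symm
    · exact (this hv hu h).symm
  · exact absurd hu (antitone_restCubes w S h hv.1).2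

/-- The coefficient of the cube `K` in `Σ_{u=1}^N ε_u β_u`. -/
def genSign (d : ℕ) (w : Fin d → ℝ) (S : Set (ℤ × (Fin d → ℤ))) (ε : ℕ → ℝ) (N : ℕ)
    (km : ℤ × (Fin d → ℤ)) : ℝ :=
  ∑ u ∈ Finset.Icc 1 N, (maxCubes d w (restCubes d w S (u - 1))).indicator (fun _ => ε u) km

theorem abs_genSign_le_one {d : ℕ} (w : Fin d → ℝ) (S : Set (ℤ × (Fin d → ℤ))) {ε : ℕ → ℝ}
    (hε : ∀ u, ε u = 1 ∨ ε u = -1) (N : ℕ) (km : ℤ × (Fin d → ℤ)) :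
    |genSign d w S ε N km| ≤ 1 := by
  by_cases h : ∃ u ∈ Finset.Icc 1 N, km ∈ maxCubes d w (restCubes d w S (u - 1))
  · obtain ⟨u, hu, hkm⟩ := h
    rw [genSign, Finset.sum_eq_single_of_mem u hu, indicator_of_mem hkm]
    · rcases hε u with h | h <;> simp [h]
    · intro v hv hvu
      refine indicator_of_notMem (fun hkm' => hvu ?_) _
      have := eq_of_mem_maxCubes_restCubes hkm hkm'
      rw [Finset.mem_Icc] at hu hv
      omega
  · push Not at h
    rw [genSign, Finset.sum_eq_zero fun u hu => indicator_of_notMem (h u hu) _, abs_zero]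
    exact zero_le_one

theorem genSign_eq_zero {d : ℕ} (w : Fin d → ℝ) {S : Set (ℤ × (Fin d → ℤ))} (ε : ℕ → ℝ)
    (N : ℕ) {km : ℤ × (Fin d → ℤ)} (h : km ∉ S) : genSign d w S ε N km = 0 :=
  Finset.sum_eq_zero fun _ _ =>
    indicator_of_notMem (fun hkm => h (maxCubes_restCubes_subset w S _ hkm)) _

theorem hasSum_genSign_mul_TKop {d : ℕ} (φ Om : Rd d → ℝ) (w : Fin d → ℝ)
    (Qset : Set (ℤ × (Fin d → ℤ))) (b : ℤ × (Fin d → ℤ) → Rd d → ℝ) (s : ℕ)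
    (S : Set (ℤ × (Fin d → ℤ))) (ε : ℕ → ℝ) (N : ℕ) {x : Rd d}
    (hx : {km ∈ S | TKop d φ Om w km.1 km.2 (bsum d Qset b (km.1 - s)) x ≠ 0}.Finite) :
    HasSum (fun km => genSign d w S ε N km * TKop d φ Om w km.1 km.2 (bsum d Qset b (km.1 - s)) x)
      (∑ u ∈ Finset.Icc 1 N, ε u * betaFn d φ Om w Qset b s S u x) := by
  have h1 : ∀ u ∈ Finset.Icc 1 N, HasSum (fun km : ℤ × (Fin d → ℤ) =>
      ε u * (maxCubes d w (restCubes d w S (u - 1))).indicator (fun km' =>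
        TKop d φ Om w km'.1 km'.2 (bsum d Qset b (km'.1 - (s : ℤ))) x) km)
      (ε u * betaFn d φ Om w Qset b s S u x) := fun u _ => by
    refine (summable_of_hasFiniteSupport (hx.subset fun km hkm => ?_)).hasSum.mul_left _
    rw [Function.mem_support, indicator_apply_ne_zero] at hkm
    exact ⟨maxCubes_restCubes_subset w S _ hkm.1, hkm.2⟩
  convert hasSum_sum h1 using 2 with km
  rw [genSign, Finset.sum_mul]
  refine Finset.sum_congr rfl fun u _ => ?_
  by_cases h : km ∈ maxCubes d w (restCubes d w S (u - 1)) <;> simp [h]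

theorem eLpNorm_two_le_ofReal {α : Type*} [MeasurableSpace α] {μ : Measure α} {G : α → ℝ} {r : ℝ}
    (hr : 0 ≤ r) (h : ∫⁻ x, ‖G x‖ₑ ^ 2 ∂μ ≤ ENNReal.ofReal (r ^ 2)) :
    eLpNorm G 2 μ ≤ ENNReal.ofReal r := by
  rw [eLpNorm_eq_lintegral_rpow_enorm_toReal two_ne_zero ENNReal.ofNat_ne_top]
  simp only [ENNReal.toReal_ofNat, ENNReal.rpow_ofNat]
  calc _ ≤ ENNReal.ofReal (r ^ 2) ^ (1 / (2:ℝ)) := ENNReal.rpow_le_rpow h (by norm_num)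
    _ = ENNReal.ofReal r := by
      rw [ENNReal.ofReal_rpow_of_nonneg (sq_nonneg r) (by norm_num), ← Real.sqrt_eq_rpow,
        Real.sqrt_sq hr]

theorem AdmissiblePhi.lintegral_sq_sum_betaFn_le {d : ℕ} {φ : Rd d → ℝ} (hφ : AdmissiblePhi d φ) :
    ∃ C : ℝ, 0 < C ∧ ∃ δ : ℝ, 0 < δ ∧ ∀ {COm Cc c₁ c₂ lam : ℝ} {f : Rd d → ℝ}
      {Qset : Set (ℤ × (Fin d → ℤ))} {b : ℤ × (Fin d → ℤ) → Rd d → ℝ} {w : Fin d → ℝ} {s : ℕ},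
      CZData d COm Cc c₁ c₂ f lam Qset b → 0 < COm → 0 < Cc → 0 < c₁ → 0 < c₂ → 0 < lam →
      Integrable f → GridShift d w → 2 ≤ s →
      ∀ {Om Om' : Rd d → ℝ} {M : ℝ}, Measurable Om' → Homogeneous0 d Om' → (∀ x, |Om' x| ≤ M) →
      Om =ᵐ[volume] Om' → ∀ n, ∀ ε : ℕ → ℝ, (∀ u, ε u = 1 ∨ ε u = -1) → ∀ N,
      ∫⁻ x, ‖∑ u ∈ Finset.Icc 1 N,
          ε u * betaFn d φ Om w Qset b s (Isharp d w Qset b s 4 n) u x‖ₑ ^ 2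
        ≤ ENNReal.ofReal (C * (M * (Cc * (c₂ * lam / COm))) ^ 2 * (2:ℝ) ^ (-δ * s)
          * (4⁻¹ ^ (n - 1) * (COm / (c₁ * lam) * ∫ x, |f x|))) := by
  obtain ⟨C, hC, δ, hδ, hmain⟩ := hφ.lintegral_sq_sum_TKop_le
  refine ⟨C, hC, δ, hδ, ?_⟩
  intro COm Cc c₁ c₂ lam f Qset b w s hCZ hCOm hCc hc₁ hc₂ hlam hf hw hs Om Om' M hOm' hhom hM
    hae n ε hε N
  classical
  set S := Isharp d w Qset b s 4 n with hS
  have hSF : ∀ km ∈ S, dcube d w km.1 km.2 ⊆ Fset d w Qset b s 4 (n - 1) := fun km h => h.2.1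
  have hU := hCZ.volume_czUnion_le hf hc₁ hlam hCOm
  obtain ⟨P, hP⟩ := Filter.exists_seq_tendsto (Filter.atTop : Filter (Finset (ℤ × (Fin d → ℤ))))
  have hPS : ∀ j x, ∑ km ∈ P j with km ∈ S, genSign d w S ε N km *
        TKop d φ Om w km.1 km.2 (bsum d Qset b (km.1 - s)) x
      = ∑ km ∈ P j, genSign d w S ε N km *
        TKop d φ Om w km.1 km.2 (bsum d Qset b (km.1 - s)) x := fun j x =>
    Finset.sum_filter_of_ne fun km _ h => by
      by_contra hkm
      exact h (by rw [genSign_eq_zero w ε N hkm, zero_mul])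
  have hb := fun j => hmain hCZ hCc.le (by positivity) hw hs hOm' hhom hM hae
    (Fset d w Qset b s 4 (n - 1)) (genSign d w S ε N) (abs_genSign_le_one w S hε N)
    {km ∈ P j | km ∈ S} fun km hkm => hSF km (Finset.mem_filter.1 hkm).2
  refine (lintegral_sq_le_of_tendsto (fun j => (hb j).1) ?_ fun j => (hb j).2).trans ?_
  · filter_upwards [hCZ.ae_finite_activeCubes hw hs (hU.trans_lt ENNReal.ofReal_lt_top).ne]
      with x hx
    simp only [hPS]
    refine (hasSum_genSign_mul_TKop φ Om w Qset b s S ε N (hx.subset fun km hkm => ?_)).comp hP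
    refine ⟨⟨subset_univ _, hkm.1.1⟩, ?_⟩
    by_contra h
    exact hkm.2 (hφ.TKop_eq_zero _ _ _ _ _ h)
  · rw [ENNReal.ofReal_mul (q := 4⁻¹ ^ (n - 1) * _) (by positivity),
      ENNReal.ofReal_mul (p := 4⁻¹ ^ (n - 1)) (by positivity)]
    exact mul_le_mul_right ((hCZ.volume_czUnion_inter_Fset_le hw hs _).trans
      (mul_le_mul_right hU _)) _

theorem Omega2_eq_zero {d : ℕ} {Ω : Rd d → ℝ} (h : omegaL1 d Ω = 0) (η : ℝ) (s : ℕ) :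
    Omega2 d Ω η s = 0 := by
  funext x
  simp [Omega2, h, (abs_nonneg (Ω x)).not_gt]

theorem betaFn_zero {d : ℕ} (φ : Rd d → ℝ) (w : Fin d → ℝ) (Qset : Set (ℤ × (Fin d → ℤ)))
    (b : ℤ × (Fin d → ℤ) → Rd d → ℝ) (s : ℕ) (S : Set (ℤ × (Fin d → ℤ))) (u : ℕ) (x : Rd d) :
    betaFn d φ 0 w Qset b s S u x = 0 := by
  simp [betaFn, TKop, Kker]

theorem two_zpow_neg_sq {n : ℕ} (hn : 1 ≤ n) : (4:ℝ)⁻¹ ^ (n - 1) = 4 * ((2:ℝ) ^ (-(n:ℤ))) ^ 2 := by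
  obtain ⟨m, rfl⟩ := Nat.exists_eq_add_of_le' hn
  rw [zpow_neg, zpow_natCast, ← inv_pow, ← pow_mul, mul_comm _ 2, pow_mul]
  norm_num [pow_succ]
  ring

theorem beta_constant_le {C Cc c₁ c₂ δ lam COm L I n₂ l : ℝ} {s : ℕ} (hC : 0 < C)
    (hc₁ : 0 < c₁) (hlam : 0 < lam) (hL : 0 ≤ L) (hl : 0 < l) (hLC : l * L ≤ COm) (hCOm : 0 < COm)
    (hI : 0 ≤ I) :
    C * ((2:ℝ) ^ (δ / 4 * s) * L * (Cc * (c₂ * lam / COm))) ^ 2 * (2:ℝ) ^ (-δ * s)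
        * (4 * n₂ ^ 2 * (COm / (c₁ * lam) * I))
      ≤ 4 * C * Cc ^ 2 * c₂ ^ 2 / (c₁ * l ^ 2) * n₂ ^ 2
        * ((2:ℝ) ^ (-(δ / 2) * s) * lam * COm * I) := by
  have h1 : ((2:ℝ) ^ (δ / 4 * s)) ^ 2 * (2:ℝ) ^ (-δ * s) = (2:ℝ) ^ (-(δ / 2) * s) := by
    rw [← Real.rpow_natCast, ← Real.rpow_mul two_pos.le, ← Real.rpow_add two_pos]
    congr 1
    push_cast
    ring
  have h2 : (l * L) ^ 2 ≤ COm ^ 2 := pow_le_pow_left₀ (by positivity) hLC 2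
  have h3 : C * ((2:ℝ) ^ (δ / 4 * s) * L * (Cc * (c₂ * lam / COm))) ^ 2 * (2:ℝ) ^ (-δ * s)
        * (4 * n₂ ^ 2 * (COm / (c₁ * lam) * I))
      = (4 * C * Cc ^ 2 * c₂ ^ 2 / (c₁ * l ^ 2) * n₂ ^ 2 * (2:ℝ) ^ (-(δ / 2) * s) * lam * I / COm)
        * (l * L) ^ 2 := by
    rw [← h1]
    field_simp
  rw [h3]
  refine (mul_le_mul_of_nonneg_left h2 (by positivity)).trans_eq ?_
  field_simp

/-- The orthogonality estimate for random signs: `‖Σ_u ε_u β_u‖_{L²} ≲ 2^{-n}(2^{-δs}λC_Ω‖f‖₁)^{1/2}`. -/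
theorem beta_orthogonality_bound :
    ∀ d : ℕ, 2 ≤ d →
    ∀ Cc c₁ c₂ : ℝ, 0 < Cc → 0 < c₁ → 0 < c₂ →
    ∀ φ : Rd d → ℝ, AdmissiblePhi d φ →
    ∃ η : ℝ, 0 < η ∧ ∃ δ : ℝ, 0 < δ ∧ ∃ C₀ : ℝ, 0 < C₀ ∧ ∃ C' : ℝ, 0 < C' ∧
      ∀ Ω : Rd d → ℝ, OmegaHyp d Ω →
      ∀ f : Rd d → ℝ, Integrable f →
      ∀ lam : ℝ, 0 < lam →
      ∀ (Qset : Set (ℤ × (Fin d → ℤ))) (b : ℤ × (Fin d → ℤ) → Rd d → ℝ),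
        CZData d (constCOmega d Ω) Cc c₁ c₂ f lam Qset b →
      ∀ s : ℕ, 200 ≤ s →
      ∀ w : Fin d → ℝ, GridShift d w →
      ∀ n : ℕ, 1 ≤ n →
      ∀ ε : ℕ → ℝ, (∀ u, ε u = 1 ∨ ε u = -1) →
        eLpNorm
          (fun x : Rd d =>
            ∑ u ∈ Finset.Icc 1 ⌈C₀ * (2:ℝ) ^ (d * s)⌉₊,
              ε u * betaFn d φ (Omega2 d Ω η s) w Qset b s (Isharp d w Qset b s C₀ n) u x)
          2 volume ≤
          ENNReal.ofReal (C' * (2:ℝ) ^ (-(n:ℤ)) *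
            Real.sqrt ((2:ℝ) ^ (-δ * s) * lam * constCOmega d Ω * ∫ x : Rd d, |f x|)) := by
  intro d hd Cc c₁ c₂ hCc hc₁ hc₂ φ hφ
  obtain ⟨C, hC, δ, hδ, hmain⟩ := hφ.lintegral_sq_sum_betaFn_le
  have hlog : 0 < Real.log 2 := Real.log_pos one_lt_two
  refine ⟨δ / 4, by positivity, δ / 2, by positivity, 4, by norm_num,
    √(4 * C * Cc ^ 2 * c₂ ^ 2 / (c₁ * Real.log 2 ^ 2)), by positivity, ?_⟩
  intro Ω hΩ f hf lam hlam Qset b hCZ s hs w hw n hn ε hε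
  rcases (omegaL1_nonneg d Ω).eq_or_lt' with hL | hL
  · simp only [Omega2_eq_zero hL, betaFn_zero, mul_zero, Finset.sum_const_zero, eLpNorm_zero',
      zero_le]
  have hLC := log_two_mul_omegaL1_le_constCOmega hΩ
  have hCOm : 0 < constCOmega d Ω := (mul_pos hlog hL).trans_le hLC
  have hI : 0 ≤ ∫ x, |f x| := integral_nonneg fun _ => abs_nonneg _
  obtain ⟨Ω', hm, hhom, hM, hae⟩ := hΩ.exists_representative_Omega2 (by omega) (δ / 4) s
  refine eLpNorm_two_le_ofReal (by positivity) ((hmain hCZ hCOm hCc hc₁ hc₂ hlam hf hw (by omega)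
    hm hhom hM hae n ε hε _).trans (ENNReal.ofReal_le_ofReal ?_))
  rw [mul_pow _ √_, mul_pow √_, Real.sq_sqrt (by positivity), Real.sq_sqrt (by positivity),
    two_zpow_neg_sq hn]
  exact beta_constant_le hC hc₁ hlam hL.le hlog hLC hCOm hI
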